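/- Fix ε > 0. Let n → ∞ and for each n let k(n) be a divisor of n with k(n) ≥ K₀(n), and set p = p(n) = (2+ε)·(log n)/n. Then the G(n,p) probability of the set of graphs on {1,…,n} containing a k(n)-cycle factor tends to 1; in particular the threshold for the existence of a k-cycle factor in G(n,p), for any such k, has order (log n)/n. -/

import Mathlib

/-- `K₀(n) = log₂(2n/e) / (1 − (1/2)·log₂ 3)`. -/
noncomputable def K0 (n : ℕ) : ℝ :=
  Real.logb 2 (2 * n / Real.exp 1) / (1 - Real.logb 2 3 / 2)

/-- `G` contains a `k`-cycle factor: `n/k` vertex-disjoint cycles of length `k` covering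
all the vertices. -/
def HasCycleFactor {n : ℕ} (G : SimpleGraph (Fin n)) (k : ℕ) : Prop :=
  ∃ f : Fin (n / k) → Fin k → Fin n,
    Function.Bijective (fun p : Fin (n / k) × Fin k => f p.1 p.2) ∧
    ∀ (c : Fin (n / k)) (i : Fin k),
      G.Adj (f c i) (f c ⟨((i : ℕ) + 1) % k, Nat.mod_lt _ i.pos⟩)

/-- The `G(n,p)` probability of a set `A` of simple graphs on `{1,…,n}`:
`Σ_{H ∈ A} p^{e(H)}·(1−p)^{C(n,2)−e(H)}`. -/
noncomputable def gnpProb (n : ℕ) (p : ℝ) (A : SimpleGraph (Fin n) → Prop) : ℝ :=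
  ∑' H : {G : SimpleGraph (Fin n) // A G},
    p ^ H.1.edgeSet.ncard * (1 - p) ^ (n.choose 2 - H.1.edgeSet.ncard)

namespace CF
open Finset

section PartA
variable {α : Type*} [Fintype α] [DecidableEq α]

/-- `x` is an injective path on `V`, in which each `v ∈ J` is followed by `σ v`. -/
def PathOK (σ : α → α) (n : ℕ) (V J : Finset α) (x : Fin n → α) : Prop :=
  Function.Injective x ∧ (∀ i, x i ∈ V) ∧
    ∀ i : Fin n, x i ∈ J → ∃ i' : Fin n, (i' : ℕ) = i + 1 ∧ x i' = σ (x i)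

open Classical in
lemma path_count_from (σ : α → α) (hσ : Function.Injective σ) (n : ℕ) :
    ∀ (V J : Finset α) (h : α),
    (univ.filter (fun x : Fin (n+1) → α => PathOK σ (n+1) V J x ∧ x 0 = h ∧ V.card = n+1 ∧ J ⊆ V)).card
      ≤ (((V \ J.image σ).erase h).card).factorial := by
  induction n with
  | zero =>
    intro V J h
    refine le_trans (Finset.card_le_one.2 ?_) (Nat.factorial_pos _)
    intro a ha b hb
    simp only [mem_filter, mem_univ, true_and] at ha hb
    funext i
    have : i = 0 := by ext; simp
    rw [this, ha.2.1, hb.2.1]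
  | succ n ih =>
    intro V J h
    set H' := (V \ J.image σ).erase h with hH'
    -- general: tail is OK
    have tail_ok : ∀ x : Fin (n+2) → α, PathOK σ (n+2) V J x → x 0 = h → V.card = n+2 → J ⊆ V →
        PathOK σ (n+1) (V.erase h) (J.erase h) (Fin.tail x) ∧ (V.erase h).card = n+1 ∧
          (J.erase h) ⊆ V.erase h := by
      rintro x ⟨hi, hV, hJ⟩ h0 hc hJV
      have hhV : h ∈ V := h0 ▸ hV 0
      refine ⟨⟨?_, ?_, ?_⟩, ?_, Finset.erase_subset_erase _ hJV⟩
      · intro a b hab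
        exact Fin.succ_injective _ (hi hab)
      · intro i
        refine mem_erase.2 ⟨?_, hV _⟩
        intro he
        have := hi (he.trans h0.symm)
        exact absurd this (Fin.succ_ne_zero i)
      · intro i hiJ
        obtain ⟨i', h1, h2⟩ := hJ i.succ (mem_of_mem_erase hiJ)
        have hlt : (i : ℕ) + 1 < n + 1 := by
          have := i'.2
          simp at h1
          omega
        refine ⟨⟨i+1, hlt⟩, rfl, ?_⟩
        have : (⟨i+1, hlt⟩ : Fin (n+1)).succ = i' := by
          ext; simp [h1]
        simp only [Fin.tail]
        rw [this]; exact h2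
      · rw [card_erase_of_mem hhV, hc]; rfl
    by_cases hhJ : h ∈ J
    · refine le_trans (Finset.card_le_card_of_injOn (fun x => Fin.tail x) ?_ ?_)
        (le_trans (ih (V.erase h) (J.erase h) (σ h)) (Nat.factorial_le (card_le_card ?_)))
      · intro x hx
        simp only [coe_filter, mem_univ, true_and, Set.mem_ofPred_eq] at hx ⊢
        obtain ⟨h1, h2, h3⟩ := tail_ok x hx.1 hx.2.1 hx.2.2.1 hx.2.2.2
        refine ⟨h1, ?_, h2, h3⟩
        obtain ⟨i', h1, h2⟩ := hx.1.2.2 0 (hx.2.1 ▸ hhJ)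
        have : i' = (0 : Fin (n+1)).succ := by ext; simpa using h1
        rw [this, hx.2.1] at h2
        exact h2
      · intro x hx y hy hxy
        simp only [coe_filter, mem_univ, true_and, Set.mem_ofPred_eq] at hx hy
        rw [← Fin.cons_self_tail x, ← Fin.cons_self_tail y, hx.2.1, hy.2.1]
        exact congrArg _ hxy
      · intro v hv
        simp only [mem_erase, mem_sdiff, mem_image, not_exists, not_and] at hv
        simp only [hH', mem_erase, mem_sdiff, mem_image, not_exists, not_and]
        refine ⟨hv.2.1.1, hv.2.1.2, ?_⟩
        intro u hu huv
        by_cases huh : u = h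
        · subst huh; exact hv.1 huv.symm
        · exact hv.2.2 u ⟨huh, hu⟩ huv
    · have hJe : J.erase h = J := erase_eq_of_notMem hhJ
      have key : (univ.filter (fun x : Fin (n+2) → α => PathOK σ (n+2) V J x ∧ x 0 = h ∧ V.card = n+2 ∧ J ⊆ V)).card
        ≤ ∑ h' ∈ H', (univ.filter (fun x : Fin (n+1) → α => PathOK σ (n+1) (V.erase h) J x ∧ x 0 = h' ∧ (V.erase h).card = n+1 ∧ J ⊆ V.erase h)).card := by
        rw [← Finset.card_sigma]
        refine Finset.card_le_card_of_injOn (fun x => ⟨Fin.tail x 0, Fin.tail x⟩) ?_ ?_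
        · intro x hx
          simp only [coe_filter, mem_univ, true_and, Set.mem_ofPred_eq] at hx
          obtain ⟨h1, h2, h3⟩ := tail_ok x hx.1 hx.2.1 hx.2.2.1 hx.2.2.2
          rw [hJe] at h1 h3
          simp only [coe_sigma, Set.mem_sigma_iff, mem_coe, mem_filter, mem_univ, true_and]
          refine ⟨?_, h1, h2, h3⟩
          have hm := h1.2.1 0
          rw [hH']
          simp only [mem_erase, mem_sdiff, mem_image, not_exists, not_and] at hm ⊢
          refine ⟨hm.1, hm.2, ?_⟩
          intro u hu huv
          -- u occurs at some index
          have himg : univ.image x = V := by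
            apply Finset.eq_of_subset_of_card_le
            · intro v hv
              obtain ⟨i, -, rfl⟩ := mem_image.1 hv
              exact hx.1.2.1 i
            · rw [card_image_of_injective _ hx.1.1, hx.2.2.1]; simp
          have hu' : u ∈ univ.image x := himg ▸ hx.2.2.2 hu
          obtain ⟨i, -, rfl⟩ := mem_image.1 hu'
          obtain ⟨i', e1, e2⟩ := hx.1.2.2 i hu
          have : i' = (0 : Fin (n+1)).succ := hx.1.1 (e2.trans huv)
          rw [this] at e1
          have : i = 0 := by ext; simp at e1 ⊢; omega
          rw [this, hx.2.1] at hu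
          exact hhJ hu
        · intro x hx y hy hxy
          simp only [coe_filter, mem_univ, true_and, Set.mem_ofPred_eq] at hx hy
          rw [← Fin.cons_self_tail x, ← Fin.cons_self_tail y, hx.2.1, hy.2.1]
          simp only [Sigma.mk.injEq, heq_eq_eq] at hxy
          exact congrArg _ hxy.2
      refine key.trans ?_
      have : ∀ h' ∈ H', (univ.filter (fun x : Fin (n+1) → α => PathOK σ (n+1) (V.erase h) J x ∧ x 0 = h' ∧ (V.erase h).card = n+1 ∧ J ⊆ V.erase h)).card ≤ (H'.card - 1).factorial := by
        intro h' hh'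
        refine (ih (V.erase h) J h').trans ?_
        have : (V.erase h \ image σ J) = H' := by
          rw [hH']; ext v; simp only [mem_erase, mem_sdiff]; tauto
        rw [this, card_erase_of_mem hh']
      refine (Finset.sum_le_sum this).trans ?_
      rw [Finset.sum_const, smul_eq_mul]
      rcases Nat.eq_zero_or_pos H'.card with h0 | h0
      · rw [h0]; simp
      · rw [Nat.mul_factorial_pred h0.ne']

open Classical in
lemma path_count (σ : α → α) (hσ : Function.Injective σ) (n : ℕ) (V J : Finset α)
    (hV : V.card = n) (hJ : J ⊆ V) :
    (univ.filter (fun x : Fin n → α => PathOK σ n V J x)).card ≤ (n - J.card).factorial := by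
  rcases n with _ | n
  · refine le_trans (Finset.card_le_one.2 ?_) (Nat.factorial_pos _)
    intro a _ b _
    exact Subsingleton.elim _ _
  rcases (univ.filter (fun x : Fin (n+1) → α => PathOK σ (n+1) V J x)).eq_empty_or_nonempty with he | ⟨x0, hx0⟩
  · rw [he]; simp
  have himg : ∀ x : Fin (n+1) → α, PathOK σ (n+1) V J x → univ.image x = V := by
    intro x hx
    apply Finset.eq_of_subset_of_card_le
    · intro v hv
      obtain ⟨i, -, rfl⟩ := mem_image.1 hv
      exact hx.2.1 i
    · rw [card_image_of_injective _ hx.1, hV]; simp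
  set H := V \ J.image σ with hH
  have hsub : J.image σ ⊆ V := by
    simp only [mem_filter, mem_univ, true_and] at hx0
    intro v hv
    obtain ⟨u, hu, rfl⟩ := mem_image.1 hv
    have : u ∈ univ.image x0 := (himg x0 hx0).symm ▸ hJ hu
    obtain ⟨i, -, rfl⟩ := mem_image.1 this
    obtain ⟨i', _, h2⟩ := hx0.2.2 i hu
    rw [← h2]; exact hx0.2.1 i'
  have hHc : H.card = n + 1 - J.card := by
    rw [hH, card_sdiff_of_subset hsub, hV, card_image_of_injective _ hσ]
  have key : (univ.filter (fun x : Fin (n+1) → α => PathOK σ (n+1) V J x)).card ≤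
      ∑ h ∈ H, (univ.filter (fun x : Fin (n+1) → α => PathOK σ (n+1) V J x ∧ x 0 = h ∧ V.card = n+1 ∧ J ⊆ V)).card := by
    rw [← Finset.card_sigma]
    refine Finset.card_le_card_of_injOn (fun x => ⟨x 0, x⟩) ?_ ?_
    · intro x hx
      simp only [coe_filter, mem_univ, true_and, Set.mem_ofPred_eq] at hx
      simp only [coe_sigma, Set.mem_sigma_iff, mem_coe, mem_filter, mem_univ, true_and]
      refine ⟨?_, hx, hV, hJ⟩
      simp only [hH, mem_sdiff, mem_image, not_exists, not_and]
      refine ⟨hx.2.1 0, ?_⟩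
      intro u hu huv
      have hu' : u ∈ univ.image x := (himg x hx).symm ▸ hJ hu
      obtain ⟨i, -, rfl⟩ := mem_image.1 hu'
      obtain ⟨i', e1, e2⟩ := hx.2.2 i hu
      have : i' = 0 := hx.1 (e2.trans huv)
      rw [this] at e1
      simp at e1
    · intro x hx y hy hxy
      simp only [Sigma.mk.injEq, heq_eq_eq] at hxy
      exact hxy.2
  refine key.trans ?_
  have : ∀ h ∈ H, (univ.filter (fun x : Fin (n+1) → α => PathOK σ (n+1) V J x ∧ x 0 = h ∧ V.card = n+1 ∧ J ⊆ V)).card ≤ (H.card - 1).factorial := by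
    intro h hh
    refine (path_count_from σ hσ n V J h).trans ?_
    rw [card_erase_of_mem hh]
  refine (Finset.sum_le_sum this).trans ?_
  rw [Finset.sum_const, smul_eq_mul, ← hHc]
  rcases Nat.eq_zero_or_pos H.card with h0 | h0
  · rw [h0]; simp
  · rw [Nat.mul_factorial_pred h0.ne']

end PartA
end CF

namespace CF
open Finset

section PartA2
variable {α : Type*} [Fintype α] [DecidableEq α]

/-- successor relation of the system: one path on `[0,L)`, then circles of length `k`. -/
def nsr (k L i i' : ℕ) : Prop :=
  (i + 1 < L ∧ i' = i + 1) ∨ (L ≤ i ∧ ¬ k ∣ i + 1 ∧ i' = i + 1) ∨ (L ≤ i ∧ k ∣ i + 1 ∧ i' + k = i + 1)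

def SysOK (σ : α → α) (k L n : ℕ) (V J : Finset α) (x : Fin n → α) : Prop :=
  Function.Injective x ∧ (∀ i, x i ∈ V) ∧
    ∀ i : Fin n, x i ∈ J → ∃ i' : Fin n, nsr k L i i' ∧ x i' = σ (x i)

open Classical in
noncomputable def KS (σ : α → α) (k L n : ℕ) (V : Finset α) (j : ℕ) :
    Finset ((Fin n → α) × Finset α) :=
  univ.filter (fun p => SysOK σ k L n V p.2 p.1 ∧ p.2 ⊆ V ∧ p.2.card = j)

lemma mem_KS {σ : α → α} {k L n : ℕ} {V : Finset α} {j : ℕ} {p : (Fin n → α) × Finset α} :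
    p ∈ KS σ k L n V j ↔ SysOK σ k L n V p.2 p.1 ∧ p.2 ⊆ V ∧ p.2.card = j := by
  simp [KS]

lemma nsr_self {k n i i' : ℕ} (hi : i < n) : nsr k n i i' ↔ i + 1 < n ∧ i' = i + 1 := by
  unfold nsr
  constructor
  · rintro (h | h | h)
    · exact h
    · omega
    · omega
  · exact fun h => Or.inl h

/-- base case -/
lemma KS_base (σ : α → α) (hσ : Function.Injective σ) (k n : ℕ) (V : Finset α) (hV : V.card = n)
    (j : ℕ) : (KS σ k n n V j).card * j.factorial ≤ n.factorial := by
  classical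
  have h1 : (KS σ k n n V j).card ≤ ∑ J ∈ V.powersetCard j,
      (univ.filter (fun x : Fin n → α => PathOK σ n V J x)).card := by
    rw [← Finset.card_sigma]
    refine Finset.card_le_card_of_injOn (fun p => ⟨p.2, p.1⟩) ?_ ?_
    · intro p hp
      have hp := mem_KS.1 (mem_coe.1 hp)
      simp only [coe_sigma, Set.mem_sigma_iff, mem_coe, mem_filter, mem_univ, true_and,
        mem_powersetCard]
      refine ⟨hp.2, hp.1.1, hp.1.2.1, ?_⟩
      intro i hi
      obtain ⟨i', h1, h2⟩ := hp.1.2.2 i hi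
      exact ⟨i', ((nsr_self i.2).1 h1).2, h2⟩
    · rintro ⟨x, J⟩ _ ⟨y, J'⟩ _ h
      simp only [Sigma.mk.injEq, heq_eq_eq] at h
      ext1
      · exact h.2
      · exact h.1
  have h2 : ∀ J ∈ V.powersetCard j,
      (univ.filter (fun x : Fin n → α => PathOK σ n V J x)).card ≤ (n - j).factorial := by
    intro J hJ
    rw [mem_powersetCard] at hJ
    rw [← hJ.2]
    exact path_count σ hσ n V J hV hJ.1
  have h3 := h1.trans (Finset.sum_le_sum h2)
  rw [sum_const, card_powersetCard, hV, smul_eq_mul] at h3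
  by_cases hj : j ≤ n
  · calc _ ≤ _ := Nat.mul_le_mul_right _ h3
      _ = n.factorial := by
        rw [← Nat.choose_mul_factorial_mul_factorial hj]; ring
  · rw [Nat.choose_eq_zero_of_lt (by omega)] at h3
    have : (KS σ k n n V j).card = 0 := by omega
    rw [this]; simp

def rho (k L t i : ℕ) : ℕ :=
  if i ≤ t then i else if i < k then L + i else if i ≤ k + t then L + i - k else
    if i < k + L then i - k else i

def rhoInv (k L t m : ℕ) : ℕ :=
  if m ≤ t then m else if m < L then m + k else if m ≤ L + t then m + k - L else
    if m < L + k then m - L else m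

lemma rho_lt {k L t i n : ℕ} (ht : t < k) (hL : L + k ≤ n) (hi : i < n) :
    rho k L t i < n := by
  unfold rho; split_ifs <;> omega

lemma rhoInv_lt {k L t i n : ℕ} (ht : t < k) (hkL : k ≤ L) (hL : L + k ≤ n) (hi : i < n) :
    rhoInv k L t i < n := by
  unfold rhoInv; split_ifs <;> omega

lemma rho_rhoInv {k L t i : ℕ} (ht : t < k) (hkL : k ≤ L) :
    rho k L t (rhoInv k L t i) = i := by
  unfold rho rhoInv; split_ifs <;> omega

lemma rhoInv_rho {k L t i : ℕ} (ht : t < k) (hkL : k ≤ L) :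
    rhoInv k L t (rho k L t i) = i := by
  unfold rho rhoInv; split_ifs <;> omega

lemma nsr_rho {k L t i m : ℕ} (ht : t + 1 < k) (hkL : k ≤ L) (hd : k ∣ L)
    (h1 : rho k L t i ≠ t) (h2 : rho k L t i ≠ L + t) (h : nsr k L (rho k L t i) m) :
    nsr k (L + k) i (rhoInv k L t m) := by
  have hcirc : ∀ r, L ≤ r → r < L + k → (k ∣ r + 1 ↔ r + 1 = L + k) := by
    intro r hr1 hr2
    constructor
    · intro hdr
      have h3 : k ∣ r + 1 - L := Nat.dvd_sub hdr hd
      have := Nat.le_of_dvd (by omega) h3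
      omega
    · intro h; rw [h]; exact Nat.dvd_add hd (dvd_refl k)
  by_cases hi : i < L + k
  · left
    rcases h with h | h | h
    · unfold rhoInv
      unfold rho at h h1 h2
      split_ifs at h h1 h2 ⊢ <;> omega
    · have hr : rho k L t i < L + k := by unfold rho; split_ifs <;> omega
      rw [hcirc _ h.1 hr] at h
      unfold rhoInv
      unfold rho at h h1 h2
      split_ifs at h h1 h2 ⊢ <;> omega
    · have hr : rho k L t i < L + k := by unfold rho; split_ifs <;> omega
      rw [hcirc _ h.1 hr] at h
      unfold rhoInv
      unfold rho at h h1 h2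
      split_ifs at h h1 h2 ⊢ <;> omega
  · have hr : rho k L t i = i := by unfold rho; split_ifs <;> omega
    rw [hr] at h
    have hm : L + k ≤ m := by
      rcases h with h | h | h
      · omega
      · omega
      · have : k ∣ i + 1 - (L + k) := Nat.dvd_sub h.2.1 (Nat.dvd_add hd (dvd_refl k))
        have := Nat.le_of_dvd (by omega) this
        omega
    have hm' : rhoInv k L t m = m := by unfold rhoInv; split_ifs <;> omega
    rw [hm']
    rcases h with h | h | h
    · omega
    · right; left; exact ⟨by omega, h.2⟩
    · right; right; exact ⟨by omega, h.2⟩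

end PartA2
end CF

set_option linter.unusedSectionVars false
set_option linter.unusedVariables false
namespace CF
open Finset

section PartA3
variable {α : Type*} [Fintype α] [DecidableEq α]

def xat {n : ℕ} (x : Fin n → α) (J : Finset α) (i : ℕ) : Prop := ∃ h : i < n, x ⟨i, h⟩ ∈ J

lemma merge_ok {σ : α → α} {k L n t : ℕ} {V J : Finset α} {x : Fin n → α}
    (ht : t + 1 < k) (hkL : k ≤ L) (hd : k ∣ L) (hL : L + k ≤ n)
    (hx : SysOK σ k L n V J x) (h1 : ¬ xat x J t) (h2 : ¬ xat x J (L + t)) :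
    SysOK σ k (L + k) n V J (fun i => x ⟨rho k L t i, rho_lt (by omega) hL i.2⟩) := by
  refine ⟨?_, fun i => hx.2.1 _, ?_⟩
  · intro a b hab
    have := hx.1 hab
    simp only [Fin.mk.injEq] at this
    have h := congrArg (rhoInv k L t) this
    rw [rhoInv_rho (by omega) hkL, rhoInv_rho (by omega) hkL] at h
    exact Fin.ext h
  · intro i hi
    obtain ⟨m, hm1, hm2⟩ := hx.2.2 _ hi
    refine ⟨⟨rhoInv k L t m, rhoInv_lt (by omega) hkL hL m.2⟩, nsr_rho ht hkL hd ?_ ?_ hm1, ?_⟩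
    · intro h
      exact h1 (h ▸ ⟨_, hi⟩)
    · intro h
      exact h2 (h ▸ ⟨_, hi⟩)
    · rw [← hm2]
      exact congrArg x (Fin.ext (rho_rhoInv (by omega) hkL))

open Classical in
noncomputable def ES (σ : α → α) (k L n : ℕ) (V : Finset α) (j : ℕ) :
    Finset ((Fin n → α) × Finset α) :=
  (KS σ k L n V j).filter (fun p => ∀ s, s + 1 < k → xat p.1 p.2 s ∨ xat p.1 p.2 (L + s))

open Classical in
noncomputable def tfirst {n : ℕ} (k L : ℕ) (x : Fin n → α) (J : Finset α) : ℕ :=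
  if h : ∃ s, s + 1 < k ∧ ¬ xat x J s ∧ ¬ xat x J (L + s) then Nat.find h else 0

open Classical in
lemma tfirst_congr {n : ℕ} {k L L' : ℕ} {x y : Fin n → α} {J J' : Finset α}
    (h : ∀ s, (s + 1 < k ∧ ¬ xat x J s ∧ ¬ xat x J (L + s)) ↔
      (s + 1 < k ∧ ¬ xat y J' s ∧ ¬ xat y J' (L' + s))) :
    tfirst k L x J = tfirst k L' y J' := by
  unfold tfirst
  have : (fun s => s + 1 < k ∧ ¬ xat x J s ∧ ¬ xat x J (L + s)) =
      (fun s => s + 1 < k ∧ ¬ xat y J' s ∧ ¬ xat y J' (L' + s)) := funext fun s => propext (h s)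
  by_cases hx : ∃ s, s + 1 < k ∧ ¬ xat x J s ∧ ¬ xat x J (L + s)
  · have hy := (exists_congr h).1 hx
    rw [dif_pos hx, dif_pos hy]
    exact le_antisymm (Nat.find_min' _ ((h _).2 (Nat.find_spec hy)))
      (Nat.find_min' _ ((h _).1 (Nat.find_spec hx)))
  · have hy := fun h' => hx ((exists_congr h).2 h')
    rw [dif_neg hx, dif_neg hy]

lemma merge_pred {k L n t : ℕ} {J : Finset α} {x : Fin n → α}
    (ht : t + 1 < k) (hkL : k ≤ L) (hL : L + k ≤ n) (s : ℕ) (hs : s + 1 < k) :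
    let x' : Fin n → α := fun i => x ⟨rho k L t i, rho_lt (by omega) hL i.2⟩
    ((¬ xat x' J s ∧ ¬ xat x' J (k + s)) ↔ (¬ xat x J s ∧ ¬ xat x J (L + s))) := by
  intro x'
  have e : ∀ i, xat x' J i ↔ (i < n ∧ xat x J (rho k L t i)) := by
    intro i
    constructor
    · rintro ⟨h, h'⟩
      exact ⟨h, _, h'⟩
    · rintro ⟨h, _, h'⟩
      exact ⟨h, h'⟩
  rw [e, e]
  have a1 : s < n := by omega
  have a2 : k + s < n := by omega
  simp only [a1, a2, true_and]
  by_cases hst : s ≤ t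
  · have e1 : rho k L t s = s := by unfold rho; split_ifs; omega
    have e2 : rho k L t (k + s) = L + s := by unfold rho; split_ifs <;> omega
    rw [e1, e2]
  · have e1 : rho k L t s = L + s := by unfold rho; split_ifs <;> omega
    have e2 : rho k L t (k + s) = s := by unfold rho; split_ifs <;> omega
    rw [e1, e2]; tauto

lemma merge_card (σ : α → α) {k L n : ℕ} (V : Finset α) (j : ℕ)
    (hkL : k ≤ L) (hd : k ∣ L) (hL : L + k ≤ n) :
    (KS σ k L n V j).card ≤ (KS σ k (L + k) n V j).card + (ES σ k L n V j).card := by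
  classical
  rw [← Finset.card_filter_add_card_filter_not (s := KS σ k L n V j)
    (fun p => ∀ s, s + 1 < k → xat p.1 p.2 s ∨ xat p.1 p.2 (L + s))]
  rw [add_comm]
  refine Nat.add_le_add ?_ (le_of_eq ?_)
  swap
  · unfold ES; congr
  have key : ∀ p : (Fin n → α) × Finset α,
      p ∈ (KS σ k L n V j).filter (fun p => ¬ ∀ s, s + 1 < k → xat p.1 p.2 s ∨ xat p.1 p.2 (L + s)) →
      p ∈ KS σ k L n V j ∧ ∃ s, s + 1 < k ∧ ¬ xat p.1 p.2 s ∧ ¬ xat p.1 p.2 (L + s) := by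
    intro p hp
    rw [mem_filter] at hp
    refine ⟨hp.1, ?_⟩
    have := hp.2
    push Not at this
    exact this
  have htf : ∀ p : (Fin n → α) × Finset α,
      (∃ s, s + 1 < k ∧ ¬ xat p.1 p.2 s ∧ ¬ xat p.1 p.2 (L + s)) →
      tfirst k L p.1 p.2 + 1 < k ∧ ¬ xat p.1 p.2 (tfirst k L p.1 p.2) ∧
        ¬ xat p.1 p.2 (L + tfirst k L p.1 p.2) := by
    intro p h
    unfold tfirst
    rw [dif_pos h]
    exact Nat.find_spec h
  let mp : (Fin n → α) × Finset α → (Fin n → α) × Finset α := fun p =>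
    (fun i => if h : rho k L (tfirst k L p.1 p.2) i < n then p.1 ⟨rho k L (tfirst k L p.1 p.2) i, h⟩
      else p.1 i, p.2)
  have hmp : ∀ p (h : tfirst k L p.1 p.2 + 1 < k), mp p =
      ((fun i : Fin n => p.1 ⟨rho k L (tfirst k L p.1 p.2) i, rho_lt (by omega) hL i.2⟩), p.2) := by
    intro p h
    refine Prod.ext ?_ rfl
    funext i
    exact dif_pos (rho_lt (by omega) hL i.2)
  have hrec : ∀ p (h : ∃ s, s + 1 < k ∧ ¬ xat p.1 p.2 s ∧ ¬ xat p.1 p.2 (L + s)),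
      tfirst k k (mp p).1 (mp p).2 = tfirst k L p.1 p.2 := by
    intro p h
    have h' := htf p h
    rw [hmp p h'.1]
    have hiff : ∀ s, (s + 1 < k ∧ ¬ xat (fun i : Fin n => p.1 ⟨rho k L (tfirst k L p.1 p.2) i, rho_lt (by omega) hL i.2⟩) p.2 s ∧ ¬ xat (fun i : Fin n => p.1 ⟨rho k L (tfirst k L p.1 p.2) i, rho_lt (by omega) hL i.2⟩) p.2 (k + s)) ↔ (s + 1 < k ∧ ¬ xat p.1 p.2 s ∧ ¬ xat p.1 p.2 (L + s)) := by
      intro s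
      refine and_congr_right fun hs => ?_
      exact merge_pred (x := p.1) (J := p.2) h'.1 hkL hL s hs
    exact tfirst_congr hiff
  refine Finset.card_le_card_of_injOn mp ?_ ?_
  · intro p hp
    obtain ⟨hK, he⟩ := key p hp
    have h' := htf p he
    rw [hmp p h'.1, mem_coe, mem_KS]
    rw [mem_KS] at hK
    exact ⟨merge_ok h'.1 hkL hd hL hK.1 h'.2.1 h'.2.2, hK.2⟩
  · intro p hp q hq hpq
    obtain ⟨hK, he⟩ := key p hp
    obtain ⟨hK', he'⟩ := key q hq
    have ht : tfirst k L p.1 p.2 = tfirst k L q.1 q.2 := by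
      rw [← hrec p he, ← hrec q he', hpq]
    have hp1 := htf p he
    have hq1 := htf q he'
    rw [hmp p hp1.1, hmp q hq1.1] at hpq
    have h2 := congrArg Prod.snd hpq
    have h1 := congrArg Prod.fst hpq
    simp only at h1 h2
    refine Prod.ext ?_ h2
    funext i
    have := congrFun h1 ⟨rhoInv k L (tfirst k L p.1 p.2) i, rhoInv_lt (by omega) hkL hL i.2⟩
    simp only [← ht] at this
    have e : (⟨rho k L (tfirst k L p.1 p.2) (rhoInv k L (tfirst k L p.1 p.2) i), rho_lt (by omega) hL (rhoInv_lt (by omega) hkL hL i.2)⟩ : Fin n) = i := by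
      ext; exact rho_rhoInv (by omega) hkL
    rw [e] at this
    exact this

end PartA3
end CF

set_option linter.unusedSectionVars false
set_option linter.unusedVariables false
namespace CF
open Finset

section PartA4
variable {α : Type*} [Fintype α] [DecidableEq α]

def embD (k L' i : ℕ) : ℕ := if i < k then i else L' + i
def embR (k L' m : ℕ) : ℕ := if m < L' then m + k else m + 2 * k

open Classical in
noncomputable def XD (σ : α → α) (k : ℕ) (V : Finset α) (I : Finset (Fin (2 * k))) :
    Finset (Fin (2 * k) → α) :=
  univ.filter (fun y => Function.Injective y ∧ (∀ i, y i ∈ V) ∧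
    ∀ i i' : Fin (2 * k), (i' : ℕ) = i + 1 → (i' : ℕ) ≠ k → i ∈ I → y i' = σ (y i))

lemma XD_card (σ : α → α) (k : ℕ) (hk : 0 < k) (V : Finset α) (hV : 0 < V.card) (I : Finset (Fin (2 * k))) :
    (XD σ k V I).card ≤ V.card ^ (2 * k - I.card + 2) := by
  classical
  set U : Finset (Fin (2 * k)) := univ.filter (fun i' => (i' : ℕ) = 0 ∨ (i' : ℕ) = k ∨
    ∃ i ∈ univ \ I, (i' : ℕ) = (i : Fin (2 * k)) + 1) with hU
  have hUc : U.card ≤ 2 * k - I.card + 2 := by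
    have : U ⊆ {⟨0, by omega⟩, ⟨k, by omega⟩} ∪ (univ \ I).image (fun i : Fin (2 * k) => if h : (i : ℕ) + 1 < 2 * k then ⟨i + 1, h⟩ else ⟨0, by omega⟩) := by
      intro i' hi'
      simp only [hU, mem_filter, mem_univ, true_and] at hi'
      rcases hi' with h | h | ⟨i, hi, h⟩
      · apply mem_union_left; simp; left; ext; exact h
      · apply mem_union_left; simp; right; ext; exact h
      · apply mem_union_right
        refine mem_image.2 ⟨i, hi, ?_⟩
        rw [dif_pos (by have := i'.2; omega)]
        ext; exact h.symm
    refine (card_le_card this).trans ((card_union_le _ _).trans ?_)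
    have h1 := Finset.card_le_two (a := (⟨0, by omega⟩ : Fin (2 * k))) (b := ⟨k, by omega⟩)
    have h2 : ((univ \ I).image (fun i : Fin (2 * k) => if h : (i : ℕ) + 1 < 2 * k then (⟨i + 1, h⟩ : Fin (2 * k)) else ⟨0, by omega⟩)).card ≤ 2 * k - I.card := by
      refine card_image_le.trans ?_
      rw [card_univ_sdiff]; simp
    omega
  have h : (XD σ k V I).card ≤ (Fintype.piFinset (fun _ : U => V)).card := by
    refine Finset.card_le_card_of_injOn (fun y u => y u) ?_ ?_
    · intro y hy
      simp only [XD, coe_filter, mem_univ, true_and, Set.mem_ofPred_eq] at hy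
      simp only [mem_coe, Fintype.mem_piFinset]
      exact fun u => hy.2.1 u
    · intro y hy z hz hyz
      simp only [XD, coe_filter, mem_univ, true_and, Set.mem_ofPred_eq] at hy hz
      have hyz' : ∀ u ∈ U, y u = z u := fun u hu => congrFun hyz ⟨u, hu⟩
      have : ∀ (a : ℕ) (ha : a < 2 * k), y ⟨a, ha⟩ = z ⟨a, ha⟩ := by
        intro a
        induction a with
        | zero => intro ha; apply hyz'; simp [hU]
        | succ a ih =>
          intro ha
          by_cases hu : (⟨a + 1, ha⟩ : Fin (2 * k)) ∈ U
          · exact hyz' _ hu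
          · simp only [hU, mem_filter, mem_univ, true_and, not_or, not_exists, not_and] at hu
            have hI : (⟨a, by omega⟩ : Fin (2 * k)) ∈ I := by
              by_contra hn
              exact hu.2.2 ⟨a, by omega⟩ (by simpa using hn) rfl
            rw [hy.2.2 ⟨a, by omega⟩ ⟨a + 1, ha⟩ rfl hu.2.1 hI,
              hz.2.2 ⟨a, by omega⟩ ⟨a + 1, ha⟩ rfl hu.2.1 hI, ih]
      funext i
      exact this i i.2
  refine h.trans ?_
  rw [Fintype.card_piFinset, prod_const, card_univ, Fintype.card_coe]
  exact Nat.pow_le_pow_right hV hUc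

lemma ES_card (σ : α → α) {k L' n' : ℕ} (hk : 0 < k) (hd : k ∣ L') (hL : L' ≤ n') (V : Finset α)
    (hV : V.card = n' + 2 * k) (j : ℕ) (M : ℕ → ℕ)
    (hM : ∀ g, k ≤ g + 1 → g ≤ j → ∀ V' : Finset α, V'.card = n' → (KS σ k L' n' V' (j - g)).card ≤ M g) :
    (ES σ k (L' + k) (n' + 2 * k) V j).card ≤
      ∑ I ∈ (univ : Finset (Finset (Fin (2 * k)))).filter (fun I => k ≤ I.card + 1 ∧ I.card ≤ j),
        V.card ^ (2 * k - I.card + 2) * M I.card := by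
  classical
  have hDlt : ∀ i : Fin (2 * k), embD k L' i < n' + 2 * k := by
    intro i; have := i.2; unfold embD; split_ifs <;> omega
  have hRlt : ∀ i : Fin n', embR k L' i < n' + 2 * k := by
    intro i; have := i.2; unfold embR; split_ifs <;> omega
  let xD : (Fin (n' + 2 * k) → α) → Fin (2 * k) → α := fun x i => x ⟨embD k L' i, hDlt i⟩
  let xR : (Fin (n' + 2 * k) → α) → Fin n' → α := fun x i => x ⟨embR k L' i, hRlt i⟩
  let Iof : (Fin (n' + 2 * k) → α) × Finset α → Finset (Fin (2 * k)) :=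
    fun p => univ.filter (fun i => xD p.1 i ∈ p.2)
  have hDR : ∀ (i : Fin (2 * k)) (m : Fin n'), embD k L' i ≠ embR k L' m := by
    intro i m; have := i.2; have := m.2; unfold embD embR; split_ifs <;> omega
  have hcov : ∀ m, m < n' + 2 * k → (∃ i : Fin (2 * k), embD k L' i = m) ∨ (∃ i : Fin n', embR k L' i = m) := by
    intro m hm
    by_cases h1 : m < k
    · left; exact ⟨⟨m, by omega⟩, by unfold embD; simp [h1]⟩
    by_cases h2 : m < L' + k
    · right; refine ⟨⟨m - k, by omega⟩, ?_⟩; unfold embR; simp only; split_ifs <;> omega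
    by_cases h3 : m < L' + 2 * k
    · left; refine ⟨⟨m - L', by omega⟩, ?_⟩; unfold embD; simp only; split_ifs <;> omega
    · right; refine ⟨⟨m - 2 * k, by omega⟩, ?_⟩; unfold embR; simp only; split_ifs <;> omega
  have hDinj : ∀ i i' : Fin (2 * k), embD k L' i = embD k L' i' → i = i' := by
    intro i i' h; ext; have := i.2; have := i'.2; unfold embD at h; split_ifs at h <;> omega
  have hRinj : ∀ i i' : Fin n', embR k L' i = embR k L' i' → i = i' := by
    intro i i' h; ext; have := i.2; have := i'.2; unfold embR at h; split_ifs at h <;> omega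
  have step1 : (ES σ k (L' + k) (n' + 2 * k) V j).card ≤
      ∑ I ∈ (univ : Finset (Finset (Fin (2 * k)))).filter (fun I => k ≤ I.card + 1 ∧ I.card ≤ j),
        ∑ y ∈ XD σ k V I, (KS σ k L' n' (V \ univ.image y) (j - I.card)).card := by
    simp_rw [← Finset.card_sigma]
    refine Finset.card_le_card_of_injOn (fun p => ⟨Iof p, xD p.1, (xR p.1, p.2 \ univ.image (xD p.1))⟩) ?_ ?_
    · rintro ⟨x, J⟩ hp
      simp only [ES, coe_filter, Set.mem_ofPred_eq, mem_KS] at hp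
      obtain ⟨⟨⟨hx1, hx2, hx3⟩, hJV, hJc⟩, hE⟩ := hp
      have hDi : Function.Injective (xD x) := by
        intro a b hab
        have := hx1 hab
        simp only [Fin.mk.injEq] at this
        exact hDinj _ _ this
      have hRi : Function.Injective (xR x) := by
        intro a b hab
        have := hx1 hab
        simp only [Fin.mk.injEq] at this
        exact hRinj _ _ this
      have hIimg : (Iof (x, J)).image (xD x) = J ∩ univ.image (xD x) := by
        ext v
        simp only [Iof, mem_image, mem_filter, mem_univ, true_and, mem_inter]
        constructor
        · rintro ⟨i, h1, rfl⟩; exact ⟨h1, i, rfl⟩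
        · rintro ⟨h1, i, rfl⟩; exact ⟨i, h1, rfl⟩
      have hIc : (Iof (x, J)).card = (J ∩ univ.image (xD x)).card := by
        rw [← hIimg, card_image_of_injective _ hDi]
      simp only [coe_sigma, Set.mem_sigma_iff, mem_coe, mem_filter, mem_univ, true_and, mem_KS]
      refine ⟨⟨?_, ?_⟩, ?_, ⟨hRi, ?_, ?_⟩, ?_, ?_⟩
      · -- size of I
        have hsub : (univ : Finset (Fin (k - 1))).card ≤ (Iof (x, J)).card := by
          have : ∀ s : Fin (k - 1), ∃ i ∈ Iof (x, J), (i : ℕ) = s ∨ (i : ℕ) = k + s := by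
            intro s
            have hs := s.2
            rcases hE s (by omega) with ⟨h, h'⟩ | ⟨h, h'⟩
            · refine ⟨⟨s, by omega⟩, ?_, Or.inl rfl⟩
              simp only [Iof, mem_filter, mem_univ, true_and, xD]
              have e : embD k L' s = s := by unfold embD; split_ifs <;> omega
              simp only [e]; exact h'
            · refine ⟨⟨k + s, by omega⟩, ?_, Or.inr rfl⟩
              simp only [Iof, mem_filter, mem_univ, true_and, xD]
              have e : embD k L' (k + s) = L' + k + s := by unfold embD; split_ifs <;> omega
              simp only [e]; exact h'
          choose φ h1 h2 using this
          refine Finset.card_le_card_of_injOn φ (fun s _ => h1 s) ?_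
          intro a _ b _ hab
          have ha := h2 a
          have hb := h2 b
          rw [hab] at ha
          ext
          have := a.2; have := b.2
          omega
        simp at hsub
        omega
      · rw [hIc, ← hJc]; exact card_le_card inter_subset_left
      · simp only [XD, mem_filter, mem_univ, true_and]
        refine ⟨hDi, fun i => hx2 _, ?_⟩
        intro i i' hii hik hiI
        simp only [Iof, mem_filter, mem_univ, true_and] at hiI
        obtain ⟨m, hm1, hm2⟩ := hx3 _ hiI
        change _ = σ (x _)
        rw [← hm2]
        have hi := i.2
        have hi' := i'.2
        have : (m : ℕ) = embD k L' i' := by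
          simp only [nsr] at hm1
          have hdd : k ≤ i → (k ∣ embD k L' i + 1 ↔ k ∣ (i : ℕ) + 1) := by
            intro hki
            have : embD k L' i + 1 = L' + (i + 1) := by unfold embD; split_ifs <;> omega
            rw [this]
            exact (Nat.dvd_add_right hd)
          have hnd : k ≤ i → ¬ k ∣ (i : ℕ) + 1 := by
            intro hki hdv
            have := Nat.le_of_dvd (by omega) (Nat.dvd_sub hdv (dvd_refl k))
            omega
          rcases hm1 with h | h | h
          · rw [h.2]; have h := h.1; unfold embD at h ⊢; split_ifs at h ⊢ <;> omega
          · rw [h.2.2]; have h := h.1; unfold embD at h ⊢; split_ifs at h ⊢ <;> omega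
          · exfalso
            have hki : k ≤ i := by
              have := h.1; unfold embD at this; split_ifs at this <;> omega
            exact hnd hki ((hdd hki).1 h.2.1)
        exact congrArg x (Fin.ext this.symm)
      · intro i
        simp only [mem_sdiff, mem_image, mem_univ, true_and, not_exists]
        refine ⟨hx2 _, fun a ha => ?_⟩
        have := hx1 ha
        simp only [Fin.mk.injEq] at this
        exact hDR _ _ this
      · intro i hi
        simp only [mem_sdiff] at hi
        obtain ⟨m, hm1, hm2⟩ := hx3 _ hi.1
        have hi2 := i.2
        have : ∃ i' : Fin n', nsr k L' i i' ∧ embR k L' i' = m := by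
          simp only [nsr] at hm1
          have hm := m.2
          by_cases hc : (i : ℕ) < L'
          · have e : embR k L' i = i + k := by unfold embR; split_ifs; rfl
            rw [e] at hm1
            have : (i : ℕ) + 1 < L' ∧ (m : ℕ) = i + k + 1 := by omega
            refine ⟨⟨i + 1, by omega⟩, Or.inl ⟨this.1, rfl⟩, ?_⟩
            unfold embR; simp only; split_ifs <;> omega
          · have e : embR k L' i = i + 2 * k := by unfold embR; split_ifs; rfl
            rw [e] at hm1
            have hdd : k ∣ i + 2 * k + 1 ↔ k ∣ (i : ℕ) + 1 := by
              rw [show (i : ℕ) + 2 * k + 1 = (i + 1) + 2 * k by ring]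
              exact Nat.dvd_add_left (Dvd.intro_left 2 rfl)
            rcases hm1 with h | h | h
            · omega
            · rw [hdd] at h
              refine ⟨⟨i + 1, by omega⟩, Or.inr (Or.inl ⟨by omega, h.2.1, rfl⟩), ?_⟩
              unfold embR; simp only; split_ifs <;> omega
            · rw [hdd] at h
              have h5 : k ≤ i + 1 - L' := Nat.le_of_dvd (by omega) (Nat.dvd_sub h.2.1 hd)
              refine ⟨⟨i + 1 - k, by omega⟩, Or.inr (Or.inr ⟨by omega, h.2.1, by simp only; omega⟩), ?_⟩
              unfold embR; simp only; split_ifs <;> omega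
        obtain ⟨i', h1, h2⟩ := this
        refine ⟨i', h1, ?_⟩
        change x _ = σ (x _)
        rw [← hm2]
        exact congrArg x (Fin.ext h2)
      · exact sdiff_subset_sdiff hJV (subset_refl _)
      · rw [card_sdiff, hJc, hIc, inter_comm]
    · rintro ⟨x, J⟩ _ ⟨x', J'⟩ _ h
      simp only [Sigma.mk.injEq] at h
      obtain ⟨h1, h2⟩ := h
      have h2 := eq_of_heq h2
      simp only [Sigma.mk.injEq] at h2
      obtain ⟨h2, h3⟩ := h2
      have h3 := eq_of_heq h3
      simp only [Prod.mk.injEq] at h3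
      obtain ⟨h3, h4⟩ := h3
      have hx : x = x' := by
        funext m
        rcases hcov m m.2 with ⟨i, hi⟩ | ⟨i, hi⟩
        · have := congrFun h2 i
          have e : (⟨embD k L' i, hDlt i⟩ : Fin (n' + 2 * k)) = m := Fin.ext hi
          simp only [xD, e] at this
          exact this
        · have := congrFun h3 i
          have e : (⟨embR k L' i, hRlt i⟩ : Fin (n' + 2 * k)) = m := Fin.ext hi
          simp only [xR, e] at this
          exact this
      subst hx
      refine Prod.ext rfl ?_
      ext v
      simp only
      by_cases hv : v ∈ univ.image (xD x)
      · obtain ⟨i, -, rfl⟩ := mem_image.1 hv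
        have := Finset.ext_iff.1 h1 i
        simp only [Iof, mem_filter, mem_univ, true_and] at this
        exact this
      · have := Finset.ext_iff.1 h4 v
        simp only [mem_sdiff, hv, not_false_eq_true, and_true] at this
        exact this
  refine step1.trans (Finset.sum_le_sum fun I hI => ?_)
  simp only [mem_filter, mem_univ, true_and] at hI
  refine le_trans (Finset.sum_le_card_nsmul _ _ (M I.card) ?_) ?_
  · intro y hy
    refine hM _ hI.1 hI.2 _ ?_
    simp only [XD, mem_filter, mem_univ, true_and] at hy
    rw [card_sdiff_of_subset, card_image_of_injective _ hy.1, hV]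
    · simp
    · intro v hv
      obtain ⟨i, -, rfl⟩ := mem_image.1 hv
      exact hy.2.1 i
  · rw [smul_eq_mul]
    exact Nat.mul_le_mul_right _ (XD_card σ k hk V (by omega) I)

end PartA4
end CF

set_option linter.unusedSectionVars false
set_option linter.unusedVariables false
namespace CF
open Finset

section PartA5
variable {α : Type*} [Fintype α] [DecidableEq α]

lemma ks0_ok {σ : α → α} {k n : ℕ} (hk : 0 < k) {V J : Finset α} {x : Fin n → α}
    (hx : SysOK σ k 0 n V J x) (J' : Finset α) (hJ' : J' ⊆ J) (h : ¬ xat x J' (k - 1)) :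
    SysOK σ k k n V J' x := by
  refine ⟨hx.1, hx.2.1, fun i hi => ?_⟩
  obtain ⟨m, hm1, hm2⟩ := hx.2.2 i (hJ' hi)
  refine ⟨m, ?_, hm2⟩
  have hne : (i : ℕ) ≠ k - 1 := by
    intro he
    exact h (he ▸ ⟨i.2, hi⟩)
  unfold nsr at hm1 ⊢
  by_cases hik : (i : ℕ) + 1 < k
  · left
    have : ¬ k ∣ (i : ℕ) + 1 := fun hd => by have := Nat.le_of_dvd (by omega) hd; omega
    rcases hm1 with h | h | h
    · omega
    · exact ⟨hik, h.2.2⟩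
    · exact absurd h.2.1 this
  · have : k ≤ i := by omega
    rcases hm1 with h | h | h
    · omega
    · exact Or.inr (Or.inl ⟨this, h.2⟩)
    · exact Or.inr (Or.inr ⟨this, h.2⟩)

lemma KS0_card (σ : α → α) {k n : ℕ} (hk : 0 < k) (hn : k ≤ n) (V : Finset α) (j : ℕ) :
    (KS σ k 0 n V j).card ≤ (KS σ k k n V j).card +
      (if j = 0 then 0 else (KS σ k k n V (j - 1)).card) := by
  classical
  rw [← Finset.card_filter_add_card_filter_not (s := KS σ k 0 n V j)
    (fun p => ¬ xat p.1 p.2 (k - 1))]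
  refine Nat.add_le_add (card_le_card ?_) ?_
  · intro p hp
    rw [mem_filter, mem_KS] at hp
    exact mem_KS.2 ⟨ks0_ok hk hp.1.1 _ (subset_refl _) hp.2, hp.1.2⟩
  · have hlt : k - 1 < n := by omega
    have hJp : ∀ p ∈ (KS σ k 0 n V j).filter (fun p => ¬ ¬ xat p.1 p.2 (k - 1)),
        p.1 ⟨k - 1, hlt⟩ ∈ p.2 := by
      intro p hp
      rw [mem_filter, not_not] at hp
      exact hp.2.2
    split_ifs with hj
    · rw [Nat.le_zero, card_eq_zero, eq_empty_iff_forall_notMem]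
      intro p hp
      have h1 := hJp p hp
      rw [mem_filter, mem_KS, hj, card_eq_zero] at hp
      rw [hp.1.2.2] at h1
      simp at h1
    · refine Finset.card_le_card_of_injOn (fun p => (p.1, p.2.erase (p.1 ⟨k - 1, hlt⟩))) ?_ ?_
      · intro p hp
        have h1 := hJp p hp
        rw [mem_coe, mem_filter, mem_KS] at hp
        rw [mem_coe, mem_KS]
        refine ⟨ks0_ok hk hp.1.1 _ (erase_subset _ _) ?_, (erase_subset _ _).trans hp.1.2.1, ?_⟩
        · rintro ⟨_, h⟩
          simp at h
        · simp only
          rw [card_erase_of_mem h1, hp.1.2.2]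
      · intro p hp q hq hpq
        have h1 := hJp p hp
        have h2 := hJp q hq
        simp only [Prod.mk.injEq] at hpq
        refine Prod.ext hpq.1 ?_
        rw [← insert_erase h1, ← insert_erase h2, hpq.2, hpq.1]

lemma fac_bound {j g n : ℕ} {γ : ℝ} (hg : g ≤ j) (hj : (j : ℝ) ≤ γ * n) :
    (j.factorial : ℝ) ≤ (j - g).factorial * (γ * n) ^ g := by
  have h1 : (j - g).factorial * j.descFactorial g = j.factorial := Nat.factorial_mul_descFactorial hg
  rw [← h1]
  push_cast
  have h2 : (j.descFactorial g : ℝ) ≤ (j : ℝ) ^ g := by exact_mod_cast Nat.descFactorial_le_pow j g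
  have h3 : (j : ℝ) ^ g ≤ (γ * n) ^ g := pow_le_pow_left₀ (by positivity) hj g
  gcongr
  exact h2.trans h3

noncomputable def eps0 (k n0 : ℕ) (γ : ℝ) : ℝ := 16 ^ k * ((n0 : ℝ) + 1) ^ 3 * γ ^ (k - 1)

lemma eps0_nonneg (k n0 : ℕ) {γ : ℝ} (hγ : 0 < γ) : 0 ≤ eps0 k n0 γ := by unfold eps0; positivity

theorem KS_bound (σ : α → α) (hσ : Function.Injective σ) (k : ℕ) (hk : 2 ≤ k) (γ : ℝ) (hγ : 0 < γ)
    (hγ' : γ ≤ 1 / 8) (n0 : ℕ) : ∀ b L n : ℕ, ∀ (V : Finset α) (j : ℕ), k ∣ L → k ≤ L →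
      n = L + b * k → n ≤ n0 → V.card = n → (j : ℝ) ≤ γ * n →
      ((KS σ k L n V j).card : ℝ) * j.factorial ≤ (1 + eps0 k n0 γ) ^ b * n.factorial := by
  intro b
  have he0 := eps0_nonneg k n0 hγ
  induction b using Nat.strong_induction_on with
  | _ b ih =>
  intro L n V j hd hkL hn hn0 hV hj
  rcases b with _ | b
  · have : n = L := by simpa using hn
    subst this
    simp only [pow_zero, one_mul]
    exact_mod_cast KS_base σ hσ k n V hV j
  obtain ⟨L', rfl⟩ : ∃ L', L = L' + k := ⟨L - k, by omega⟩
  have hd' : k ∣ L' := (Nat.dvd_add_left (dvd_refl k)).1 hd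
  obtain ⟨n', hn'⟩ : ∃ n', n' = L' + b * k := ⟨_, rfl⟩
  have hnn : n = n' + 2 * k := by rw [hn, hn']; ring
  subst hnn
  have h1 := merge_card σ V j hkL hd (show L' + k + k ≤ n' + 2 * k by rw [hn']; nlinarith)
  have h2 := ih b (by omega) (L' + k + k) (n' + 2 * k) V j (Nat.dvd_add hd (dvd_refl k)) (by omega)
    (by rw [hn']; ring) hn0 hV hj
  set B : ℝ := (1 + eps0 k n0 γ) ^ b with hB
  have hB1 : 1 ≤ B := one_le_pow₀ (by linarith)
  set n := n' + 2 * k with hnd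
  -- rest
  have hkR : (2 : ℝ) ≤ k := by exact_mod_cast hk
  have hgk : ∀ g, k ≤ g + 1 → (k : ℝ) / 2 ≤ g := by
    intro g hg
    have : (k : ℝ) ≤ g + 1 := by exact_mod_cast hg
    linarith
  have hrest : ∀ g, k ≤ g + 1 → g ≤ j → ∀ V' : Finset α, V'.card = n' →
      ((KS σ k L' n' V' (j - g)).card : ℝ) * (j - g).factorial ≤ B * n'.factorial * (1 + j) := by
    intro g hg hgj V' hV'
    have hj' : ((j - g : ℕ) : ℝ) ≤ γ * n' := by
      rw [Nat.cast_sub hgj]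
      have h3 := hgk g hg
      have : (n : ℝ) = n' + 2 * k := by rw [hnd]; push_cast; ring
      rw [this] at hj
      nlinarith
    rcases Nat.eq_zero_or_pos L' with hL0 | hL0
    · subst hL0
      rcases b with _ | b
      · exfalso
        have h3 := hgk g hg
        have h4 : (n : ℝ) = 2 * k := by rw [hnd, hn']; push_cast; ring
        rw [h4] at hj
        have h5 : (g : ℝ) ≤ j := by exact_mod_cast hgj
        nlinarith
      have hB' : (1 + eps0 k n0 γ) ^ b ≤ B := by
        rw [hB]; exact pow_le_pow_right₀ (by linarith) (by omega)
      have hc := KS0_card σ (by omega : 0 < k) (by rw [hn']; nlinarith : k ≤ n') V' (j - g)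
      have i1 := ih b (by omega) k n' V' (j - g) (dvd_refl k) le_rfl (by rw [hn']; ring) (by omega) hV' hj'
      have hjj : ((j - g : ℕ) : ℝ) ≤ j := by exact_mod_cast Nat.sub_le _ _
      by_cases hz : j - g = 0
      · rw [if_pos hz, add_zero] at hc
        have hc' : ((KS σ k 0 n' V' (j - g)).card : ℝ) ≤ (KS σ k k n' V' (j - g)).card := by exact_mod_cast hc
        calc _ ≤ ((KS σ k k n' V' (j - g)).card : ℝ) * (j - g).factorial := by gcongr
          _ ≤ _ := i1
          _ ≤ B * n'.factorial := by gcongr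
          _ ≤ B * n'.factorial * (1 + j) := by
            refine le_mul_of_one_le_right (by positivity) ?_
            have : (0 : ℝ) ≤ j := by positivity
            linarith
      · rw [if_neg hz] at hc
        have hc' : ((KS σ k 0 n' V' (j - g)).card : ℝ) ≤ (KS σ k k n' V' (j - g)).card + (KS σ k k n' V' (j - g - 1)).card := by exact_mod_cast hc
        have i2 := ih b (by omega) k n' V' (j - g - 1) (dvd_refl k) le_rfl (by rw [hn']; ring) (by omega) hV'
          (le_trans (by exact_mod_cast Nat.sub_le _ _) hj')
        have hf : ((j - g).factorial : ℝ) = (j - g : ℕ) * (j - g - 1).factorial := by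
          exact_mod_cast (Nat.mul_factorial_pred hz).symm
        calc _ ≤ (((KS σ k k n' V' (j - g)).card : ℝ) + (KS σ k k n' V' (j - g - 1)).card) * (j - g).factorial := by gcongr
          _ = ((KS σ k k n' V' (j - g)).card : ℝ) * (j - g).factorial + (j - g : ℕ) * (((KS σ k k n' V' (j - g - 1)).card : ℝ) * (j - g - 1).factorial) := by
            rw [hf]; ring
          _ ≤ B * n'.factorial + j * (B * n'.factorial) := by
            refine add_le_add (i1.trans (by gcongr)) ?_
            exact mul_le_mul hjj (i2.trans (by gcongr)) (by positivity) (by positivity)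
          _ = _ := by ring
    · have hkL' : k ≤ L' := Nat.le_of_dvd hL0 hd'
      have i1 := ih b (by omega) L' n' V' (j - g) hd' hkL' hn' (by omega) hV' hj'
      refine i1.trans ?_
      refine le_mul_of_one_le_right (by positivity) ?_
      have : (0 : ℝ) ≤ j := by positivity
      linarith
  have hES := ES_card σ (by omega : 0 < k) hd' (by rw [hn']; omega : L' ≤ n') V hV j
    (fun g => ⌊B * n'.factorial * (1 + j) / (j - g).factorial⌋₊) (by
      intro g hg hgj V' hV'
      apply Nat.le_floor
      rw [le_div_iff₀ (by positivity)]
      exact hrest g hg hgj V' hV')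
  have hESR : ((ES σ k (L' + k) n V j).card : ℝ) * j.factorial ≤ B * n.factorial * eps0 k n0 γ := by
    have : ((ES σ k (L' + k) n V j).card : ℝ) ≤ ∑ I ∈ (univ : Finset (Finset (Fin (2 * k)))).filter (fun I => k ≤ I.card + 1 ∧ I.card ≤ j),
        (n : ℝ) ^ (2 * k - I.card + 2) * (B * n'.factorial * (1 + j) / (j - I.card).factorial) := by
      calc ((ES σ k (L' + k) n V j).card : ℝ) ≤ _ := Nat.cast_le.2 hES
        _ ≤ _ := by
          push_cast
          refine Finset.sum_le_sum fun I hI => ?_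
          rw [hV]
          gcongr
          exact Nat.floor_le (by positivity)
    calc ((ES σ k (L' + k) n V j).card : ℝ) * j.factorial ≤ _ := mul_le_mul_of_nonneg_right this (by positivity)
      _ = ∑ I ∈ (univ : Finset (Finset (Fin (2 * k)))).filter (fun I => k ≤ I.card + 1 ∧ I.card ≤ j),
        (n : ℝ) ^ (2 * k - I.card + 2) * (B * n'.factorial * (1 + j) / (j - I.card).factorial) * j.factorial := by
        rw [Finset.sum_mul]
      _ ≤ ∑ I ∈ (univ : Finset (Finset (Fin (2 * k)))).filter (fun I => k ≤ I.card + 1 ∧ I.card ≤ j),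
        (B * n.factorial * (4 ^ k * ((n0 : ℝ) + 1) ^ 3 * γ ^ (k - 1))) := by
        refine Finset.sum_le_sum fun I hI => ?_
        simp only [mem_filter, mem_univ, true_and] at hI
        have hIc : I.card ≤ 2 * k := by simpa using Finset.card_le_univ I
        set g := I.card with hg
        have hgj : (g : ℝ) ≤ j := by exact_mod_cast hI.2
        have hn4 : (4 : ℝ) * k ≤ n := by
          have := hgk g hI.1
          have : (0:ℝ) ≤ n := by positivity
          nlinarith
        have hf := fac_bound (n := n) hI.2 hj
        have hn'2 : (n : ℝ) / 2 ≤ (n' + 1 : ℕ) := by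
          have : (n : ℝ) = n' + 2 * k := by rw [hnd]; push_cast; ring
          push_cast; linarith
        have hfac : (n'.factorial : ℝ) * (n : ℝ) ^ (2 * k) ≤ n.factorial * 4 ^ k := by
          have h5 : (n'.factorial : ℝ) * ((n' + 1 : ℕ) : ℝ) ^ (2 * k) ≤ n.factorial := by
            exact_mod_cast Nat.factorial_mul_pow_le_factorial
          have h6 : (n'.factorial : ℝ) * ((n : ℝ) / 2) ^ (2 * k) ≤ n.factorial :=
            le_trans (by gcongr) h5
          rw [div_pow, pow_mul (2 : ℝ) 2 k] at h6
          norm_num at h6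
          rw [← mul_div_assoc, div_le_iff₀ (by positivity)] at h6
          exact h6
        have hjn : (j : ℝ) ≤ n0 := by
          have : (n : ℝ) ≤ n0 := by exact_mod_cast hn0
          have : (0:ℝ) ≤ n := by positivity
          nlinarith
        have hnn0 : (n : ℝ) ≤ n0 + 1 := by
          have : (n : ℝ) ≤ n0 := by exact_mod_cast hn0
          linarith
        have hγg : γ ^ g ≤ γ ^ (k - 1) := pow_le_pow_of_le_one hγ.le (by linarith) (by omega)
        have hpow : (n : ℝ) ^ (2 * k - g + 2) * n ^ g = n ^ (2 * k) * n ^ 2 := by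
          rw [← pow_add, ← pow_add]; congr 1; omega
        calc (n : ℝ) ^ (2 * k - g + 2) * (B * n'.factorial * (1 + j) / (j - g).factorial) * j.factorial
            ≤ (n : ℝ) ^ (2 * k - g + 2) * (B * n'.factorial * (1 + j) / (j - g).factorial) * ((j - g).factorial * (γ * n) ^ g) := by gcongr
          _ = (n : ℝ) ^ (2 * k - g + 2) * (B * n'.factorial * (1 + j) * (γ * n) ^ g) := by
            field_simp
          _ = B * (n'.factorial * ((n : ℝ) ^ (2 * k - g + 2) * n ^ g)) * (1 + j) * γ ^ g := by
            rw [mul_pow]; ring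
          _ = B * ((n'.factorial * (n : ℝ) ^ (2 * k)) * n ^ 2) * (1 + j) * γ ^ g := by
            rw [hpow]; ring
          _ ≤ B * ((n.factorial * 4 ^ k) * (n0 + 1) ^ 2) * (1 + n0) * γ ^ (k - 1) := by
            gcongr
          _ = _ := by ring
      _ ≤ _ := by
        rw [Finset.sum_const, nsmul_eq_mul]
        have hc : (((univ : Finset (Finset (Fin (2 * k)))).filter (fun I => k ≤ I.card + 1 ∧ I.card ≤ j)).card : ℝ) ≤ 4 ^ k := by
          have : ((univ : Finset (Finset (Fin (2 * k)))).filter (fun I => k ≤ I.card + 1 ∧ I.card ≤ j)).card ≤ 4 ^ k := by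
            refine (card_filter_le _ _).trans ?_
            simp [pow_mul]
          exact_mod_cast this
        calc _ ≤ (4 : ℝ) ^ k * (B * n.factorial * (4 ^ k * ((n0 : ℝ) + 1) ^ 3 * γ ^ (k - 1))) := by gcongr
          _ = B * n.factorial * eps0 k n0 γ := by
            unfold eps0
            rw [show (16 : ℝ) = 4 * 4 by norm_num, mul_pow]; ring
  have h1R : ((KS σ k (L' + k) n V j).card : ℝ) ≤ (KS σ k (L' + k + k) n V j).card + (ES σ k (L' + k) n V j).card := by exact_mod_cast h1
  calc _ ≤ (((KS σ k (L' + k + k) n V j).card : ℝ) + (ES σ k (L' + k) n V j).card) * j.factorial := by gcongr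
    _ ≤ B * n.factorial + B * n.factorial * eps0 k n0 γ := by
      rw [add_mul]; exact add_le_add h2 hESR
    _ = _ := by rw [pow_succ, ← hB]; ring

end PartA5
end CF

set_option linter.unusedSectionVars false
set_option linter.unusedVariables false
namespace CF
open Finset

section PartA6
variable {α : Type*} [Fintype α] [DecidableEq α]

/-- arrangements -/
abbrev Arr (N k : ℕ) (α : Type*) := (Fin N × Fin k) ≃ α

def nx (N k : ℕ) [NeZero k] : Equiv.Perm (Fin N × Fin k) :=
  Equiv.prodCongr (Equiv.refl _) (Equiv.addRight (1 : Fin k))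

def sg {N k : ℕ} [NeZero k] (f : Arr N k α) : Equiv.Perm α := f.symm.trans ((nx N k).trans f)

lemma sg_apply {N k : ℕ} [NeZero k] (f : Arr N k α) (c : Fin N) (s : Fin k) :
    sg f (f (c, s)) = f (c, s + 1) := by
  simp [sg, nx]

def rot {N k : ℕ} [NeZero k] [NeZero N] (q : Fin N × Fin k) : Equiv.Perm (Fin N × Fin k) :=
  Equiv.prodCongr (Equiv.addRight q.1) (Equiv.addRight q.2)

lemma sg_rot {N k : ℕ} [NeZero k] [NeZero N] (q : Fin N × Fin k) (f : Arr N k α) :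
    sg ((rot q).trans f) = sg f := by
  ext x
  obtain ⟨⟨c, s⟩, rfl⟩ := ((rot q).trans f).surjective x
  rw [sg_apply]
  simp only [Equiv.trans_apply, rot, Equiv.prodCongr_apply, Prod.map, Equiv.coe_addRight]
  rw [sg_apply, add_right_comm]

def xof {N k : ℕ} (f : Arr N k α) : Fin (N * k) → α := fun i => f (finProdFinEquiv.symm i)

lemma val_add_one {k : ℕ} [NeZero k] (s : Fin k) : ((s + 1 : Fin k) : ℕ) = if (s : ℕ) + 1 = k then 0 else (s : ℕ) + 1 := by
  have hs := s.2
  rw [Fin.val_add, Fin.val_one']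
  rw [Nat.add_mod_mod]
  split_ifs with h
  · rw [h]; simp
  · exact Nat.mod_eq_of_lt (by omega)

lemma xof_ok {N k : ℕ} [NeZero k] (σ : Equiv.Perm α) (J : Finset α) (f : Arr N k α)
    (h : ∀ x ∈ J, sg f x = σ x) : SysOK σ k 0 (N * k) univ J (xof f) := by
  refine ⟨?_, fun _ => mem_univ _, ?_⟩
  · intro a b hab
    exact finProdFinEquiv.symm.injective (f.injective hab)
  · intro i hi
    obtain ⟨⟨c, s⟩, rfl⟩ := finProdFinEquiv.surjective i
    have hs := s.2
    refine ⟨finProdFinEquiv (c, s + 1), ?_, ?_⟩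
    · simp only [nsr, finProdFinEquiv_apply_val, val_add_one]
      have hdd : k ∣ (s : ℕ) + k * c + 1 ↔ k ∣ (s : ℕ) + 1 := by
        rw [show (s : ℕ) + k * c + 1 = (s + 1) + k * c by ring]
        exact Nat.dvd_add_left (Dvd.intro _ rfl)
      right
      rw [hdd]
      split_ifs with hc
      · right; rw [hc]; exact ⟨Nat.zero_le _, dvd_refl _, by omega⟩
      · left
        refine ⟨Nat.zero_le _, fun hd => ?_, by omega⟩
        have := Nat.le_of_dvd (by omega) hd
        omega
    · rw [← h _ hi]
      simp only [xof, Equiv.symm_apply_apply, sg_apply]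

open Classical in
noncomputable def PairS (N k : ℕ) [NeZero k] (σ : Equiv.Perm α) (j : ℕ) :
    Finset (Arr N k α × Finset α) :=
  univ.filter (fun p => p.2.card = j ∧ ∀ x ∈ p.2, sg p.1 x = σ x)

lemma pair_le (N k : ℕ) [NeZero k] [NeZero N] (hc : Fintype.card α = N * k) (σ : Equiv.Perm α) (j : ℕ) :
    (N * k - j) * (PairS N k σ j).card ≤ (N * k) * (KS σ k k (N * k) (univ : Finset α) j).card := by
  classical
  have hk : 0 < k := Nat.pos_of_ne_zero (NeZero.ne k)
  let e : Fin k := ⟨k - 1, by omega⟩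
  have h1 : (PairS N k σ j).sum (fun p => (univ.filter (fun q : Fin N × Fin k => p.1 q ∉ p.2)).card)
      = (N * k - j) * (PairS N k σ j).card := by
    rw [Finset.sum_const_nat, mul_comm]
    intro p hp
    simp only [PairS, mem_filter, mem_univ, true_and] at hp
    have : (univ.filter (fun q : Fin N × Fin k => p.1 q ∉ p.2)).card = (univ \ p.2).card := by
      refine Finset.card_bij (fun q _ => p.1 q) ?_ ?_ ?_
      · intro q hq; simpa using hq
      · intro a _ b _ hab; exact p.1.injective hab
      · intro b hb; refine ⟨p.1.symm b, ?_, by simp⟩; simpa using hb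
    rw [this, card_univ_sdiff, hc, hp.1]
  rw [← h1, ← Finset.card_sigma]
  have h2 : N * k = (univ : Finset (Fin N × Fin k)).card := by simp
  have h4 : (N * k) * (KS σ k k (N * k) (univ : Finset α) j).card = (univ : Finset (Fin N × Fin k)).card * (KS σ k k (N * k) (univ : Finset α) j).card := by
    simp
  rw [h4, show (univ : Finset (Fin N × Fin k)).card * (KS σ k k (N * k) (univ : Finset α) j).card = ((univ : Finset (Fin N × Fin k)) ×ˢ (KS σ k k (N * k) (univ : Finset α) j)).card from (card_product _ _).symm]
  refine Finset.card_le_card_of_injOn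
    (fun p => (p.2, (xof ((rot (p.2 - (0, e))).trans p.1.1), p.1.2))) ?_ ?_
  · rintro ⟨⟨f, J⟩, q⟩ hp
    simp only [coe_sigma, Set.mem_sigma_iff, mem_coe, mem_filter, mem_univ, true_and, PairS] at hp
    obtain ⟨⟨hJ, hs⟩, hq⟩ := hp
    simp only [mem_coe, mem_product, mem_univ, true_and, mem_KS, subset_univ]
    refine ⟨ks0_ok hk (xof_ok σ J _ ?_) _ (subset_refl _) ?_, hJ⟩
    · rw [sg_rot]; exact hs
    · rintro ⟨h, h'⟩
      have hh : (⟨k - 1, h⟩ : Fin (N * k)) = finProdFinEquiv ((0 : Fin N), e) := by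
        ext; simp [e]
      rw [hh] at h'
      simp only [xof, Equiv.symm_apply_apply, Equiv.trans_apply] at h'
      have : rot (q - (0, e)) ((0 : Fin N), e) = q := by
        ext <;> simp [rot]
      rw [this] at h'
      exact hq h'
  · rintro ⟨⟨f, J⟩, q⟩ _ ⟨⟨f', J'⟩, q'⟩ _ h
    simp only [Prod.mk.injEq] at h
    obtain ⟨rfl, h1, rfl⟩ := h
    have : f = f' := by
      ext x
      have h2 := congrFun h1 (finProdFinEquiv ((rot (q - (0, e))).symm x))
      simpa [xof] using h2
    subst this
    rfl

noncomputable def Psi (N k : ℕ) (γ : ℝ) (u : ℕ) : ℝ :=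
  ((N * k : ℕ) : ℝ) / ((N * k : ℕ) - u) * (1 + eps0 k (N * k) γ) ^ N

lemma pair_bound (N k : ℕ) [NeZero k] [NeZero N] (hk : 2 ≤ k) (hc : Fintype.card α = N * k)
    (σ : Equiv.Perm α) (j : ℕ) (γ : ℝ) (hγ : 0 < γ) (hγ' : γ ≤ 1 / 8) (hj : (j : ℝ) ≤ γ * (N * k : ℕ)) :
    ((PairS N k σ j).card : ℝ) * j.factorial ≤ Psi N k γ j * (N * k).factorial := by
  have hN : 0 < N := Nat.pos_of_ne_zero (NeZero.ne N)
  have he := eps0_nonneg k (N * k) hγ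
  have h1 := KS_bound σ σ.injective k hk γ hγ hγ' (N * k) (N - 1) k (N * k) (univ : Finset α) j
    (dvd_refl k) le_rfl (by obtain ⟨m, rfl⟩ : ∃ m, N = m + 1 := ⟨N - 1, by omega⟩; simp; ring) le_rfl
    (by simpa using hc) hj
  have h2 := pair_le N k hc σ j
  have hn : (0 : ℝ) < (N * k : ℕ) := by
    have : 0 < N * k := by positivity
    exact_mod_cast this
  have hjn : j ≤ N * k := by
    have : (j : ℝ) ≤ (N * k : ℕ) := by nlinarith
    exact_mod_cast this
  have h2' : (((N * k : ℕ) : ℝ) - j) * (PairS N k σ j).card ≤ (N * k : ℕ) * (KS σ k k (N * k) (univ : Finset α) j).card := by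
    rw [← Nat.cast_sub hjn]; exact_mod_cast h2
  have hpos : (0 : ℝ) < ((N * k : ℕ) : ℝ) - j := by nlinarith
  have h3 : ((PairS N k σ j).card : ℝ) ≤ ((N * k : ℕ) : ℝ) / ((N * k : ℕ) - j) * (KS σ k k (N * k) (univ : Finset α) j).card := by
    rw [div_mul_eq_mul_div, le_div_iff₀ hpos]; linarith
  calc _ ≤ ((N * k : ℕ) : ℝ) / ((N * k : ℕ) - j) * (KS σ k k (N * k) (univ : Finset α) j).card * j.factorial := by gcongr
    _ = ((N * k : ℕ) : ℝ) / ((N * k : ℕ) - j) * ((KS σ k k (N * k) (univ : Finset α) j).card * j.factorial) := by ring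
    _ ≤ ((N * k : ℕ) : ℝ) / ((N * k : ℕ) - j) * ((1 + eps0 k (N * k) γ) ^ (N - 1) * (N * k).factorial) := by
      gcongr
    _ ≤ ((N * k : ℕ) : ℝ) / ((N * k : ℕ) - j) * ((1 + eps0 k (N * k) γ) ^ N * (N * k).factorial) := by
      gcongr
      · linarith
      · omega
    _ = _ := by unfold Psi; ring

open Classical in
noncomputable def QS (N k : ℕ) [NeZero k] (U : Finset α) : Finset (Arr N k α × Arr N k α) :=
  univ.filter (fun p => ∀ x ∈ U, sg p.1 x = sg p.2 x)

lemma sg_trans {N k : ℕ} [NeZero k] (f : Arr N k α) (τ : Equiv.Perm α) (x : α) :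
    sg (f.trans τ) (τ x) = τ (sg f x) := by
  simp [sg]

lemma QS_card_image (N k : ℕ) [NeZero k] (U : Finset α) (τ : Equiv.Perm α) :
    (QS N k U).card ≤ (QS N k (U.image τ)).card := by
  classical
  refine Finset.card_le_card_of_injOn (fun p => (p.1.trans τ, p.2.trans τ)) ?_ ?_
  · intro p hp
    simp only [QS, coe_filter, mem_univ, true_and, Set.mem_ofPred_eq] at hp ⊢
    intro y hy
    obtain ⟨x, hx, rfl⟩ := mem_image.1 hy
    rw [sg_trans, sg_trans, hp x hx]
  · rintro ⟨f, f'⟩ _ ⟨g, g'⟩ _ h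
    simp only [Prod.mk.injEq] at h
    refine Prod.ext ?_ ?_
    · ext x; exact τ.injective (congrArg (fun e : Arr N k α => e x) h.1)
    · ext x; exact τ.injective (congrArg (fun e : Arr N k α => e x) h.2)

lemma QS_card_le_of_card (N k : ℕ) [NeZero k] (U W : Finset α) (h : U.card = W.card) :
    (QS N k U).card ≤ (QS N k W).card := by
  classical
  have e : {x // x ∈ U} ≃ {x // x ∈ W} := Finset.equivOfCardEq h
  have := e.extendSubtype
  have h2 : U.image (e.extendSubtype) = W := by
    apply Finset.eq_of_subset_of_card_le
    · intro y hy
      obtain ⟨x, hx, rfl⟩ := mem_image.1 hy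
      exact e.extendSubtype_mem x hx
    · rw [card_image_of_injective _ (Equiv.injective _), h]
  rw [← h2]
  exact QS_card_image N k U _

lemma card_Arr (N k : ℕ) (hc : Fintype.card α = N * k) :
    Fintype.card (Arr N k α) = (N * k).factorial := by
  classical
  have e : (Fin N × Fin k) ≃ α := Fintype.equivOfCardEq (by simp [hc])
  rw [Fintype.card_equiv e]; simp

lemma QS_bound (N k : ℕ) [NeZero k] [NeZero N] (hk : 2 ≤ k) (hc : Fintype.card α = N * k)
    (U : Finset α) (γ : ℝ) (hγ : 0 < γ) (hγ' : γ ≤ 1 / 8) (hj : (U.card : ℝ) ≤ γ * (N * k : ℕ)) :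
    ((QS N k U).card : ℝ) ≤ (N * k).factorial * (N * k - U.card).factorial * Psi N k γ U.card := by
  classical
  set u := U.card with hu
  have hun : u ≤ N * k := by rw [hu, ← hc]; exact card_le_univ U
  have h1 : (N * k).choose u * (QS N k U).card ≤ ∑ f' : Arr N k α, (PairS N k (sg f') u).card := by
    calc (N * k).choose u * (QS N k U).card = ∑ W ∈ (univ : Finset α).powersetCard u, (QS N k U).card := by
          rw [sum_const, card_powersetCard, card_univ, hc, smul_eq_mul]
      _ ≤ ∑ W ∈ (univ : Finset α).powersetCard u, (QS N k W).card := by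
          refine Finset.sum_le_sum fun W hW => QS_card_le_of_card N k U W ?_
          rw [(mem_powersetCard.1 hW).2]
      _ ≤ _ := by
          rw [← card_sigma, ← card_sigma]
          refine Finset.card_le_card_of_injOn (fun p => ⟨p.2.2, (p.2.1, p.1)⟩) ?_ ?_
          · rintro ⟨W, f, f'⟩ hp
            simp only [coe_sigma, Set.mem_sigma_iff, mem_coe, mem_filter, mem_univ, true_and, PairS, QS, mem_powersetCard] at hp ⊢
            exact ⟨hp.1.2, hp.2⟩
          · rintro ⟨W, f, f'⟩ _ ⟨W', g, g'⟩ _ h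
            simp only [Sigma.mk.injEq, heq_eq_eq, Prod.mk.injEq] at h
            obtain ⟨rfl, rfl, rfl⟩ := h
            rfl
  have h2 : (((N * k).choose u * (QS N k U).card : ℕ) : ℝ) * u.factorial ≤ (N * k).factorial * (Psi N k γ u * (N * k).factorial) := by
    calc _ ≤ ((∑ f' : Arr N k α, (PairS N k (sg f') u).card : ℕ) : ℝ) * u.factorial := by
          gcongr
      _ = ∑ f' : Arr N k α, ((PairS N k (sg f') u).card : ℝ) * u.factorial := by
          push_cast; rw [Finset.sum_mul]
      _ ≤ ∑ f' : Arr N k α, Psi N k γ u * (N * k).factorial :=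
          Finset.sum_le_sum fun f' _ => pair_bound N k hk hc _ u γ hγ hγ' hj
      _ = _ := by rw [sum_const, card_univ, card_Arr N k hc, nsmul_eq_mul]
  have h3 := Nat.choose_mul_factorial_mul_factorial hun
  have h3' : ((N * k).choose u : ℝ) * u.factorial * (N * k - u).factorial = (N * k).factorial := by exact_mod_cast h3
  push_cast at h2
  have hp : (0 : ℝ) < ((N * k).choose u : ℝ) * u.factorial := by
    have := Nat.choose_pos hun
    positivity
  rw [← mul_le_mul_iff_of_pos_left hp]
  calc _ = ((N * k).choose u : ℝ) * (QS N k U).card * u.factorial := by ring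
    _ ≤ _ := h2
    _ = _ := by rw [← h3']; ring

end PartA6
end CF

set_option linter.unusedSectionVars false
set_option linter.unusedVariables false
namespace CF
open Finset

section PartA7
variable {α : Type*} [Fintype α] [DecidableEq α]

lemma card_perm_fix (A : Finset α) :
    (univ.filter (fun π : Equiv.Perm α => ∀ x ∈ A, π x = x)).card = (Fintype.card α - A.card).factorial := by
  classical
  have e := Equiv.Perm.subtypeEquivSubtypePerm (fun x : α => x ∉ A)
  have h1 := Fintype.card_congr e
  rw [Fintype.card_perm] at h1
  have h2 : Fintype.card {x : α // x ∉ A} = Fintype.card α - A.card := by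
    rw [Fintype.card_subtype_compl, Fintype.card_coe]
  rw [h2] at h1
  rw [h1, Fintype.card_subtype]
  congr 1
  ext π
  simp

lemma card_perm_ext (A : Finset α) (φ : α → α) (hφ : Set.InjOn φ A) :
    (univ.filter (fun π : Equiv.Perm α => ∀ x ∈ A, π x = φ x)).card = (Fintype.card α - A.card).factorial := by
  classical
  -- an extension
  let e : {x // x ∈ A} ≃ {x // x ∈ A.image φ} :=
    Equiv.ofBijective (fun x => ⟨φ x, mem_image_of_mem _ x.2⟩) (by
      constructor
      · intro x y h
        exact Subtype.ext (hφ x.2 y.2 (congrArg Subtype.val h))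
      · rintro ⟨y, hy⟩
        obtain ⟨x, hx, rfl⟩ := mem_image.1 hy
        exact ⟨⟨x, hx⟩, rfl⟩)
  let θ : Equiv.Perm α := e.extendSubtype
  have hθ : ∀ x ∈ A, θ x = φ x := by
    intro x hx
    exact (e.extendSubtype_apply_of_mem x hx).trans rfl
  rw [← card_perm_fix A]
  refine Finset.card_bij (fun π _ => θ⁻¹ * π) ?_ ?_ ?_
  · intro π hπ
    simp only [mem_filter, mem_univ, true_and] at hπ ⊢
    intro x hx
    rw [Equiv.Perm.mul_apply, hπ x hx, ← hθ x hx]; simp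
  · intro a _ b _ h
    exact mul_left_cancel h
  · intro π hπ
    simp only [mem_filter, mem_univ, true_and] at hπ
    refine ⟨θ * π, ?_, by simp⟩
    simp only [mem_filter, mem_univ, true_and]
    intro x hx
    rw [Equiv.Perm.mul_apply, hπ x hx, hθ x hx]

lemma sg_inj_aux {N k : ℕ} [NeZero k] (f g : Arr N k α) (h : sg f = sg g)
    (h0 : ∀ c, f (c, 0) = g (c, 0)) : f = g := by
  ext ⟨c, s⟩
  have : ∀ (a : ℕ) (ha : a < k), f (c, ⟨a, ha⟩) = g (c, ⟨a, ha⟩) := by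
    intro a
    induction a with
    | zero => intro ha; exact h0 c
    | succ a ih =>
      intro ha
      have e : (⟨a + 1, ha⟩ : Fin k) = ⟨a, by omega⟩ + 1 := by
        ext; rw [val_add_one]; simp only; split_ifs <;> omega
      rw [e, ← sg_apply, ← sg_apply, ih, h]
  exact this s s.2

lemma QS_trivial (N k : ℕ) [NeZero k] (hc : Fintype.card α = N * k) (U : Finset α) :
    (QS N k U).card ≤ (N * k).factorial * ((N * k - U.card).factorial * (N * k) ^ N) := by
  classical
  have h1 : (QS N k U).card ≤ ∑ f' : Arr N k α,
      ((univ.filter (fun π : Equiv.Perm α => ∀ x ∈ U, π x = sg f' x)) ×ˢ (univ : Finset (Fin N → α))).card := by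
    rw [← card_sigma]
    refine Finset.card_le_card_of_injOn (fun p => ⟨p.2, (sg p.1, fun c => p.1 (c, 0))⟩) ?_ ?_
    · rintro ⟨f, f'⟩ hp
      simp only [QS, coe_filter, mem_univ, true_and, Set.mem_ofPred_eq] at hp
      simp only [coe_sigma, Set.mem_sigma_iff, mem_coe, mem_filter, mem_univ, true_and, mem_product, and_true]
      exact hp
    · rintro ⟨f, f'⟩ _ ⟨g, g'⟩ _ h
      simp only [Sigma.mk.injEq, heq_eq_eq, Prod.mk.injEq] at h
      obtain ⟨rfl, h1, h2⟩ := h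
      rw [sg_inj_aux f g h1 (fun c => congrFun h2 c)]
  refine h1.trans ?_
  have h2 : ∀ f' : Arr N k α, ((univ.filter (fun π : Equiv.Perm α => ∀ x ∈ U, π x = sg f' x)) ×ˢ (univ : Finset (Fin N → α))).card = (N * k - U.card).factorial * (N * k) ^ N := by
    intro f'
    rw [card_product, card_perm_ext U (sg f') (Equiv.injective _).injOn, hc]
    simp [hc]
  rw [Finset.sum_congr rfl (fun f' _ => h2 f'), sum_const, card_univ, card_Arr N k hc, smul_eq_mul]

end PartA7
end CF

set_option linter.unusedSectionVars false
set_option linter.unusedVariables false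
namespace CF
open Finset

section PartB1
variable {S : Type*} [Fintype S] [DecidableEq S]

lemma T1 (d : ℕ) (a : S → Fin d) (y : Equiv.Perm S) :
    (univ.filter (fun θ : Equiv.Perm (S × Fin d) => ∀ x, (θ (x, a x)).1 = y x)).card
      = d ^ Fintype.card S * (Fintype.card S * d - Fintype.card S).factorial := by
  classical
  have h1 := Finset.card_eq_sum_card_fiberwise
    (s := univ.filter (fun θ : Equiv.Perm (S × Fin d) => ∀ x, (θ (x, a x)).1 = y x))
    (t := (univ : Finset (S → Fin d))) (f := fun θ x => (θ (x, a x)).2) (fun _ _ => mem_coe.2 (mem_univ _))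
  rw [h1]
  have h2 : ∀ b : S → Fin d, ((univ.filter (fun θ : Equiv.Perm (S × Fin d) => ∀ x, (θ (x, a x)).1 = y x)).filter
      (fun θ => (fun x => (θ (x, a x)).2) = b)).card = (Fintype.card S * d - Fintype.card S).factorial := by
    intro b
    have hinj : Function.Injective (fun x : S => (x, a x)) := fun x z h => (Prod.mk.inj h).1
    have := card_perm_ext (univ.image (fun x : S => (x, a x))) (fun p => (y p.1, b p.1)) (by
      intro p hp q hq h
      simp only [coe_image, coe_univ, Set.image_univ, Set.mem_range] at hp hq
      obtain ⟨x, rfl⟩ := hp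
      obtain ⟨z, rfl⟩ := hq
      simp only [Prod.mk.injEq, EmbeddingLike.apply_eq_iff_eq] at h
      simp [h.1])
    rw [card_image_of_injective _ hinj, Fintype.card_prod, Fintype.card_fin, card_univ] at this
    rw [← this]
    congr 1
    ext θ
    simp only [mem_filter, mem_univ, true_and, mem_image, forall_exists_index, forall_apply_eq_imp_iff]
    constructor
    · rintro ⟨h1, h2⟩ x
      exact Prod.ext (h1 x) (congrFun h2 x)
    · intro h
      refine ⟨fun x => by rw [h x], funext fun x => by rw [h x]⟩
  rw [Finset.sum_congr rfl (fun b _ => h2 b), sum_const, card_univ, smul_eq_mul]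
  simp

lemma T2 (d : ℕ) (hd : 1 ≤ d) (a a' : S → Fin d) (y y' : Equiv.Perm S)
    (hy : ∀ x, a x = a' x → y x = y' x) :
    (univ.filter (fun θ : Equiv.Perm (S × Fin d) => ∀ x, (θ (x, a x)).1 = y x ∧ (θ (x, a' x)).1 = y' x)).card
      ≤ (d ^ Fintype.card S * (d - 1) ^ (Fintype.card S - (univ.filter (fun x => a x = a' x)).card)) *
        (Fintype.card S * d - (2 * Fintype.card S - (univ.filter (fun x => a x = a' x)).card)).factorial := by
  classical
  set m := Fintype.card S with hm
  set J := univ.filter (fun x => a x = a' x) with hJ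
  set Θ := univ.filter (fun θ : Equiv.Perm (S × Fin d) => ∀ x, (θ (x, a x)).1 = y x ∧ (θ (x, a' x)).1 = y' x) with hΘ
  let τ : Equiv.Perm S := y.trans y'.symm
  have hτJ : ∀ x, x ∉ J → τ x ∉ J := by
    intro x hx hτ
    have h1 : y (τ x) = y' (τ x) := hy _ (by simpa [hJ] using hτ)
    have h2 : y' (τ x) = y x := by simp [τ]
    have := y.injective (h1.trans h2)
    rw [this] at hτ
    exact hx hτ
  let P : (S → Fin d) → Finset (S → Fin d) := fun b =>
    Fintype.piFinset (fun z => if z ∈ J then {b z} else univ \ {b (τ.symm z)})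
  let BB : Finset ((S → Fin d) × (S → Fin d)) :=
    ((univ : Finset (S → Fin d)).sigma P).image (fun p => (p.1, p.2))
  have hBB : BB.card ≤ d ^ m * (d - 1) ^ (m - J.card) := by
    refine card_image_le.trans ?_
    rw [card_sigma]
    have : ∀ b, (P b).card = (d - 1) ^ (m - J.card) := by
      intro b
      rw [Fintype.card_piFinset]
      have : ∀ z, ((if z ∈ J then {b z} else univ \ {b (τ.symm z)} : Finset (Fin d))).card = if z ∈ J then 1 else (d - 1) := by
        intro z
        split_ifs
        · simp
        · rw [card_univ_sdiff]; simp
      rw [Finset.prod_congr rfl (fun z _ => this z), Finset.prod_ite]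
      simp only [prod_const_one, one_mul, prod_const]
      congr 1
      rw [hm, ← card_univ_sdiff]
      congr 1
      ext z; simp
    rw [Finset.sum_congr rfl (fun b _ => this b), sum_const, card_univ, smul_eq_mul]
    simp [hm]
  have hmap : ∀ θ ∈ Θ, ((fun x => (θ (x, a x)).2), (fun x => (θ (x, a' x)).2)) ∈ BB := by
    intro θ hθ
    simp only [hΘ, mem_filter, mem_univ, true_and] at hθ
    refine mem_image.2 ⟨⟨fun x => (θ (x, a x)).2, fun x => (θ (x, a' x)).2⟩, ?_, rfl⟩
    rw [mem_sigma]
    refine ⟨mem_univ _, ?_⟩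
    simp only [P, Fintype.mem_piFinset]
    intro z
    split_ifs with hz
    · simp only [hJ, mem_filter, mem_univ, true_and] at hz
      simp [hz]
    · simp only [mem_sdiff, mem_univ, true_and, mem_singleton]
      intro he
      set x := τ.symm z with hx
      have hzx : z = τ x := by simp [hx]
      have h1 : (θ (z, a' z)).1 = (θ (x, a x)).1 := by
        rw [(hθ z).2, (hθ x).1, hzx]; simp [τ]
      have h2 : θ (z, a' z) = θ (x, a x) := Prod.ext h1 he
      have h3 := θ.injective h2
      simp only [Prod.mk.injEq] at h3
      apply hz
      simp only [hJ, mem_filter, mem_univ, true_and]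
      rw [h3.2, h3.1]
  set A : Finset (S × Fin d) := univ.image (fun x : S => (x, a x)) ∪ univ.image (fun x : S => (x, a' x)) with hA
  have hAc : A.card = 2 * m - J.card := by
    have hinj : ∀ a : S → Fin d, Function.Injective (fun x : S => (x, a x)) := fun a x z h => (Prod.mk.inj h).1
    have h1 := card_union_add_card_inter (univ.image (fun x : S => (x, a x))) (univ.image (fun x : S => (x, a' x)))
    rw [card_image_of_injective _ (hinj a), card_image_of_injective _ (hinj a'), card_univ, ← hm] at h1
    have h2 : (univ.image (fun x : S => (x, a x)) ∩ univ.image (fun x : S => (x, a' x))).card = J.card := by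
      rw [← card_image_of_injective J (hinj a)]
      congr 1
      ext p
      simp only [mem_inter, mem_image, mem_univ, true_and, hJ, mem_filter]
      constructor
      · rintro ⟨⟨x, rfl⟩, z, hz⟩
        simp only [Prod.mk.injEq] at hz
        refine ⟨x, ?_, rfl⟩
        rw [← hz.2, hz.1]
      · rintro ⟨x, hx, rfl⟩
        exact ⟨⟨x, rfl⟩, x, by rw [hx]⟩
    rw [h2, ← hA] at h1
    omega
  calc Θ.card ≤ (m * d - (2 * m - J.card)).factorial * BB.card := by
        refine Finset.card_le_mul_card_image_of_maps_to (f := fun θ => ((fun x => (θ (x, a x)).2), (fun x => (θ (x, a' x)).2))) hmap _ ?_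
        intro bb _
        rcases (Θ.filter (fun θ => ((fun x => (θ (x, a x)).2), (fun x => (θ (x, a' x)).2)) = bb)).eq_empty_or_nonempty with he | ⟨θ0, h0⟩
        · rw [he]; simp
        · have := card_perm_ext A θ0 (Equiv.injective _).injOn
          rw [hAc, Fintype.card_prod, Fintype.card_fin, ← hm] at this
          rw [← this]
          refine card_le_card ?_
          intro θ hθ
          simp only [hΘ, mem_filter, mem_univ, true_and] at hθ h0 ⊢
          have hbb := hθ.2.trans h0.2.symm
          simp only [Prod.mk.injEq] at hbb
          intro p hp
          rw [hA, mem_union, mem_image, mem_image] at hp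
          rcases hp with ⟨x, -, rfl⟩ | ⟨x, -, rfl⟩
          · exact Prod.ext ((hθ.1 x).1.trans (h0.1 x).1.symm) (congrFun hbb.1 x)
          · exact Prod.ext ((hθ.1 x).2.trans (h0.1 x).2.symm) (congrFun hbb.2 x)
    _ ≤ (m * d - (2 * m - J.card)).factorial * (d ^ m * (d - 1) ^ (m - J.card)) := Nat.mul_le_mul_left _ hBB
    _ = _ := by ring

lemma count_aa (d : ℕ) (J : Finset S) :
    (univ.filter (fun p : (S → Fin d) × (S → Fin d) => univ.filter (fun x => p.1 x = p.2 x) = J)).card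
      ≤ d ^ Fintype.card S * (d - 1) ^ (Fintype.card S - J.card) := by
  classical
  let P : (S → Fin d) → Finset (S → Fin d) := fun b =>
    Fintype.piFinset (fun z => if z ∈ J then {b z} else univ \ {b z})
  have : ∀ b, (P b).card = (d - 1) ^ (Fintype.card S - J.card) := by
    intro b
    rw [Fintype.card_piFinset]
    have : ∀ z, ((if z ∈ J then {b z} else univ \ {b z} : Finset (Fin d))).card = if z ∈ J then 1 else (d - 1) := by
      intro z
      split_ifs
      · simp
      · rw [card_univ_sdiff]; simp
    rw [Finset.prod_congr rfl (fun z _ => this z), Finset.prod_ite]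
    simp only [prod_const_one, one_mul, prod_const]
    congr 1
    rw [← card_univ_sdiff]
    congr 1
    ext z; simp
  have h2 : ((univ : Finset (S → Fin d)).sigma P).card = d ^ Fintype.card S * (d - 1) ^ (Fintype.card S - J.card) := by
    rw [card_sigma, Finset.sum_congr rfl (fun b _ => this b), sum_const, card_univ, smul_eq_mul]
    simp
  rw [← h2]
  refine Finset.card_le_card_of_injOn (fun p => ⟨p.1, p.2⟩) ?_ ?_
  · rintro ⟨a, a'⟩ hp
    simp only [coe_filter, mem_univ, true_and, Set.mem_ofPred_eq] at hp
    simp only [coe_sigma, Set.mem_sigma_iff, mem_coe, mem_univ, true_and, P, Fintype.mem_piFinset]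
    intro z
    have := Finset.ext_iff.1 hp z
    simp only [mem_filter, mem_univ, true_and] at this
    split_ifs with hz
    · simp [this.2 hz]
    · simp only [mem_sdiff, mem_univ, true_and, mem_singleton]
      exact fun h => hz (this.1 h.symm)
  · rintro ⟨a, a'⟩ _ ⟨b, b'⟩ _ h
    simp only [Sigma.mk.injEq, heq_eq_eq] at h
    rw [h.1, h.2]

end PartB1
end CF

set_option linter.unusedSectionVars false
set_option linter.unusedVariables false
set_option linter.unusedSimpArgs false
namespace CF
open Finset

section PartB2
variable {α : Type*} [Fintype α] [DecidableEq α]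

def NOK {N k : ℕ} [NeZero k] (S : Finset α) (d : ℕ) (β : Equiv.Perm α) (θ : Equiv.Perm (S × Fin d))
    (f : Arr N k α) (a : S → Fin d) : Prop :=
  (∀ x, x ∉ S → sg f x = β x) ∧ ∀ x : S, sg f x = β (θ (x, a x)).1

open Classical in
noncomputable def Nset (N k : ℕ) [NeZero k] (S : Finset α) (d : ℕ) (β : Equiv.Perm α)
    (θ : Equiv.Perm (S × Fin d)) : Finset (Arr N k α × (S → Fin d)) :=
  univ.filter (fun p => NOK S d β θ p.1 p.2)

lemma exists_y (S : Finset α) (σ β : Equiv.Perm α) (h : ∀ x, x ∉ S → σ x = β x) :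
    ∃ y : Equiv.Perm S, ∀ x : S, σ x = β (y x) := by
  have hfix : ∀ x, x ∉ S → (β⁻¹ * σ) x = x := by
    intro x hx
    rw [Equiv.Perm.mul_apply, h x hx]; simp
  have hiff : ∀ x, (β⁻¹ * σ) x ∈ S ↔ x ∈ S := by
    intro x
    constructor
    · intro h1
      by_contra h2
      rw [hfix x h2] at h1
      exact h2 h1
    · intro h1
      by_contra h2
      have h3 := hfix _ h2
      have := (β⁻¹ * σ).injective h3
      rw [this] at h2
      exact h2 h1
  refine ⟨(β⁻¹ * σ).subtypePerm hiff, fun x => ?_⟩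
  simp [Equiv.Perm.subtypePerm]

lemma card_beta (S : Finset α) (σ : Equiv.Perm α) :
    (univ.filter (fun β : Equiv.Perm α => ∀ x, x ∉ S → σ x = β x)).card = S.card.factorial := by
  classical
  have := card_perm_ext (univ \ S) σ (Equiv.injective _).injOn
  rw [card_univ_sdiff, Nat.sub_sub_self (card_le_univ S)] at this
  rw [← this]
  congr 1
  ext β
  simp [eq_comm]

open Classical in
lemma first_count {N k : ℕ} [NeZero k] (S : Finset α) (d : ℕ) (f : Arr N k α) (a : S → Fin d) :
    (univ.filter (fun q : Equiv.Perm α × Equiv.Perm (S × Fin d) => NOK S d q.1 q.2 f a)).card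
     = S.card.factorial * (d ^ S.card * (S.card * d - S.card).factorial) := by
  classical
  have h1 : (univ.filter (fun q : Equiv.Perm α × Equiv.Perm (S × Fin d) => NOK S d q.1 q.2 f a)).card =
    ∑ β ∈ univ.filter (fun β : Equiv.Perm α => ∀ x, x ∉ S → sg f x = β x),
      (univ.filter (fun θ : Equiv.Perm (S × Fin d) => ∀ x : S, sg f x = β (θ (x, a x)).1)).card := by
    rw [← card_sigma]
    refine Finset.card_bij (fun q _ => ⟨q.1, q.2⟩) ?_ ?_ ?_
    · rintro ⟨β, θ⟩ h
      simp only [mem_filter, mem_univ, true_and] at h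
      unfold NOK at h
      simpa using h
    · rintro ⟨β, θ⟩ _ ⟨β', θ'⟩ _ h
      simp only [Sigma.mk.injEq, heq_eq_eq] at h
      rw [h.1, h.2]
    · rintro ⟨β, θ⟩ h
      refine ⟨(β, θ), ?_, rfl⟩
      simp only [mem_filter, mem_univ, true_and, NOK]
      simpa using h
  refine h1.trans ?_
  have h2 : ∀ β ∈ univ.filter (fun β : Equiv.Perm α => ∀ x, x ∉ S → sg f x = β x),
      (univ.filter (fun θ : Equiv.Perm (S × Fin d) => ∀ x : S, sg f x = β (θ (x, a x)).1)).card
        = (d ^ S.card * (S.card * d - S.card).factorial) := by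
    intro β hβ
    simp only [mem_filter, mem_univ, true_and] at hβ
    obtain ⟨y, hy⟩ := exists_y S (sg f) β hβ
    have := T1 d a y
    rw [Fintype.card_coe] at this
    rw [← this]
    congr 1
    ext θ
    simp only [mem_filter, mem_univ, true_and]
    refine forall_congr' fun x => ?_
    rw [hy x]
    simp only [EmbeddingLike.apply_eq_iff_eq]
    rw [Subtype.ext_iff, eq_comm]
  rw [Finset.sum_congr rfl h2, sum_const, card_beta, smul_eq_mul]

open Classical in
lemma second_count {N k : ℕ} [NeZero k] (S : Finset α) (d : ℕ) (hd : 1 ≤ d) (f f' : Arr N k α) (a a' : S → Fin d) :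
    (univ.filter (fun q : Equiv.Perm α × Equiv.Perm (S × Fin d) =>
      NOK S d q.1 q.2 f a ∧ NOK S d q.1 q.2 f' a')).card
     ≤ (if (f, f') ∈ QS N k (univ \ S ∪ (univ.filter (fun x => a x = a' x)).map (Function.Embedding.subtype _)) then
      S.card.factorial * ((d ^ S.card * (d - 1) ^ (S.card - (univ.filter (fun x => a x = a' x)).card)) *
        (S.card * d - (2 * S.card - (univ.filter (fun x => a x = a' x)).card)).factorial) else 0) := by
  classical
  split_ifs with hQ
  · have h1 : (univ.filter (fun q : Equiv.Perm α × Equiv.Perm (S × Fin d) => NOK S d q.1 q.2 f a ∧ NOK S d q.1 q.2 f' a')).card ≤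
      ∑ β ∈ univ.filter (fun β : Equiv.Perm α => ∀ x, x ∉ S → sg f x = β x),
        (univ.filter (fun θ : Equiv.Perm (S × Fin d) => ∀ x : S, sg f x = β (θ (x, a x)).1 ∧ sg f' x = β (θ (x, a' x)).1)).card := by
      rw [← card_sigma]
      refine Finset.card_le_card_of_injOn (fun q => ⟨q.1, q.2⟩) ?_ ?_
      · rintro ⟨β, θ⟩ h
        simp only [coe_filter, Set.mem_ofPred_eq, mem_univ, true_and] at h
        simp only [coe_sigma, Set.mem_sigma_iff, mem_coe, mem_filter, mem_univ, true_and]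
        exact ⟨h.1.1, fun x => ⟨h.1.2 x, h.2.2 x⟩⟩
      · rintro ⟨β, θ⟩ _ ⟨β', θ'⟩ _ h
        simp only [Sigma.mk.injEq, heq_eq_eq] at h
        rw [h.1, h.2]
    refine h1.trans ?_
    rw [← card_beta S (sg f), ← smul_eq_mul (a := (univ.filter (fun β : Equiv.Perm α => ∀ x, x ∉ S → sg f x = β x)).card)]
    refine Finset.sum_le_card_nsmul _ _ _ ?_
    intro β hβ
    simp only [mem_filter, mem_univ, true_and] at hβ
    simp only [QS, mem_filter, mem_univ, true_and, mem_union, mem_sdiff, mem_map,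
      Function.Embedding.subtype_apply] at hQ
    have hβ' : ∀ x, x ∉ S → sg f' x = β x := fun x hx => by
      rw [← hβ x hx, hQ x (Or.inl hx)]
    obtain ⟨y, hy⟩ := exists_y S (sg f) β hβ
    obtain ⟨y', hy'⟩ := exists_y S (sg f') β hβ'
    have := T2 d hd a a' y y' (by
      intro x hx
      have h3 := hQ x (Or.inr ⟨x, hx, rfl⟩)
      rw [hy x, hy' x] at h3
      exact Subtype.ext (β.injective h3))
    rw [Fintype.card_coe] at this
    refine le_trans (le_of_eq ?_) this
    congr 1
    ext θ
    simp only [mem_filter, mem_univ, true_and]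
    refine forall_congr' fun x => ?_
    rw [hy x, hy' x]
    simp only [EmbeddingLike.apply_eq_iff_eq]
    rw [Subtype.ext_iff, Subtype.ext_iff, eq_comm, @eq_comm _ (y' x : α)]
  · rw [Nat.le_zero, card_eq_zero, eq_empty_iff_forall_notMem]
    rintro ⟨β, θ⟩ h
    simp only [mem_filter, mem_univ, true_and] at h
    apply hQ
    simp only [QS, mem_filter, mem_univ, true_and, mem_union, mem_sdiff, mem_map,
      Function.Embedding.subtype_apply]
    rintro x (hx | ⟨x, hx, rfl⟩)
    · rw [h.1.1 x hx, h.2.1 x hx]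
    · rw [h.1.2 x, h.2.2 x, hx]

open Classical in
lemma sum_card_filter_comm {A B : Type*} [Fintype A] [Fintype B] (r : A → B → Prop) :
    ∑ x : A, (univ.filter (fun y => r x y)).card = ∑ y : B, (univ.filter (fun x => r x y)).card := by
  classical
  simp_rw [card_filter]
  exact Finset.sum_comm

theorem moment (N k : ℕ) [NeZero k] (hc : Fintype.card α = N * k) (S : Finset α) (d : ℕ) (hd : 1 ≤ d) :
    ((N * k).factorial * d ^ S.card * (S.card.factorial * (d ^ S.card * (S.card * d - S.card).factorial))) ^ 2 ≤
    (univ.filter (fun q : Equiv.Perm α × Equiv.Perm (S × Fin d) => (Nset N k S d q.1 q.2).Nonempty)).card *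
    ∑ J : Finset S, (d ^ S.card * (d - 1) ^ (S.card - J.card)) *
      ((QS N k (univ \ S ∪ J.map (Function.Embedding.subtype _))).card *
      (S.card.factorial * ((d ^ S.card * (d - 1) ^ (S.card - J.card)) *
        (S.card * d - (2 * S.card - J.card)).factorial))) := by
  classical
  have h1 : ∑ q : Equiv.Perm α × Equiv.Perm (S × Fin d), (Nset N k S d q.1 q.2).card =
      (N * k).factorial * d ^ S.card * (S.card.factorial * (d ^ S.card * (S.card * d - S.card).factorial)) := by
    unfold Nset
    have := sum_card_filter_comm (fun (q : Equiv.Perm α × Equiv.Perm (S × Fin d)) (p : Arr N k α × (S → Fin d)) => NOK S d q.1 q.2 p.1 p.2)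
    refine Eq.trans ?_ (this.trans ?_)
    · congr
    · refine (Finset.sum_congr rfl (fun p _ => first_count S d p.1 p.2)).trans ?_
      rw [sum_const, card_univ, Fintype.card_prod, card_Arr N k hc, smul_eq_mul]
      simp
  have h2 : ∑ q : Equiv.Perm α × Equiv.Perm (S × Fin d), (Nset N k S d q.1 q.2).card ^ 2 ≤
      ∑ J : Finset S, (d ^ S.card * (d - 1) ^ (S.card - J.card)) *
      ((QS N k (univ \ S ∪ J.map (Function.Embedding.subtype _))).card *
      (S.card.factorial * ((d ^ S.card * (d - 1) ^ (S.card - J.card)) *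
        (S.card * d - (2 * S.card - J.card)).factorial))) := by
    have e1 : ∀ q : Equiv.Perm α × Equiv.Perm (S × Fin d), (Nset N k S d q.1 q.2).card ^ 2 =
        (univ.filter (fun p : (Arr N k α × Arr N k α) × ((S → Fin d) × (S → Fin d)) => NOK S d q.1 q.2 p.1.1 p.2.1 ∧ NOK S d q.1 q.2 p.1.2 p.2.2)).card := by
      intro q
      rw [sq, ← card_product]
      refine Finset.card_bij (fun p _ => ((p.1.1, p.2.1), (p.1.2, p.2.2))) ?_ ?_ ?_
      · rintro ⟨⟨f, a⟩, ⟨f', a'⟩⟩ h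
        simpa [Nset] using h
      · rintro ⟨⟨f, a⟩, ⟨f', a'⟩⟩ _ ⟨⟨g, b⟩, ⟨g', b'⟩⟩ _ h
        simp only [Prod.mk.injEq] at h
        obtain ⟨⟨rfl, rfl⟩, rfl, rfl⟩ := h
        rfl
      · rintro ⟨⟨f, f'⟩, ⟨a, a'⟩⟩ h
        refine ⟨((f, a), (f', a')), ?_, rfl⟩
        simpa [Nset] using h
    rw [Finset.sum_congr rfl (fun q _ => e1 q)]
    have := sum_card_filter_comm (fun (q : Equiv.Perm α × Equiv.Perm (S × Fin d)) (p : (Arr N k α × Arr N k α) × ((S → Fin d) × (S → Fin d))) => NOK S d q.1 q.2 p.1.1 p.2.1 ∧ NOK S d q.1 q.2 p.1.2 p.2.2)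
    refine le_trans (le_of_eq (Eq.trans ?_ this)) ?_
    · refine Finset.sum_congr rfl fun q _ => ?_
      congr
    refine (Finset.sum_le_sum (fun p _ => le_trans (le_of_eq (by congr)) (second_count S d hd p.1.1 p.1.2 p.2.1 p.2.2))).trans ?_
    rw [Fintype.sum_prod_type_right]
    have e2 : ∀ aa : (S → Fin d) × (S → Fin d),
      (∑ x : Arr N k α × Arr N k α, if (x.1, x.2) ∈ QS N k (univ \ S ∪ (univ.filter (fun x => aa.1 x = aa.2 x)).map (Function.Embedding.subtype _)) then
      S.card.factorial * ((d ^ S.card * (d - 1) ^ (S.card - (univ.filter (fun x => aa.1 x = aa.2 x)).card)) *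
        (S.card * d - (2 * S.card - (univ.filter (fun x => aa.1 x = aa.2 x)).card)).factorial) else 0)
      = (fun J : Finset S => (QS N k (univ \ S ∪ J.map (Function.Embedding.subtype _))).card *
      (S.card.factorial * ((d ^ S.card * (d - 1) ^ (S.card - J.card)) *
        (S.card * d - (2 * S.card - J.card)).factorial))) (univ.filter (fun x => aa.1 x = aa.2 x)) := by
      intro aa
      rw [← Finset.sum_filter, sum_const, smul_eq_mul]
      congr 2
      ext; simp
    rw [Finset.sum_congr rfl (fun aa _ => e2 aa)]
    rw [← Finset.sum_fiberwise_of_maps_to (s := univ) (t := (univ : Finset (Finset S))) (g := fun aa : (S → Fin d) × (S → Fin d) => univ.filter (fun x => aa.1 x = aa.2 x)) (fun _ _ => mem_univ _)]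
    refine Finset.sum_le_sum fun J _ => ?_
    rw [Finset.sum_congr rfl (g := fun _ => (QS N k (univ \ S ∪ J.map (Function.Embedding.subtype _))).card *
      (S.card.factorial * ((d ^ S.card * (d - 1) ^ (S.card - J.card)) *
        (S.card * d - (2 * S.card - J.card)).factorial)))]
    · rw [sum_const, smul_eq_mul]
      refine Nat.mul_le_mul_right _ ?_
      have := count_aa d J
      rw [Fintype.card_coe] at this
      exact this
    · intro aa haa
      simp only [mem_filter, mem_univ, true_and] at haa
      rw [haa]
  rw [← h1]
  have h3 : ∑ q : Equiv.Perm α × Equiv.Perm (S × Fin d), (Nset N k S d q.1 q.2).card =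
      ∑ q ∈ univ.filter (fun q : Equiv.Perm α × Equiv.Perm (S × Fin d) => (Nset N k S d q.1 q.2).Nonempty), (Nset N k S d q.1 q.2).card := by
    rw [Finset.sum_filter]
    refine Finset.sum_congr rfl fun q _ => ?_
    split_ifs with h
    · rfl
    · rw [not_nonempty_iff_eq_empty.1 h]; rfl
  rw [h3]
  refine sq_sum_le_card_mul_sum_sq.trans (Nat.mul_le_mul_left _ (le_trans ?_ h2))
  exact Finset.sum_le_sum_of_subset (filter_subset _ _)

end PartB2
end CF

set_option linter.unusedSectionVars false
set_option linter.unusedVariables false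
set_option linter.unusedSimpArgs false
namespace CF
open Finset

section PartB3

/-- `y^y / y!`. -/
noncomputable def rr (y : ℕ) : ℝ := (y : ℝ) ^ y / (y.factorial : ℝ)

lemma rr_pos (y : ℕ) : 0 < rr y := by
  unfold rr
  rcases Nat.eq_zero_or_pos y with rfl | h
  · simp
  · positivity

lemma rr_conv1 (t : ℕ) : rr (t + 1) * rr (t + 1) ≤ rr t * rr (t + 2) := by
  rcases Nat.eq_zero_or_pos t with rfl | h
  · norm_num [rr, Nat.factorial]
  · have hb := one_add_mul_le_pow (a := -(1 / ((t : ℝ) + 1) ^ 2)) (by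
      have : (1 : ℝ) / ((t : ℝ) + 1) ^ 2 ≤ 1 := by
        rw [div_le_one (by positivity)]; nlinarith [(Nat.cast_nonneg t : (0:ℝ) ≤ t)]
      linarith) (t + 1)
    have ht : (0 : ℝ) < t := by exact_mod_cast h
    have e1 : 1 + -(1 / ((t : ℝ) + 1) ^ 2) = t * (t + 2) / ((t : ℝ) + 1) ^ 2 := by
      field_simp; ring
    have e2 : 1 + ((t + 1 : ℕ) : ℝ) * -(1 / ((t : ℝ) + 1) ^ 2) = t / ((t : ℝ) + 1) := by
      push_cast; field_simp; ring
    rw [e1, e2, div_pow, mul_pow, ← pow_mul, div_le_div_iff₀ (by positivity) (by positivity)] at hb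
    unfold rr
    rw [div_mul_div_comm, div_mul_div_comm, div_le_div_iff₀ (by positivity) (by positivity)]
    have f1 : ((t + 2).factorial : ℝ) = (t + 2) * ((t + 1) * t.factorial) := by
      rw [Nat.factorial_succ, Nat.factorial_succ]; push_cast; ring
    have f2 : ((t + 1).factorial : ℝ) = ((t + 1) * t.factorial) := by
      rw [Nat.factorial_succ]; push_cast; ring
    rw [f1, f2]
    push_cast
    have h3 : (0 : ℝ) ≤ (t.factorial : ℝ) ^ 2 * ((t + 1) * (t + 2)) := by positivity
    have key : ((t : ℝ) + 1) ^ (t + 1) * ((t : ℝ) + 1) ^ (t + 1) ≤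
        (t : ℝ) ^ t * (t + 2) ^ (t + 1) * (t + 1) := by
      have : (t : ℝ) * (((t : ℝ) + 1) ^ (t + 1) * ((t : ℝ) + 1) ^ (t + 1)) ≤
        t * ((t : ℝ) ^ t * (t + 2) ^ (t + 1) * (t + 1)) := by
        calc (t : ℝ) * (((t : ℝ) + 1) ^ (t + 1) * ((t : ℝ) + 1) ^ (t + 1)) = t * ((t : ℝ) + 1) ^ (2 * (t + 1)) := by ring
          _ ≤ _ := hb
          _ = _ := by ring
      exact le_of_mul_le_mul_left this ht
    calc _ = (((t : ℝ) + 1) ^ (t + 1) * ((t : ℝ) + 1) ^ (t + 1)) * ((t.factorial : ℝ) ^ 2 * ((t + 1) * (t + 2))) := by ring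
      _ ≤ ((t : ℝ) ^ t * (t + 2) ^ (t + 1) * (t + 1)) * ((t.factorial : ℝ) ^ 2 * ((t + 1) * (t + 2))) :=
        mul_le_mul_of_nonneg_right key h3
      _ = _ := by ring

lemma rr_conv2 (t s : ℕ) : rr (t + 1) * rr (t + s) ≤ rr t * rr (t + s + 1) := by
  induction s with
  | zero => simp [mul_comm]
  | succ s ih =>
    have h1 := rr_conv1 (t + s)
    have p1 := rr_pos (t + s)
    have p2 := rr_pos (t + s + 1)
    have p3 := rr_pos (t + 1)
    have p4 := rr_pos (t + s + 2)
    have p5 := rr_pos t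
    have : rr (t + s) * (rr (t + 1) * rr (t + s + 1)) ≤ rr (t + s) * (rr t * rr (t + s + 2)) := by
      nlinarith
    exact le_of_mul_le_mul_left this p1

lemma rr_conv3 (a s u : ℕ) : rr (a + u) * rr (a + s) ≤ rr a * rr (a + s + u) := by
  induction u with
  | zero => simp
  | succ u ih =>
    have h1 := rr_conv2 (a + u) s
    have e : a + u + s = a + s + u := by ring
    rw [e] at h1
    have p1 := rr_pos (a + u)
    have p2 := rr_pos (a + s + u)
    have p3 := rr_pos (a + u + 1)
    have p4 := rr_pos (a + s)
    have p5 := rr_pos a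
    have p6 := rr_pos (a + s + u + 1)
    have : rr (a + u) * rr (a + s + u) * (rr (a + u + 1) * rr (a + s)) ≤ rr (a + u) * rr (a + s + u) * (rr a * rr (a + s + u + 1)) := by
      calc _ = (rr (a + u) * rr (a + s)) * (rr (a + u + 1) * rr (a + s + u)) := by ring
        _ ≤ (rr a * rr (a + s + u)) * (rr (a + u) * rr (a + s + u + 1)) := by gcongr
        _ = _ := by ring
    exact le_of_mul_le_mul_left this (by positivity)

/-- The constant `c ≤ (1-z)^A` with `d = D+2`. -/
lemma c_bound (D m : ℕ) (hD : 1 ≤ D) (hm : 1 ≤ m) :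
    ((D * m).factorial : ℝ) * (((D + 2) * m).factorial : ℝ) * ((D : ℝ) + 1) ^ (2 * m) /
      (((D : ℝ) + 2) ^ (2 * m) * (((D + 1) * m).factorial : ℝ) ^ 2)
    ≤ (1 - 1 / ((D : ℝ) + 1) ^ 2) ^ (D * m) := by
  have h := rr_conv3 (D * m) m m
  rw [show D * m + m = (D + 1) * m by ring, show (D + 1) * m + m = (D + 2) * m by ring] at h
  unfold rr at h
  rw [div_mul_div_comm, div_mul_div_comm, div_le_div_iff₀ (by positivity) (by positivity)] at h
  have hD' : (0 : ℝ) < D := by exact_mod_cast hD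
  have hm' : (0 : ℝ) < m := by exact_mod_cast hm
  have e1 : 1 - 1 / ((D : ℝ) + 1) ^ 2 = (D * (D + 2)) / ((D : ℝ) + 1) ^ 2 := by
    field_simp; ring
  rw [e1, div_pow, div_le_div_iff₀ (by positivity) (by positivity)]
  push_cast at h
  have hpos : (0 : ℝ) < ((m : ℝ) ^ ((D + 1) * m)) ^ 2 := by positivity
  refine le_of_mul_le_mul_left ?_ hpos
  calc _ = (((D : ℝ) + 1) * m) ^ ((D + 1) * m) * ((((D : ℝ) + 1) * m) ^ ((D + 1) * m)) * (((D * m).factorial : ℝ) * (((D + 2) * m).factorial : ℝ)) := by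
        rw [mul_pow, ← pow_mul ((D : ℝ) + 1)]
        have : ((D : ℝ) + 1) ^ (2 * m) * ((D : ℝ) + 1) ^ (2 * (D * m)) = ((D : ℝ) + 1) ^ ((D + 1) * m) * ((D : ℝ) + 1) ^ ((D + 1) * m) := by
          rw [← pow_add, ← pow_add]; congr 1; ring
        linear_combination ((m : ℝ) ^ ((D + 1) * m)) ^ 2 * (((D * m).factorial : ℝ) * (((D + 2) * m).factorial : ℝ)) * this
    _ ≤ _ := h
    _ = _ := by
        have q1 : ((D : ℝ) * m) ^ (D * m) * (((D : ℝ) + 2) * m) ^ ((D + 2) * m) = ((m : ℝ) ^ ((D + 1) * m)) ^ 2 * ((D * (D + 2)) ^ (D * m) * ((D : ℝ) + 2) ^ (2 * m)) := by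
          have : ((m : ℝ) ^ ((D + 1) * m)) ^ 2 = (m : ℝ) ^ (D * m) * (m : ℝ) ^ ((D + 2) * m) := by
            rw [← pow_add, ← pow_mul]; congr 1; ring
          rw [this, mul_pow, mul_pow, mul_pow, show (D + 2) * m = D * m + 2 * m by ring, pow_add ((D : ℝ) + 2)]
          ring
        rw [q1]; ring

lemma choose_sum (A : ℕ) (z : ℝ) (h0 : 0 ≤ z) (h1 : z < 1) (s : Finset ℕ) :
    ∑ j ∈ s, ((j + A).choose A : ℝ) * z ^ j ≤ 1 / (1 - z) ^ (A + 1) := by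
  have := hasSum_choose_mul_geometric_of_norm_lt_one A (r := z) (by rw [Real.norm_eq_abs, abs_of_nonneg h0]; exact h1)
  exact sum_le_hasSum s (fun _ _ => by positivity) this

end PartB3
end CF

set_option linter.unusedSectionVars false
set_option linter.unusedVariables false
set_option linter.unusedSimpArgs false
namespace CF
open Finset

section PartB4
variable {α : Type*} [Fintype α] [DecidableEq α]

/-- The set of good pairs. -/
noncomputable def Xset (N k : ℕ) [NeZero k] (S : Finset α) (d : ℕ) : Finset (Equiv.Perm α × Equiv.Perm (S × Fin d)) :=
  univ.filter (fun q => (Nset N k S d q.1 q.2).Nonempty)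

lemma moment_real (N k : ℕ) [NeZero k] (hc : Fintype.card α = N * k) (S : Finset α) (D m : ℕ) (hD : 1 ≤ D)
    (hm : S.card = m) (hm1 : 1 ≤ m) (Ψ : ℕ → ℝ)
    (hΨ : ∀ J : Finset S, ((QS N k (univ \ S ∪ J.map (Function.Embedding.subtype _))).card : ℝ) ≤
      (N * k).factorial * (m - J.card).factorial * Ψ J.card) :
    ((N * k).factorial : ℝ) * ((D + 2) * m).factorial ≤ ((Xset N k S (D + 2)).card : ℝ) *
      ((1 - 1 / ((D : ℝ) + 1) ^ 2) ^ (D * m) * ∑ j ∈ range (m + 1), ((j + D * m).choose (D * m) : ℝ) * (1 / ((D : ℝ) + 1) ^ 2) ^ j * Ψ j) := by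
  have h := moment N k hc S (D + 2) (by omega)
  rw [← Xset, hm] at h
  have h' : (((N * k).factorial * (D + 2) ^ m * (m.factorial * ((D + 2) ^ m * (m * (D + 2) - m).factorial)) : ℕ) : ℝ) ^ 2 ≤
     ((Xset N k S (D + 2)).card : ℝ) * ∑ J : Finset S, ((((D + 2) ^ m * (D + 2 - 1) ^ (m - J.card) : ℕ) : ℝ) * (((QS N k (univ \ S ∪ J.map (Function.Embedding.subtype _))).card : ℝ) * ((m.factorial * (((D + 2) ^ m * (D + 2 - 1) ^ (m - J.card)) *
        (m * (D + 2) - (2 * m - J.card)).factorial) : ℕ) : ℝ))) := by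
    exact_mod_cast h
  clear h
  set X : ℝ := ((Xset N k S (D + 2)).card : ℝ) with hX
  have hX0 : 0 ≤ X := Nat.cast_nonneg _
  let F : ℕ → ℝ := fun j => (((D + 2) ^ m * (D + 1) ^ (m - j) : ℕ) : ℝ) * (((N * k).factorial * (m - j).factorial * Ψ j) * ((m.factorial * (((D + 2) ^ m * (D + 1) ^ (m - j)) *
        (m * (D + 2) - (2 * m - j)).factorial) : ℕ) : ℝ))
  have h2 : ∑ J : Finset S, ((((D + 2) ^ m * (D + 2 - 1) ^ (m - J.card) : ℕ) : ℝ) * (((QS N k (univ \ S ∪ J.map (Function.Embedding.subtype _))).card : ℝ) * ((m.factorial * (((D + 2) ^ m * (D + 2 - 1) ^ (m - J.card)) *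
        (m * (D + 2) - (2 * m - J.card)).factorial) : ℕ) : ℝ))) ≤ ∑ j ∈ range (m + 1), (m.choose j : ℝ) * F j := by
    have e := Finset.sum_powerset_apply_card F (x := (univ : Finset S))
    rw [card_univ, Fintype.card_coe, hm] at e
    simp only [nsmul_eq_mul] at e
    rw [← e, powerset_univ]
    refine Finset.sum_le_sum fun J _ => ?_
    simp only [F, show D + 2 - 1 = D + 1 by omega]
    gcongr
    exact hΨ J
  have h3 : ∀ j ∈ range (m + 1), (m.choose j : ℝ) * F j = ((N * k).factorial * (m.factorial : ℝ) ^ 2 * ((D : ℝ) + 2) ^ (2 * m) * ((D * m).factorial * ((D : ℝ) + 1) ^ (2 * m))) *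
      (((j + D * m).choose (D * m) : ℝ) * (1 / ((D : ℝ) + 1) ^ 2) ^ j * Ψ j) := by
    intro j hj
    have hj' : j ≤ m := by simpa [Nat.lt_succ_iff] using hj
    obtain ⟨i, rfl⟩ := Nat.exists_eq_add_of_le hj'
    simp only [F]
    have e1 : (j + i) * (D + 2) - (2 * (j + i) - j) = j + D * (j + i) := by
      have : (j + i) * (D + 2) = D * (j + i) + 2 * (j + i) := by ring
      omega
    rw [e1, show j + i - j = i by omega]
    have e2 : (((j + i).choose j : ℕ) : ℝ) * i.factorial * j.factorial = (j + i).factorial := by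
      have := Nat.choose_mul_factorial_mul_factorial hj'
      rw [show j + i - j = i by omega] at this
      rw [← this]; push_cast; ring
    have e3 : (((j + D * (j + i)).choose (D * (j + i)) : ℕ) : ℝ) * (D * (j + i)).factorial * j.factorial = (j + D * (j + i)).factorial := by
      have := Nat.choose_mul_factorial_mul_factorial (show D * (j + i) ≤ j + D * (j + i) by omega)
      rw [show j + D * (j + i) - D * (j + i) = j by omega] at this
      rw [← this]; push_cast; ring
    push_cast
    rw [← e3]
    have e4 : ((D : ℝ) + 1) ^ (2 * (j + i)) * (1 / ((D : ℝ) + 1) ^ 2) ^ j = ((D : ℝ) + 1) ^ i * ((D : ℝ) + 1) ^ i := by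
      rw [mul_add, pow_add, one_div, inv_pow, ← pow_mul]
      field_simp
      ring
    set P := ((D * (j + i)).factorial : ℝ)
    set C := (((j + D * (j + i)).choose (D * (j + i)) : ℕ) : ℝ)
    calc _ = ((((j + i).choose j : ℕ) : ℝ) * i.factorial * j.factorial) * ((N * k).factorial * ((j + i).factorial : ℝ) * ((D : ℝ) + 2) ^ (2 * (j + i)) * P * C * Ψ j) * (((D : ℝ) + 1) ^ i * ((D : ℝ) + 1) ^ i) := by ring
      _ = _ := by rw [e2, ← e4]; ring
  rw [Finset.sum_congr rfl h3, ← mul_sum] at h2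
  have h4 := h'.trans (mul_le_mul_of_nonneg_left h2 hX0)
  set Sg := ∑ j ∈ range (m + 1), ((j + D * m).choose (D * m) : ℝ) * (1 / ((D : ℝ) + 1) ^ 2) ^ j * Ψ j with hSg
  rw [show m * (D + 2) - m = (D + 1) * m by rw [show m * (D + 2) = (D + 1) * m + m by ring]; omega] at h4
  push_cast at h4
  have hcb := c_bound D m hD hm1
  rw [div_le_iff₀ (by positivity)] at hcb
  set B := (((D + 1) * m).factorial : ℝ)
  set n1 := ((N * k).factorial : ℝ) with hn1
  have hB : 0 < B := by positivity
  have hn0 : 0 < n1 := by positivity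
  have h5 : n1 * (((D : ℝ) + 2) ^ (2 * m) * B ^ 2) ≤ X * Sg * ((D * m).factorial * ((D : ℝ) + 1) ^ (2 * m)) := by
    have hp : 0 < n1 * (m.factorial : ℝ) ^ 2 * ((D : ℝ) + 2) ^ (2 * m) := by positivity
    refine le_of_mul_le_mul_left ?_ hp
    calc _ = (n1 * ((D : ℝ) + 2) ^ m * (↑m.factorial * (((D : ℝ) + 2) ^ m * B))) ^ 2 := by ring
      _ ≤ _ := h4
      _ = _ := by ring
  have hXS : 0 ≤ X * Sg := by
    by_contra hneg
    push Not at hneg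
    have : X * Sg * ((D * m).factorial * ((D : ℝ) + 1) ^ (2 * m)) < 0 := mul_neg_of_neg_of_pos hneg (by positivity)
    have : 0 < n1 * (((D : ℝ) + 2) ^ (2 * m) * B ^ 2) := by positivity
    linarith
  have hp : 0 < ((D : ℝ) + 2) ^ (2 * m) * B ^ 2 := by positivity
  refine le_of_mul_le_mul_right ?_ hp
  calc _ = (n1 * (((D : ℝ) + 2) ^ (2 * m) * B ^ 2)) * ((D + 2) * m).factorial := by ring
    _ ≤ (X * Sg * ((D * m).factorial * ((D : ℝ) + 1) ^ (2 * m))) * ((D + 2) * m).factorial := by gcongr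
    _ = X * Sg * ((D * m).factorial * ((D + 2) * m).factorial * ((D : ℝ) + 1) ^ (2 * m)) := by ring
    _ ≤ X * Sg * ((1 - 1 / ((D : ℝ) + 1) ^ 2) ^ (D * m) * (((D : ℝ) + 2) ^ (2 * m) * B ^ 2)) := by gcongr
    _ = _ := by ring

end PartB4
end CF

set_option linter.unusedSectionVars false
set_option linter.unusedVariables false
set_option linter.unusedSimpArgs false
namespace CF
open Finset

section PartB5
variable {α : Type*} [Fintype α] [DecidableEq α]

lemma moment_num (N k : ℕ) [NeZero k] [NeZero N] (hk : 2 ≤ k) (hc : Fintype.card α = N * k) (S : Finset α)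
    (D m : ℕ) (hD : 1 ≤ D) (hm : S.card = m) (hm1 : 1 ≤ m) (γ : ℝ) (hγ : 0 < γ) (hγ' : γ ≤ 1 / 8)
    (hlog : Real.log ((N * k : ℕ) : ℝ) ≤ k) (hS : (((N * k : ℕ) : ℝ) - m) ≤ γ / 2 * ((N * k : ℕ) : ℝ))
    (hd : Real.exp (6 / γ) ≤ ((D : ℝ) + 2) / 4) :
    ((N * k).factorial : ℝ) * ((D + 2) * m).factorial ≤ ((Xset N k S (D + 2)).card : ℝ) *
      (1 / (1 - 1 / ((D : ℝ) + 1) ^ 2) * (1 / (1 - γ) * (1 + eps0 k (N * k) γ) ^ N) + Real.exp (-((N * k : ℕ) : ℝ))) := by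
  set n := N * k with hn
  have hmn : m ≤ n := by rw [← hm, ← hc]; exact card_le_univ S
  have hn0 : 0 < n := by omega
  have hnR : (0 : ℝ) < n := by exact_mod_cast hn0
  have hε := eps0_nonneg k n hγ
  set K : ℝ := 1 / (1 - γ) * (1 + eps0 k n γ) ^ N with hK
  have h1γ : 0 < 1 - γ := by linarith
  have hK0 : 0 ≤ K := by positivity
  have hUcard : ∀ J : Finset S, (univ \ S ∪ J.map (Function.Embedding.subtype _)).card = n - m + J.card := by
    intro J
    rw [card_union_of_disjoint, card_univ_sdiff, card_map, hc, hm]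
    rw [disjoint_left]
    intro x hx hx'
    simp only [mem_sdiff, mem_univ, true_and] at hx
    simp only [mem_map, Function.Embedding.subtype_apply] at hx'
    obtain ⟨y, _, rfl⟩ := hx'
    exact hx y.2
  have hJm : ∀ J : Finset S, J.card ≤ m := fun J => by
    have := card_le_univ J
    rwa [Fintype.card_coe, hm] at this
  let Ψ : ℕ → ℝ := fun j => if ((n - m + j : ℕ) : ℝ) ≤ γ * n then K else Real.exp n
  have hΨ : ∀ J : Finset S, ((QS N k (univ \ S ∪ J.map (Function.Embedding.subtype _))).card : ℝ) ≤
      (N * k).factorial * (m - J.card).factorial * Ψ J.card := by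
    intro J
    simp only [Ψ]
    have hsub : n - (n - m + J.card) = m - J.card := by
      have := hJm J; omega
    split_ifs with h
    · have := QS_bound N k hk hc (univ \ S ∪ J.map (Function.Embedding.subtype _)) γ hγ hγ' (by rw [hUcard J]; exact h)
      refine this.trans ?_
      rw [hUcard J, ← hn, hsub]
      gcongr
      unfold Psi
      rw [← hn, hK]
      refine mul_le_mul_of_nonneg_right ?_ (by positivity)
      rw [div_le_div_iff₀ (by nlinarith) h1γ]
      nlinarith
    · have := QS_trivial N k hc (univ \ S ∪ J.map (Function.Embedding.subtype _))
      rw [hUcard J, ← hn, hsub] at this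
      have h2 : ((QS N k (univ \ S ∪ J.map (Function.Embedding.subtype _))).card : ℝ) ≤ n.factorial * ((m - J.card).factorial * (n : ℝ) ^ N) := by
        exact_mod_cast this
      refine h2.trans ?_
      rw [← hn, mul_assoc]
      gcongr
      rw [← Real.exp_log hnR, ← Real.exp_nat_mul, Real.exp_log hnR]
      apply Real.exp_le_exp.2
      have hnk : (n : ℝ) = N * k := by rw [hn]; push_cast; rfl
      calc (N : ℝ) * Real.log n ≤ N * k := mul_le_mul_of_nonneg_left hlog (Nat.cast_nonneg _)
        _ = n := hnk.symm
  have hmain := moment_real N k hc S D m hD hm hm1 Ψ hΨ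
  refine hmain.trans (mul_le_mul_of_nonneg_left ?_ (Nat.cast_nonneg _))
  have hDR : (1 : ℝ) ≤ D := by exact_mod_cast hD
  set z : ℝ := 1 / ((D : ℝ) + 1) ^ 2 with hz
  have hz0 : 0 < z := by positivity
  have hz1 : z < 1 := by
    rw [hz, div_lt_one (by positivity)]; nlinarith
  have h1z : 0 < 1 - z := by linarith
  set A := D * m with hA
  set z' : ℝ := 1 / ((D : ℝ) + 2) with hz'
  have hz'0 : 0 < z' := by positivity
  have hz'1 : z' < 1 := by
    rw [hz', div_lt_one (by positivity)]; linarith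
  have htail : 1 / (1 - z') ^ (A + 1) ≤ Real.exp n := by
    have e : 1 / (1 - z') = 1 + 1 / ((D : ℝ) + 1) := by
      rw [hz']
      have : (1 : ℝ) - 1 / (D + 2) = (D + 1) / (D + 2) := by field_simp; ring
      rw [this]; field_simp; ring
    rw [← one_div_pow, e]
    have : 1 + 1 / ((D : ℝ) + 1) ≤ Real.exp (1 / ((D : ℝ) + 1)) := by
      have := Real.add_one_le_exp (1 / ((D : ℝ) + 1)); linarith
    calc (1 + 1 / ((D : ℝ) + 1)) ^ (A + 1) ≤ Real.exp (1 / ((D : ℝ) + 1)) ^ (A + 1) := by gcongr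
      _ = Real.exp ((A + 1 : ℕ) * (1 / ((D : ℝ) + 1))) := by rw [← Real.exp_nat_mul]
      _ ≤ Real.exp n := by
        apply Real.exp_le_exp.2
        have hmR : (1 : ℝ) ≤ m := by exact_mod_cast hm1
        have hmnR : (m : ℝ) ≤ n := by exact_mod_cast hmn
        rw [mul_one_div, div_le_iff₀ (by positivity), hA]
        push_cast
        nlinarith
  have hterm : ∀ j ∈ range (m + 1), ((j + A).choose A : ℝ) * z ^ j * Ψ j ≤
      K * (((j + A).choose A : ℝ) * z ^ j) + Real.exp (-(2 * n)) * (((j + A).choose A : ℝ) * z' ^ j) := by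
    intro j hj
    simp only [Ψ]
    split_ifs with h
    · have : 0 ≤ Real.exp (-(2 * n)) * (((j + A).choose A : ℝ) * z' ^ j) := by positivity
      linarith [mul_comm (((j + A).choose A : ℝ) * z ^ j) K]
    · have h0 : 0 ≤ K * (((j + A).choose A : ℝ) * z ^ j) := by positivity
      have hzz : z ≤ z' * (4 / ((D : ℝ) + 2)) := by
        rw [hz, hz', div_mul_div_comm, div_le_div_iff₀ (by positivity) (by positivity)]
        nlinarith
      have h4 : 4 / ((D : ℝ) + 2) ≤ Real.exp (-(6 / γ)) := by
        rw [Real.exp_neg, ← one_div, div_le_div_iff₀ (by positivity) (Real.exp_pos _)]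
        rw [le_div_iff₀ (by norm_num)] at hd
        linarith
      have hj2 : γ / 2 * n ≤ j := by
        push Not at h
        rw [Nat.cast_add, Nat.cast_sub hmn] at h
        linarith
      have h5 : z ^ j ≤ z' ^ j * Real.exp (-(3 * n)) := by
        calc z ^ j ≤ (z' * Real.exp (-(6 / γ))) ^ j := by
              gcongr; exact hzz.trans (by gcongr)
          _ = z' ^ j * Real.exp (j * -(6 / γ)) := by rw [mul_pow, ← Real.exp_nat_mul]
          _ ≤ _ := by
              gcongr
              have : 3 * (n : ℝ) ≤ j * (6 / γ) := by
                rw [mul_div_assoc', le_div_iff₀ hγ]; linarith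
              linarith
      have h6 : Real.exp (-(2 * n)) = Real.exp (-(3 * n)) * Real.exp n := by
        rw [← Real.exp_add]; congr 1; ring
      rw [h6]
      calc ((j + A).choose A : ℝ) * z ^ j * Real.exp n ≤ ((j + A).choose A : ℝ) * (z' ^ j * Real.exp (-(3 * n))) * Real.exp n := by gcongr
        _ = Real.exp (-(3 * n)) * Real.exp n * (((j + A).choose A : ℝ) * z' ^ j) := by ring
        _ ≤ _ := by linarith
  have hsum := Finset.sum_le_sum hterm
  rw [sum_add_distrib, ← mul_sum, ← mul_sum] at hsum
  have c1 := choose_sum A z hz0.le hz1 (range (m + 1))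
  have c2 := choose_sum A z' hz'0.le hz'1 (range (m + 1))
  have hzA : (1 - z) ^ A ≤ 1 := pow_le_one₀ h1z.le (by linarith)
  have hzA0 : 0 < (1 - z) ^ A := by positivity
  calc (1 - z) ^ A * ∑ j ∈ range (m + 1), ((j + A).choose A : ℝ) * z ^ j * Ψ j
      ≤ (1 - z) ^ A * (K * (1 / (1 - z) ^ (A + 1)) + Real.exp (-(2 * n)) * Real.exp n) := by
        refine mul_le_mul_of_nonneg_left (hsum.trans ?_) hzA0.le
        gcongr
        exact c2.trans htail
    _ = 1 / (1 - z) * K + (1 - z) ^ A * Real.exp (-n) := by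
        rw [← Real.exp_add, pow_succ, show -(2 * (n : ℝ)) + n = -n by ring]
        field_simp
    _ ≤ 1 / (1 - z) * K + 1 * Real.exp (-n) := by gcongr
    _ = _ := by rw [one_mul]

end PartB5
end CF

set_option linter.unusedSectionVars false
set_option linter.unusedVariables false
set_option linter.unusedSimpArgs false
namespace CF
open Finset

section PartB6

lemma inv_le_aux (x : ℝ) (h0 : 0 ≤ x) (h1 : x ≤ 1 / 2) : 1 / (1 - x) ≤ 1 + 2 * x := by
  rw [div_le_iff₀ (by linarith)]; nlinarith

set_option maxHeartbeats 1000000 in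
theorem count_good (η : ℝ) (hη : 0 < η) (hη1 : η < 1) :
    ∃ γ0 : ℝ, 0 < γ0 ∧ γ0 ≤ 1 / 16 ∧ ∃ d : ℕ, 3 ≤ d ∧ ∃ n0 : ℕ, ∀ (n N k : ℕ) [NeZero k], n0 ≤ n → Fintype.card (Fin n) = N * k →
      Real.log n ≤ k → ∀ S : Finset (Fin n), (n : ℝ) - S.card ≤ γ0 * n →
      (1 - η) * ((n.factorial : ℝ) * (d * S.card).factorial) ≤ ((Xset N k S d).card : ℝ) := by
  set δ := η / 8 with hδ
  have hδ0 : 0 < δ := by positivity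
  set γ : ℝ := min (min (1 / 8) (δ / 2)) (Real.exp (-10) / 16) with hγdef
  have hγ0 : 0 < γ := by
    rw [hγdef]
    have := Real.exp_pos (-10)
    refine lt_min (lt_min (by norm_num) (by positivity)) (by positivity)
  have hγ8 : γ ≤ 1 / 8 := (min_le_left _ _).trans (min_le_left _ _)
  have hγδ : γ ≤ δ / 2 := (min_le_left _ _).trans (min_le_right _ _)
  have hγe : γ ≤ Real.exp (-10) / 16 := min_le_right _ _
  obtain ⟨D, hDge⟩ := exists_nat_ge (4 * Real.exp (6 / γ) + 2 / δ + 1)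
  have hexp0 := Real.exp_pos (6 / γ)
  have hδi : 0 < 2 / δ := by positivity
  have hD1R : (1 : ℝ) ≤ D := by linarith
  have hD1 : 1 ≤ D := by exact_mod_cast hD1R
  obtain ⟨n0, hn0⟩ := exists_nat_ge (32 / (γ * δ) + 1 / δ + 3)
  refine ⟨γ / 2, by positivity, by linarith, D + 2, by omega, n0, ?_⟩
  intro n N k _ hn hc hlog S hS
  rw [Fintype.card_fin] at hc
  have hnR : 32 / (γ * δ) + 1 / δ + 3 ≤ (n : ℝ) := hn0.trans (by exact_mod_cast hn)
  have t1 : 0 < 32 / (γ * δ) := by positivity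
  have t2 : 0 < 1 / δ := by positivity
  have hn3 : (3 : ℝ) ≤ n := by linarith
  have hnpos : (0 : ℝ) < n := by linarith
  have hk1 : 1 < (k : ℝ) := by
    refine lt_of_lt_of_le ?_ hlog
    rw [Real.lt_log_iff_exp_lt hnpos]
    exact lt_of_lt_of_le Real.exp_one_lt_three hn3
  have hk : 2 ≤ k := by exact_mod_cast hk1
  have hN0 : N ≠ 0 := by
    rintro rfl
    rw [zero_mul] at hc
    rw [hc] at hnpos
    simp at hnpos
  have : NeZero N := ⟨hN0⟩
  have hm1 : 1 ≤ S.card := by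
    by_contra h
    have : S.card = 0 := by omega
    rw [this] at hS
    push_cast at hS
    nlinarith
  have h := moment_num (α := Fin n) N k hk (by rw [Fintype.card_fin, hc]) S D S.card hD1 rfl hm1 γ hγ0 hγ8
    (by rw [← hc]; exact hlog) (by rw [← hc]; exact hS) (by linarith)
  rw [← hc] at h
  set X := ((Xset N k S (D + 2)).card : ℝ)
  have hX0 : 0 ≤ X := Nat.cast_nonneg _
  -- bounds
  have b1 : 1 / (1 - 1 / ((D : ℝ) + 1) ^ 2) ≤ 1 + δ := by
    have hDd : 2 / δ ≤ D := by linarith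
    have hz : 1 / ((D : ℝ) + 1) ^ 2 ≤ δ / 2 := by
      rw [div_le_iff₀ hδ0] at hDd
      rw [div_le_iff₀ (by positivity)]
      nlinarith
    have hz2 : 1 / ((D : ℝ) + 1) ^ 2 ≤ 1 / 2 := by
      rw [div_le_div_iff₀ (by positivity) (by norm_num)]; nlinarith
    refine (inv_le_aux _ (by positivity) hz2).trans (by linarith)
  have b2 : 1 / (1 - γ) ≤ 1 + δ := (inv_le_aux _ hγ0.le (by linarith)).trans (by linarith)
  have hε := eps0_nonneg k n hγ0
  have hNn : N ≤ n := by rw [hc]; exact Nat.le_mul_of_pos_right _ (by omega)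
  have b3' : N * eps0 k n γ ≤ δ / 2 := by
    have h16 : (16 * γ) ^ k ≤ (1 / (n : ℝ)) ^ 10 := by
      calc (16 * γ) ^ k ≤ (Real.exp (-10)) ^ k := by gcongr; linarith
        _ = Real.exp (k * -10) := by rw [← Real.exp_nat_mul]
        _ ≤ Real.exp ((10 : ℕ) * -Real.log n) := by
          apply Real.exp_le_exp.2; push_cast; linarith
        _ = _ := by rw [Real.exp_nat_mul, Real.exp_neg, Real.exp_log hnpos, one_div]
    have hγk : γ ^ k = γ ^ (k - 1) * γ := by rw [← pow_succ]; congr 1; omega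
    have e1 : γ * (N * eps0 k n γ) = N * ((n : ℝ) + 1) ^ 3 * (16 * γ) ^ k := by
      unfold eps0; rw [mul_pow, hγk]; ring
    have hNR : (N : ℝ) ≤ n := by exact_mod_cast hNn
    have e2 : γ * (N * eps0 k n γ) ≤ 16 / n := by
      rw [e1]
      calc N * ((n : ℝ) + 1) ^ 3 * (16 * γ) ^ k ≤ n * ((n : ℝ) + n) ^ 3 * (1 / (n : ℝ)) ^ 10 := by
            gcongr; linarith
        _ = 8 * (1 / (n : ℝ)) ^ 6 := by field_simp; ring
        _ ≤ 8 * (1 / (n : ℝ)) ^ 1 := by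
            have : 1 / (n : ℝ) ≤ 1 := by rw [div_le_one hnpos]; linarith
            have := pow_le_pow_of_le_one (by positivity) this (show 1 ≤ 6 by norm_num)
            linarith
        _ ≤ 16 / n := by
            rw [pow_one, mul_one_div]; gcongr; norm_num
    have e3 : 16 / (n : ℝ) ≤ γ * (δ / 2) := by
      have : 32 / (γ * δ) ≤ n := by linarith
      rw [div_le_iff₀ (by positivity)] at this ⊢
      linarith
    exact le_of_mul_le_mul_left (e2.trans e3) hγ0
  have hδ18 : δ ≤ 1 / 8 := by rw [hδ]; linarith
  have b3 : (1 + eps0 k n γ) ^ N ≤ 1 + δ := by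
    calc (1 + eps0 k n γ) ^ N ≤ Real.exp (eps0 k n γ) ^ N := by
          gcongr
          linarith [Real.add_one_le_exp (eps0 k n γ)]
      _ = Real.exp (N * eps0 k n γ) := by rw [← Real.exp_nat_mul]
      _ ≤ Real.exp (δ / 2) := Real.exp_le_exp.2 b3'
      _ ≤ 1 / (1 - δ / 2) := by
          rw [le_div_iff₀ (by linarith)]
          have := Real.one_sub_le_exp_neg (δ / 2)
          calc Real.exp (δ / 2) * (1 - δ / 2) ≤ Real.exp (δ / 2) * Real.exp (-(δ / 2)) := by gcongr
            _ = 1 := by rw [← Real.exp_add]; simp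
      _ ≤ 1 + δ := (inv_le_aux _ (by positivity) (by linarith)).trans (by linarith)
  have b4 : Real.exp (-(n : ℝ)) ≤ δ := by
    have h1 : Real.exp (-(n : ℝ)) ≤ 1 / n := by
      rw [Real.exp_neg, ← one_div]
      gcongr
      linarith [Real.add_one_le_exp (n : ℝ)]
    refine h1.trans ?_
    have : 1 / δ ≤ n := by linarith
    rw [div_le_iff₀ hδ0] at this
    rw [div_le_iff₀ hnpos]; linarith
  have hR : 1 / (1 - 1 / ((D : ℝ) + 1) ^ 2) * (1 / (1 - γ) * (1 + eps0 k n γ) ^ N) + Real.exp (-(n : ℝ)) ≤ 1 + η := by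
    have : 0 ≤ 1 / (1 - γ) := by apply div_nonneg <;> linarith
    have hp0 : 0 ≤ (1 + eps0 k n γ) ^ N := by positivity
    have h8 : η = 8 * δ := by rw [hδ]; ring
    clear_value δ X
    generalize 1 / (1 - 1 / ((D : ℝ) + 1) ^ 2) = u1 at *
    generalize 1 / (1 - γ) = u2 at *
    generalize (1 + eps0 k n γ) ^ N = u3 at *
    have g1 : u2 * u3 ≤ (1 + δ) * (1 + δ) := mul_le_mul b2 b3 hp0 (by linarith)
    have g2 : u1 * (u2 * u3) ≤ (1 + δ) * ((1 + δ) * (1 + δ)) :=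
      mul_le_mul b1 g1 (mul_nonneg this hp0) (by linarith)
    have g3 : (1 + δ) * ((1 + δ) * (1 + δ)) + δ ≤ 1 + 8 * δ := by
      have q1 : δ * δ ≤ δ * 1 := by gcongr; linarith
      have q2 : δ * δ * δ ≤ δ * 1 * 1 := by gcongr; linarith
      linarith
    linarith
  have h2 := h.trans (mul_le_mul_of_nonneg_left hR hX0)
  calc (1 - η) * ((n.factorial : ℝ) * ((D + 2) * S.card).factorial) ≤ (1 - η) * (X * (1 + η)) := by
        apply mul_le_mul_of_nonneg_left h2; linarith
    _ = X - X * η ^ 2 := by ring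
    _ ≤ X := by
      have : 0 ≤ X * η ^ 2 := by positivity
      linarith

end PartB6
end CF

set_option linter.unusedSectionVars false
set_option linter.unusedVariables false
set_option linter.unusedSimpArgs false
namespace CF
open Finset

section PartC1
variable {W : Type*} [Fintype W] [DecidableEq W]

/-- Number of ones of `R` in `A × B`. -/
def ec (R : W × W → Bool) (A B : Finset W) : ℕ := ((A ×ˢ B).filter (fun e => R e = true)).card

lemma ec_row (R : W × W → Bool) (A B : Finset W) :
    ec R A B = ∑ x ∈ A, (B.filter (fun y => R (x, y) = true)).card := by
  unfold ec
  rw [card_filter, sum_product]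
  simp_rw [card_filter]

lemma ec_col (R : W × W → Bool) (A B : Finset W) :
    ec R A B = ∑ y ∈ B, (A.filter (fun x => R (x, y) = true)).card := by
  unfold ec
  rw [card_filter, sum_product_right]
  simp_rw [card_filter]

lemma ec_mono (R : W × W → Bool) {A B A' B' : Finset W} (hA : A ⊆ A') (hB : B ⊆ B') : ec R A B ≤ ec R A' B' := by
  unfold ec
  exact card_le_card (filter_subset_filter _ (product_subset_product hA hB))

def Sparse (R : W × W → Bool) (D1 a0 : ℕ) : Prop :=
  ∀ A B : Finset W, A.card = B.card → 1 ≤ A.card → A.card ≤ a0 → ec R A B < D1 * A.card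

def Dense (R : W × W → Bool) (D1 a0 y0 : ℕ) : Prop :=
  ∀ A Y : Finset W, A.card = a0 → Y.card = y0 → D1 * a0 ≤ ec R A Y ∧ D1 * a0 ≤ ec R Y A

lemma hall (R : W × W → Bool) (D1 a0 y0 : ℕ) (hD : 1 ≤ D1) (ha : 1 ≤ a0) (hs : Sparse R D1 a0) (hd : Dense R D1 a0 y0)
    (L M : Finset W) (hLM : L.card = M.card) (hL : 2 * y0 ≤ L.card)
    (hrow : ∀ x ∈ L, D1 ≤ (M.filter (fun y => R (x, y) = true)).card)
    (hcol : ∀ y ∈ M, D1 ≤ (L.filter (fun x => R (x, y) = true)).card) :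
    ∃ f : L → W, Function.Injective f ∧ ∀ x : L, f x ∈ M ∧ R (x, f x) = true := by
  have key : ∀ s : Finset L, s.card ≤ (s.biUnion (fun x => M.filter (fun y => R (x, y) = true))).card := by
    intro s
    by_contra hlt
    push Not at hlt
    set B := s.biUnion (fun x => M.filter (fun y => R (x, y) = true)) with hB
    set A := s.map (Function.Embedding.subtype _) with hA
    have hAc : A.card = s.card := card_map _
    rw [← hAc] at hlt
    have hAL : A ⊆ L := by
      intro x hx
      simp only [hA, mem_map, Function.Embedding.subtype_apply] at hx
      obtain ⟨y, _, rfl⟩ := hx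
      exact y.2
    have hBM : B ⊆ M := by
      intro y hy
      simp only [hB, mem_biUnion, mem_filter] at hy
      obtain ⟨_, _, h, _⟩ := hy
      exact h
    have hAB : ∀ x ∈ A, ∀ y ∈ M, R (x, y) = true → y ∈ B := by
      intro x hx y hy hR
      simp only [hA, mem_map, Function.Embedding.subtype_apply] at hx
      obtain ⟨z, hz, rfl⟩ := hx
      simp only [hB, mem_biUnion, mem_filter]
      exact ⟨z, hz, hy, hR⟩
    have hACard := card_le_card hAL
    -- complement on the column side
    set C := M \ B with hC
    have hCc : C.card = M.card - B.card := card_sdiff_of_subset hBM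
    have hzero : ∀ A' ⊆ A, ∀ C' ⊆ C, ec R A' C' = 0 := by
      intro A' hA' C' hC'
      rw [ec, card_eq_zero, filter_eq_empty_iff]
      rintro ⟨x, y⟩ hxy hR
      rw [mem_product] at hxy
      have hyC := hC' hxy.2
      rw [hC, mem_sdiff] at hyC
      exact hyC.2 (hAB x (hA' hxy.1) y hyC.1 hR)
    by_cases h1 : A.card ≤ a0
    · obtain ⟨B', hBB', hB'⟩ := exists_superset_card_eq (s := B) (n := A.card) hlt.le (card_le_univ A)
      have := hs A B' hB'.symm (by omega) h1
      have h2 : D1 * A.card ≤ ec R A B' := by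
        refine le_trans ?_ (ec_mono R (Subset.refl A) hBB')
        rw [ec_row, mul_comm, ← smul_eq_mul]
        refine card_nsmul_le_sum _ _ _ ?_
        intro x hx
        refine (hrow x (hAL hx)).trans (card_le_card ?_)
        intro y hy
        rw [mem_filter] at hy ⊢
        exact ⟨hAB x hx y hy.1 hy.2, hy.2⟩
      omega
    · push Not at h1
      by_cases h2 : y0 ≤ C.card
      · obtain ⟨A', hA', hA'c⟩ := exists_subset_card_eq (s := A) (n := a0) h1.le
        obtain ⟨C', hC', hC'c⟩ := exists_subset_card_eq (s := C) (n := y0) h2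
        have := (hd A' C' hA'c hC'c).1
        rw [hzero A' hA' C' hC'] at this
        have : 0 < D1 * a0 := by positivity
        omega
      · push Not at h2
        by_cases h3 : C.card ≤ a0
        · have hnC : (L \ A).card ≤ C.card := by
            rw [card_sdiff_of_subset hAL]; omega
          obtain ⟨B', hBB', hB'⟩ := exists_superset_card_eq (s := L \ A) (n := C.card) hnC (card_le_univ C)
          have := hs B' C hB' (by omega) (by omega)
          have h2 : D1 * C.card ≤ ec R B' C := by
            refine le_trans ?_ (ec_mono R hBB' (Subset.refl C))
            rw [ec_col, mul_comm, ← smul_eq_mul]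
            refine card_nsmul_le_sum _ _ _ ?_
            intro y hy
            have hyM : y ∈ M := (mem_sdiff.1 hy).1
            refine (hcol y hyM).trans (card_le_card ?_)
            intro x hx
            rw [mem_filter] at hx ⊢
            refine ⟨mem_sdiff.2 ⟨hx.1, fun hxA => ?_⟩, hx.2⟩
            exact (mem_sdiff.1 hy).2 (hAB x hxA y hyM hx.2)
          rw [hB'] at this
          omega
        · push Not at h3
          obtain ⟨C', hC', hC'c⟩ := exists_subset_card_eq (s := C) (n := a0) h3.le
          obtain ⟨A', hA', hA'c⟩ := exists_subset_card_eq (s := A) (n := y0) (by omega)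
          have := (hd C' A' hC'c hA'c).2
          rw [hzero A' hA' C' hC'] at this
          have : 0 < D1 * a0 := by positivity
          omega
  obtain ⟨f, hf, hf'⟩ := (Finset.all_card_le_biUnion_card_iff_exists_injective _).1 key
  exact ⟨f, hf, fun x => by simpa using hf' x⟩

/-- Permutation from minimum degree. -/
lemma hall_perm (R : W × W → Bool) (D1 a0 y0 : ℕ) (hD : 1 ≤ D1) (ha : 1 ≤ a0) (hs : Sparse R D1 a0) (hd : Dense R D1 a0 y0)
    (hL : 2 * y0 ≤ Fintype.card W)
    (hrow : ∀ x, D1 ≤ ec R {x} univ) (hcol : ∀ y, D1 ≤ ec R univ {y}) :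
    ∃ X : Equiv.Perm W, ∀ x, R (x, X x) = true := by
  obtain ⟨f, hf, hf'⟩ := hall R D1 a0 y0 hD ha hs hd univ univ rfl (by rwa [card_univ])
    (fun x _ => by have := hrow x; rw [ec_row] at this; simpa using this)
    (fun x _ => by have := hcol x; rw [ec_col] at this; simpa using this)
  let g : W → W := fun x => f ⟨x, mem_univ x⟩
  have hg : Function.Injective g := fun x y h => by
    have := hf h
    simpa using this
  exact ⟨Equiv.ofBijective g (Finite.injective_iff_bijective.1 hg), fun x => (hf' ⟨x, mem_univ x⟩).2⟩

end PartC1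
end CF

set_option linter.unusedSectionVars false
set_option linter.unusedVariables false
set_option linter.unusedSimpArgs false
namespace CF
open Finset

section PartC2
variable {V : Type*} [Fintype V] [DecidableEq V] {d : ℕ}

/-- All copies of elements of `S`. -/
def blk (d : ℕ) (S : Finset V) : Finset (V × Fin d) := S ×ˢ univ

lemma mem_blk {S : Finset V} {w : V × Fin d} : w ∈ blk d S ↔ w.1 ∈ S := by simp [blk]

lemma card_blk (S : Finset V) : (blk d S).card = S.card * d := by simp [blk]

lemma blk_mono {S T : Finset V} (h : S ⊆ T) : blk d S ⊆ blk d T := fun w hw => mem_blk.2 (h (mem_blk.1 hw))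

def GoodS (X : Equiv.Perm V) (R : (V × Fin d) × (V × Fin d) → Bool) (D1 : ℕ) (S : Finset V) : Prop :=
  ∀ x ∈ S, ∀ i : Fin d, D1 ≤ ((blk d (S.map X.toEmbedding)).filter (fun y => R ((x, i), y) = true)).card ∧
    D1 ≤ ((blk d S).filter (fun y => R (y, (X x, i)) = true)).card

open Classical in
noncomputable def core (X : Equiv.Perm V) (R : (V × Fin d) × (V × Fin d) → Bool) (D1 : ℕ) : Finset V :=
  univ.filter (fun x => ∃ S, GoodS X R D1 S ∧ x ∈ S)

lemma core_max (X : Equiv.Perm V) (R : (V × Fin d) × (V × Fin d) → Bool) (D1 : ℕ) (S : Finset V) (h : GoodS X R D1 S) :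
    S ⊆ core X R D1 := by
  intro x hx
  simp only [core, mem_filter, mem_univ, true_and]
  exact ⟨S, h, hx⟩

lemma good_step (X : Equiv.Perm V) (R : (V × Fin d) × (V × Fin d) → Bool) (D1 : ℕ) (S T : Finset V) (h : GoodS X R D1 S)
    (hST : S ⊆ T) (x : V) (hx : x ∈ S) (i : Fin d) :
    D1 ≤ ((blk d (T.map X.toEmbedding)).filter (fun y => R ((x, i), y) = true)).card ∧
    D1 ≤ ((blk d T).filter (fun y => R (y, (X x, i)) = true)).card := by
  have := h x hx i
  exact ⟨this.1.trans (card_le_card (filter_subset_filter _ (blk_mono (map_subset_map.2 hST)))),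
    this.2.trans (card_le_card (filter_subset_filter _ (blk_mono hST)))⟩

lemma core_good (X : Equiv.Perm V) (R : (V × Fin d) × (V × Fin d) → Bool) (D1 : ℕ) : GoodS X R D1 (core X R D1) := by
  intro x hx i
  have hx' := hx
  simp only [core, mem_filter, mem_univ, true_and] at hx
  obtain ⟨S, hS, hxS⟩ := hx
  exact good_step X R D1 S _ hS (core_max X R D1 S hS) x hxS i

lemma good_union (X : Equiv.Perm V) (R : (V × Fin d) × (V × Fin d) → Bool) (D1 : ℕ) (S T : Finset V) (h : GoodS X R D1 S)
    (h' : GoodS X R D1 T) : GoodS X R D1 (S ∪ T) := by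
  intro x hx i
  rcases mem_union.1 hx with hx | hx
  · exact good_step X R D1 S _ h subset_union_left x hx i
  · exact good_step X R D1 T _ h' subset_union_right x hx i

/-- Row/column weak vertices. -/
def rweak (X : Equiv.Perm V) (R : (V × Fin d) × (V × Fin d) → Bool) (D1 : ℕ) (S : Finset V) (x : V) : Prop :=
  ∃ i : Fin d, ((blk d (S.map X.toEmbedding)).filter (fun y => R ((x, i), y) = true)).card < D1
def cweak (X : Equiv.Perm V) (R : (V × Fin d) × (V × Fin d) → Bool) (D1 : ℕ) (S : Finset V) (x : V) : Prop :=
  ∃ i : Fin d, ((blk d S).filter (fun y => R (y, (X x, i)) = true)).card < D1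

lemma core_exists (X : Equiv.Perm V) (R : (V × Fin d) × (V × Fin d) → Bool) (D1 : ℕ) (t : ℕ) :
    (∃ S, GoodS X R D1 S ∧ Fintype.card V ≤ S.card + t) ∨
    (∃ S : Finset V, S.card + t = Fintype.card V ∧ ∀ x, x ∉ S → rweak X R D1 S x ∨ cweak X R D1 S x) := by
  induction t with
  | zero => right; exact ⟨univ, by simp, fun x hx => absurd (mem_univ x) hx⟩
  | succ t ih =>
    rcases ih with ⟨S, h1, h2⟩ | ⟨S, h1, h2⟩
    · left; exact ⟨S, h1, by omega⟩
    · by_cases hg : GoodS X R D1 S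
      · left; exact ⟨S, hg, by omega⟩
      · right
        unfold GoodS at hg
        push Not at hg
        obtain ⟨x, hx, i, hxi⟩ := hg
        have hweak : rweak X R D1 S x ∨ cweak X R D1 S x := by
          by_cases h3 : D1 ≤ ((blk d (S.map X.toEmbedding)).filter (fun y => R ((x, i), y) = true)).card
          · right; exact ⟨i, hxi h3⟩
          · left; exact ⟨i, by omega⟩
        have hall : ∀ y, y ∉ S.erase x → rweak X R D1 S y ∨ cweak X R D1 S y := by
          intro y hy
          by_cases hyx : y = x
          · rw [hyx]; exact hweak
          · exact h2 y (fun h => hy (mem_erase.2 ⟨hyx, h⟩))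
        refine ⟨S.erase x, ?_, fun y hy => ?_⟩
        · rw [card_erase_of_mem hx]
          have : 0 < S.card := card_pos.2 ⟨x, hx⟩
          omega
        · rcases hall y hy with ⟨i, hi⟩ | ⟨i, hi⟩
          · left
            exact ⟨i, lt_of_le_of_lt (card_le_card (filter_subset_filter _ (blk_mono (map_subset_map.2 (erase_subset _ _))))) hi⟩
          · right
            exact ⟨i, lt_of_le_of_lt (card_le_card (filter_subset_filter _ (blk_mono (erase_subset _ _)))) hi⟩

lemma core_card (X : Equiv.Perm V) (R : (V × Fin d) × (V × Fin d) → Bool) (D1 a0 y0 : ℕ) (ha : 1 ≤ a0)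
    (hd : Dense R D1 a0 y0) (hy : y0 + 2 * a0 * d ≤ Fintype.card V * d) :
    Fintype.card V ≤ (core X R D1).card + 2 * a0 := by
  classical
  rcases core_exists X R D1 (2 * a0) with ⟨S, h1, h2⟩ | ⟨S, h1, h2⟩
  · have := card_le_card (core_max X R D1 S h1)
    omega
  · exfalso
    have hSd : y0 ≤ S.card * d := by
      rw [← h1, add_mul] at hy; omega
    have hc : (univ \ S).card = 2 * a0 := by rw [card_univ_sdiff]; omega
    have hsplit : a0 ≤ ((univ \ S).filter (fun x => rweak X R D1 S x)).card ∨ a0 ≤ ((univ \ S).filter (fun x => cweak X R D1 S x)).card := by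
      by_contra hcon
      push Not at hcon
      have : univ \ S ⊆ ((univ \ S).filter (fun x => rweak X R D1 S x)) ∪ ((univ \ S).filter (fun x => cweak X R D1 S x)) := by
        intro x hx
        have hxS : x ∉ S := (mem_sdiff.1 hx).2
        rcases h2 x hxS with h | h
        · exact mem_union_left _ (mem_filter.2 ⟨hx, h⟩)
        · exact mem_union_right _ (mem_filter.2 ⟨hx, h⟩)
      have := (card_le_card this).trans (card_union_le _ _)
      omega
    rcases hsplit with h | h
    · obtain ⟨A, hA, hAc⟩ := exists_subset_card_eq h
      have hw : ∀ x : A, ∃ i : Fin d, ((blk d (S.map X.toEmbedding)).filter (fun y => R ((x, i), y) = true)).card < D1 :=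
        fun x => (mem_filter.1 (hA x.2)).2
      choose i hi using hw
      let A' : Finset (V × Fin d) := A.attach.image (fun x => (x.1, i x))
      have hA'c : A'.card = a0 := by
        rw [card_image_of_injective, card_attach, hAc]
        intro x y hxy
        exact Subtype.ext (Prod.mk.inj hxy).1
      obtain ⟨Y, hY, hYc⟩ := exists_subset_card_eq (s := blk d (S.map X.toEmbedding)) (n := y0) (by rw [card_blk, card_map]; exact hSd)
      have h5 := (hd A' Y hA'c hYc).1
      have h6 : ec R A' Y < ∑ w ∈ A', D1 := by
        rw [ec_row]
        refine sum_lt_sum_of_nonempty (card_pos.1 (by omega)) ?_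
        intro w hw
        simp only [A', mem_image, mem_attach, true_and] at hw
        obtain ⟨x, rfl⟩ := hw
        exact lt_of_le_of_lt (card_le_card (filter_subset_filter _ hY)) (hi x)
      rw [sum_const, hA'c, smul_eq_mul, mul_comm] at h6
      omega
    · obtain ⟨A, hA, hAc⟩ := exists_subset_card_eq h
      have hw : ∀ x : A, ∃ i : Fin d, ((blk d S).filter (fun y => R (y, (X x, i)) = true)).card < D1 :=
        fun x => (mem_filter.1 (hA x.2)).2
      choose i hi using hw
      let A' : Finset (V × Fin d) := A.attach.image (fun x => (X x.1, i x))
      have hA'c : A'.card = a0 := by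
        rw [card_image_of_injective, card_attach, hAc]
        intro x y hxy
        exact Subtype.ext (X.injective (Prod.mk.inj hxy).1)
      obtain ⟨Y, hY, hYc⟩ := exists_subset_card_eq (s := blk d S) (n := y0) (by rw [card_blk]; exact hSd)
      have h5 := (hd A' Y hA'c hYc).2
      have h6 : ec R Y A' < ∑ w ∈ A', D1 := by
        rw [ec_col]
        refine sum_lt_sum_of_nonempty (card_pos.1 (by omega)) ?_
        intro w hw
        simp only [A', mem_image, mem_attach, true_and] at hw
        obtain ⟨x, rfl⟩ := hw
        exact lt_of_le_of_lt (card_le_card (filter_subset_filter _ hY)) (hi x)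
      rw [sum_const, hA'c, smul_eq_mul, mul_comm] at h6
      omega

/-- Permuting the row half-edges. -/
def actR (τ : Equiv.Perm (V × Fin d)) (R : (V × Fin d) × (V × Fin d) → Bool) : (V × Fin d) × (V × Fin d) → Bool :=
  fun e => R (τ e.1, e.2)

lemma good_act (X : Equiv.Perm V) (R : (V × Fin d) × (V × Fin d) → Bool) (D1 : ℕ) (T : Finset V) (τ : Equiv.Perm (V × Fin d))
    (hτ : ∀ w, w ∈ blk d T ↔ τ w ∈ blk d T) (h : GoodS X R D1 T) : GoodS X (actR τ R) D1 T := by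
  intro x hx i
  refine ⟨?_, ?_⟩
  · have hw : τ (x, i) ∈ blk d T := (hτ _).1 (mem_blk.2 hx)
    exact (h (τ (x, i)).1 (mem_blk.1 hw) (τ (x, i)).2).1
  · refine (h x hx i).2.trans (le_of_eq ?_)
    symm
    refine card_bij (fun w _ => τ w) ?_ ?_ ?_
    · intro w hw
      rw [mem_filter] at hw ⊢
      exact ⟨(hτ _).1 hw.1, hw.2⟩
    · intro w _ w' _ h
      exact τ.injective h
    · intro w hw
      rw [mem_filter] at hw
      refine ⟨τ.symm w, ?_, by simp⟩
      rw [mem_filter]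
      refine ⟨(hτ _).2 (by simpa using hw.1), ?_⟩
      simpa [actR] using hw.2

lemma supp_inv (τ : Equiv.Perm (V × Fin d)) (S T : Finset V) (hST : S ⊆ T) (hτ : ∀ w, w ∉ blk d S → τ w = w) :
    ∀ w, w ∈ blk d T ↔ τ w ∈ blk d T := by
  intro w
  by_cases hw : w ∈ blk d S
  · have h1 : τ w ∈ blk d S := by
      by_contra h
      have := τ.injective (hτ _ h)
      rw [this] at h
      exact h hw
    exact ⟨fun _ => blk_mono hST h1, fun _ => blk_mono hST hw⟩
  · rw [hτ w hw]

lemma core_act (X : Equiv.Perm V) (R : (V × Fin d) × (V × Fin d) → Bool) (D1 : ℕ) (τ : Equiv.Perm (V × Fin d))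
    (hτ : ∀ w, w ∉ blk d (core X R D1) → τ w = w) : core X (actR τ R) D1 = core X R D1 := by
  set S := core X R D1 with hS
  have hSg : GoodS X (actR τ R) D1 S := good_act X R D1 S τ (supp_inv τ S S (Subset.refl _) hτ) (core_good X R D1)
  apply Subset.antisymm
  · have h1 := core_good X (actR τ R) D1
    have h2 : S ⊆ core X (actR τ R) D1 := core_max _ _ _ _ hSg
    have hτ' : ∀ w, w ∉ blk d S → τ⁻¹ w = w := by
      intro w hw
      have := hτ w hw
      conv_lhs => rw [← this]
      simp
    have h3 := good_act X (actR τ R) D1 _ τ⁻¹ (supp_inv τ⁻¹ S _ h2 hτ') h1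
    have h4 : actR τ⁻¹ (actR τ R) = R := by
      funext e
      simp [actR]
    rw [h4] at h3
    exact core_max _ _ _ _ h3
  · exact core_max _ _ _ _ hSg

/-- A matching of the copies of `S` to the copies of `X S`. -/
def HasM (X : Equiv.Perm V) (R : (V × Fin d) × (V × Fin d) → Bool) (S : Finset V) : Prop :=
  ∃ M : Equiv.Perm (S × Fin d), ∀ w : S × Fin d, R ((w.1, w.2), (X (M w).1, (M w).2)) = true

lemma hasM_of (X : Equiv.Perm V) (R : (V × Fin d) × (V × Fin d) → Bool) (D1 a0 y0 : ℕ) (hD : 1 ≤ D1) (ha : 1 ≤ a0)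
    (hs : Sparse R D1 a0) (hd : Dense R D1 a0 y0) (S : Finset V) (hS : GoodS X R D1 S) (hy : 2 * y0 ≤ S.card * d) :
    HasM X R S := by
  obtain ⟨f, hf, hf'⟩ := hall R D1 a0 y0 hD ha hs hd (blk d S) (blk d (S.map X.toEmbedding))
    (by rw [card_blk, card_blk, card_map]) (by rw [card_blk]; exact hy)
    (fun w hw => (hS w.1 (mem_blk.1 hw) w.2).1)
    (fun w hw => by
      have := mem_blk.1 hw
      rw [mem_map] at this
      obtain ⟨x, hx, hxw⟩ := this
      have h2 := (hS x hx w.2).2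
      have : (X x, w.2) = w := Prod.ext hxw rfl
      rw [this] at h2
      exact h2)
  have hmem : ∀ w : blk d S, X.symm (f w).1 ∈ S := by
    intro w
    have := mem_blk.1 (hf' w).1
    rw [mem_map] at this
    obtain ⟨x, hx, hxw⟩ := this
    rw [← hxw]
    simpa using hx
  let lift : S × Fin d → blk d S := fun w => ⟨(w.1, w.2), mem_blk.2 w.1.2⟩
  have hlift : Function.Injective lift := by
    rintro ⟨⟨x, hx⟩, i⟩ ⟨⟨y, hy⟩, j⟩ h
    simp only [lift, Subtype.mk.injEq, Prod.mk.injEq] at h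
    obtain ⟨rfl, rfl⟩ := h
    rfl
  let g : S × Fin d → S × Fin d := fun w => (⟨X.symm (f (lift w)).1, hmem _⟩, (f (lift w)).2)
  have hg : Function.Injective g := by
    intro w w' h
    simp only [g, Prod.mk.injEq, Subtype.mk.injEq, EmbeddingLike.apply_eq_iff_eq] at h
    exact hlift (hf (Prod.ext h.1 h.2))
  refine ⟨Equiv.ofBijective g (Finite.injective_iff_bijective.1 hg), fun w => ?_⟩
  have := (hf' (lift w)).2
  simp only [Equiv.ofBijective_apply, g, Equiv.apply_symm_apply]
  exact this

end PartC2
end CF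

set_option linter.unusedSectionVars false
set_option linter.unusedVariables false
set_option linter.unusedSimpArgs false
namespace CF
open Finset

section PartD0
variable {ι : Type*} [Fintype ι] [DecidableEq ι]

/-- Product Bernoulli weight. -/
noncomputable def wt (p : ι → ℝ) (ω : ι → Bool) : ℝ := ∏ i, if ω i then p i else 1 - p i

/-- Expectation. -/
noncomputable def Ex (p : ι → ℝ) (F : (ι → Bool) → ℝ) : ℝ := ∑ ω, wt p ω * F ω

open Classical in
/-- Indicator. -/
noncomputable def ind (E : Prop) : ℝ := if E then 1 else 0

lemma ind_nonneg (E : Prop) : 0 ≤ ind E := by unfold ind; split_ifs <;> norm_num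
lemma ind_le_one (E : Prop) : ind E ≤ 1 := by unfold ind; split_ifs <;> norm_num
lemma ind_true {E : Prop} (h : E) : ind E = 1 := by simp [ind, h]
lemma ind_false {E : Prop} (h : ¬ E) : ind E = 0 := by simp [ind, h]
lemma ind_mono {E F : Prop} (h : E → F) : ind E ≤ ind F := by
  by_cases hE : E
  · rw [ind_true hE, ind_true (h hE)]
  · rw [ind_false hE]; exact ind_nonneg F
lemma ind_not (E : Prop) : ind (¬ E) = 1 - ind E := by
  by_cases hE : E <;> simp [ind, hE]

/-- Probability. -/
noncomputable def Pr (p : ι → ℝ) (E : (ι → Bool) → Prop) : ℝ := Ex p (fun ω => ind (E ω))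

lemma wt_nonneg {p : ι → ℝ} (h0 : ∀ i, 0 ≤ p i) (h1 : ∀ i, p i ≤ 1) (ω : ι → Bool) : 0 ≤ wt p ω := by
  unfold wt
  refine prod_nonneg fun i _ => ?_
  split_ifs
  · exact h0 i
  · linarith [h1 i]

lemma ex_prod (p : ι → ℝ) (g : ι → Bool → ℝ) :
    Ex p (fun ω => ∏ i, g i (ω i)) = ∏ i, (p i * g i true + (1 - p i) * g i false) := by
  unfold Ex wt
  have : ∀ i, (p i * g i true + (1 - p i) * g i false) = ∑ b : Bool, (if b then p i else 1 - p i) * g i b := by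
    intro i; simp
  simp_rw [this]
  rw [Finset.prod_univ_sum]
  rw [Fintype.piFinset_univ]
  refine sum_congr rfl fun ω _ => ?_
  rw [← prod_mul_distrib]

lemma ex_one (p : ι → ℝ) : Ex p (fun _ => 1) = 1 := by
  have := ex_prod p (fun _ _ => 1)
  simpa using this

lemma ex_mono {p : ι → ℝ} (h0 : ∀ i, 0 ≤ p i) (h1 : ∀ i, p i ≤ 1) {F G : (ι → Bool) → ℝ} (h : ∀ ω, F ω ≤ G ω) :
    Ex p F ≤ Ex p G :=
  sum_le_sum fun ω _ => mul_le_mul_of_nonneg_left (h ω) (wt_nonneg h0 h1 ω)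

lemma ex_sum {T : Type*} (p : ι → ℝ) (s : Finset T) (F : T → (ι → Bool) → ℝ) :
    Ex p (fun ω => ∑ t ∈ s, F t ω) = ∑ t ∈ s, Ex p (F t) := by
  unfold Ex
  rw [sum_comm]
  simp_rw [mul_sum]

lemma ex_mul (p : ι → ℝ) (c : ℝ) (F : (ι → Bool) → ℝ) : Ex p (fun ω => c * F ω) = c * Ex p F := by
  unfold Ex
  rw [mul_sum]
  exact sum_congr rfl fun ω _ => by ring

lemma pr_nonneg {p : ι → ℝ} (h0 : ∀ i, 0 ≤ p i) (h1 : ∀ i, p i ≤ 1) (E : (ι → Bool) → Prop) : 0 ≤ Pr p E :=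
  sum_nonneg fun ω _ => mul_nonneg (wt_nonneg h0 h1 ω) (ind_nonneg _)

lemma pr_le_one {p : ι → ℝ} (h0 : ∀ i, 0 ≤ p i) (h1 : ∀ i, p i ≤ 1) (E : (ι → Bool) → Prop) : Pr p E ≤ 1 := by
  rw [← ex_one p]
  exact ex_mono h0 h1 fun ω => ind_le_one _

lemma pr_mono {p : ι → ℝ} (h0 : ∀ i, 0 ≤ p i) (h1 : ∀ i, p i ≤ 1) {E F : (ι → Bool) → Prop} (h : ∀ ω, E ω → F ω) :
    Pr p E ≤ Pr p F := ex_mono h0 h1 fun ω => ind_mono (h ω)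

lemma pr_not (p : ι → ℝ) (E : (ι → Bool) → Prop) : Pr p (fun ω => ¬ E ω) = 1 - Pr p E := by
  rw [← ex_one p]
  unfold Pr Ex
  rw [← sum_sub_distrib]
  exact sum_congr rfl fun ω _ => by simp only [ind_not]; ring

lemma pr_or {p : ι → ℝ} (h0 : ∀ i, 0 ≤ p i) (h1 : ∀ i, p i ≤ 1) (E F : (ι → Bool) → Prop) :
    Pr p (fun ω => E ω ∨ F ω) ≤ Pr p E + Pr p F := by
  unfold Pr Ex
  rw [← sum_add_distrib]
  refine sum_le_sum fun ω _ => ?_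
  rw [← mul_add]
  refine mul_le_mul_of_nonneg_left ?_ (wt_nonneg h0 h1 ω)
  by_cases h : E ω <;> by_cases h' : F ω <;> simp [ind, h, h']

lemma pr_union {T : Type*} {p : ι → ℝ} (h0 : ∀ i, 0 ≤ p i) (h1 : ∀ i, p i ≤ 1) (s : Finset T)
    (E : T → (ι → Bool) → Prop) :
    Pr p (fun ω => ∃ t ∈ s, E t ω) ≤ ∑ t ∈ s, Pr p (E t) := by
  unfold Pr
  rw [← ex_sum]
  refine ex_mono h0 h1 fun ω => ?_
  by_cases h : ∃ t ∈ s, E t ω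
  · obtain ⟨t, ht, hE⟩ := h
    rw [ind_true ⟨t, ht, hE⟩, ← ind_true hE]
    exact single_le_sum (f := fun t => ind (E t ω)) (fun t _ => ind_nonneg _) ht
  · rw [ind_false h]
    exact sum_nonneg fun t _ => ind_nonneg _

lemma mgf (p : ℝ) (h0 : 0 ≤ p) (h1 : p ≤ 1) (T : Finset ι) (s : ℝ) :
    Ex (fun _ : ι => p) (fun ω => Real.exp (s * (T.filter (fun i => ω i = true)).card)) ≤
      Real.exp ((Real.exp s - 1) * p * T.card) := by
  have e : ∀ ω : ι → Bool, Real.exp (s * (T.filter (fun i => ω i = true)).card) =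
      ∏ i, (fun (i : ι) (b : Bool) => if i ∈ T then (if b then Real.exp s else 1) else 1) i (ω i) := by
    intro ω
    rw [mul_comm, Real.exp_nat_mul]
    simp only
    rw [prod_ite_mem, univ_inter, ← prod_filter, prod_const]
  rw [show (fun ω : ι → Bool => Real.exp (s * (T.filter (fun i => ω i = true)).card)) = _ from funext e]
  rw [ex_prod (fun _ => p) (fun (i : ι) (b : Bool) => if i ∈ T then (if b then Real.exp s else 1) else 1)]
  have : ∀ i, p * (if i ∈ T then (if true = true then Real.exp s else 1) else 1) + (1 - p) * (if i ∈ T then (if false = true then Real.exp s else 1) else 1)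
      = if i ∈ T then 1 + (Real.exp s - 1) * p else 1 := by
    intro i
    split_ifs <;> simp_all <;> ring
  rw [prod_congr rfl (fun i _ => this i)]
  rw [prod_ite_mem, univ_inter, prod_const]
  rw [mul_comm ((Real.exp s - 1) * p), Real.exp_nat_mul]
  refine pow_le_pow_left₀ ?_ ?_ _
  · nlinarith [Real.exp_pos s]
  · rw [add_comm]; exact Real.add_one_le_exp _

lemma tail_up (p : ℝ) (h0 : 0 ≤ p) (h1 : p ≤ 1) (T : Finset ι) (s : ℝ) (hs : 0 ≤ s) (m : ℕ) :
    Pr (fun _ : ι => p) (fun ω => m ≤ (T.filter (fun i => ω i = true)).card) ≤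
      Real.exp ((Real.exp s - 1) * p * T.card - s * m) := by
  rw [sub_eq_add_neg, Real.exp_add]
  have := mgf p h0 h1 T s
  calc _ ≤ Ex (fun _ : ι => p) (fun ω => Real.exp (-(s * m)) * Real.exp (s * (T.filter (fun i => ω i = true)).card)) := by
        refine ex_mono (fun _ => h0) (fun _ => h1) fun ω => ?_
        by_cases h : m ≤ (T.filter (fun i => ω i = true)).card
        · rw [ind_true h, ← Real.exp_add, Real.one_le_exp_iff]
          have : (m : ℝ) ≤ (T.filter (fun i => ω i = true)).card := by exact_mod_cast h
          nlinarith
        · rw [ind_false h]; positivity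
    _ ≤ _ := by rw [ex_mul, mul_comm]; exact mul_le_mul_of_nonneg_right this (Real.exp_pos _).le

lemma tail_down (p : ℝ) (h0 : 0 ≤ p) (h1 : p ≤ 1) (T : Finset ι) (s : ℝ) (hs : 0 ≤ s) (m : ℕ) :
    Pr (fun _ : ι => p) (fun ω => (T.filter (fun i => ω i = true)).card < m) ≤
      Real.exp (s * m - (1 - Real.exp (-s)) * p * T.card) := by
  have := mgf p h0 h1 T (-s)
  calc _ ≤ Ex (fun _ : ι => p) (fun ω => Real.exp (s * m) * Real.exp (-s * (T.filter (fun i => ω i = true)).card)) := by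
        refine ex_mono (fun _ => h0) (fun _ => h1) fun ω => ?_
        by_cases h : (T.filter (fun i => ω i = true)).card < m
        · rw [ind_true h, ← Real.exp_add, Real.one_le_exp_iff]
          have : ((T.filter (fun i => ω i = true)).card : ℝ) ≤ m := by exact_mod_cast h.le
          nlinarith
        · rw [ind_false h]; positivity
    _ ≤ Real.exp (s * m) * Real.exp ((Real.exp (-s) - 1) * p * T.card) := by
        rw [ex_mul]; exact mul_le_mul_of_nonneg_left this (Real.exp_pos _).le
    _ = _ := by rw [← Real.exp_add]; congr 1; ring

end PartD0
end CF

set_option linter.unusedSectionVars false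
set_option linter.unusedVariables false
set_option linter.unusedSimpArgs false
namespace CF
open Finset

section PartE1
variable {ι : Type*} [Fintype ι] [DecidableEq ι]

lemma wt_comp (p : ℝ) (e : Equiv.Perm ι) (ω : ι → Bool) : wt (fun _ => p) (ω ∘ e) = wt (fun _ => p) ω := by
  unfold wt
  exact Equiv.prod_comp e (fun i => if ω i then p else 1 - p)

lemma ex_comp (p : ℝ) (e : Equiv.Perm ι) (F : (ι → Bool) → ℝ) :
    Ex (fun _ => p) (fun ω => F (ω ∘ e)) = Ex (fun _ => p) F := by
  unfold Ex
  have h : ∀ ω : ι → Bool, wt (fun _ => p) ω * F (ω ∘ e) = (fun ω' => wt (fun _ => p) ω' * F ω') ((Equiv.arrowCongr e.symm (Equiv.refl Bool)) ω) := by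
    intro ω
    have : (Equiv.arrowCongr e.symm (Equiv.refl Bool)) ω = ω ∘ e := by
      ext x; simp [Equiv.arrowCongr]
    simp only [this, wt_comp]
  rw [sum_congr rfl (fun ω _ => h ω)]
  exact Equiv.sum_comp _ (fun ω' => wt (fun _ => p) ω' * F ω')

variable {V : Type*} [Fintype V] [DecidableEq V] {d : ℕ}

/-- `S × Fin d` as a subtype of `V × Fin d`. -/
def subEq (S : Finset V) (d : ℕ) : (S × Fin d) ≃ {w : V × Fin d // w.1 ∈ S} where
  toFun w := ⟨(w.1.1, w.2), w.1.2⟩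
  invFun w := (⟨w.1.1, w.2⟩, w.1.2)
  left_inv _ := rfl
  right_inv _ := rfl

/-- Extension of a permutation. -/
noncomputable def extP (S : Finset V) (θ : Equiv.Perm (S × Fin d)) : Equiv.Perm (V × Fin d) :=
  θ.extendDomain (subEq S d)

lemma extP_mem (S : Finset V) (θ : Equiv.Perm (S × Fin d)) (w : S × Fin d) :
    extP S θ (w.1.1, w.2) = ((θ w).1.1, (θ w).2) :=
  Equiv.Perm.extendDomain_apply_image θ (subEq S d) w

lemma extP_not (S : Finset V) (θ : Equiv.Perm (S × Fin d)) (w : V × Fin d) (h : w ∉ blk d S) :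
    extP S θ w = w :=
  Equiv.Perm.extendDomain_apply_not_subtype θ (subEq S d) (fun h' => h (mem_blk.2 h'))

lemma hasM_act (X : Equiv.Perm V) (R : (V × Fin d) × (V × Fin d) → Bool) (S : Finset V) (θ : Equiv.Perm (S × Fin d))
    (h : HasM X R S) : HasM X (actR (extP S θ) R) S := by
  obtain ⟨M, hM⟩ := h
  refine ⟨M * θ, fun w => ?_⟩
  have := hM (θ w)
  simp only [actR, extP_mem, Equiv.Perm.mul_apply]
  exact this

/-- Success of the pair of random structures. -/
def succF (N k : ℕ) [NeZero k] (B : V × V → Bool) (R : (V × Fin d) × (V × Fin d) → Bool) : Prop :=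
  ∃ f : Arr N k V, ∀ x, B (x, sg f x) = true ∨ ∃ i j, R ((x, i), (sg f x, j)) = true

def colB (β : Equiv.Perm V) (B : V × V → Bool) : V × V → Bool := fun e => B (e.1, β⁻¹ e.2)
def colR (β : Equiv.Perm V) (R : (V × Fin d) × (V × Fin d) → Bool) : (V × Fin d) × (V × Fin d) → Bool :=
  fun e => R (e.1, (β⁻¹ e.2.1, e.2.2))

lemma succ_of (N k : ℕ) [NeZero k] (B : V × V → Bool) (R : (V × Fin d) × (V × Fin d) → Bool) (X β : Equiv.Perm V)
    (hB : ∀ x, B (x, X x) = true) (S : Finset V) (M θ : Equiv.Perm (S × Fin d))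
    (hM : ∀ w, R ((w.1, w.2), (X (M w).1, (M w).2)) = true) (h : (β * X, M * θ) ∈ Xset N k S d) :
    succF N k (colB β B) (colR β (actR (extP S θ) R)) := by
  simp only [Xset, mem_filter, mem_univ, true_and] at h
  obtain ⟨⟨f, a⟩, hfa⟩ := h
  simp only [Nset, mem_filter, mem_univ, true_and] at hfa
  refine ⟨f, fun x => ?_⟩
  by_cases hx : x ∈ S
  · right
    have h2 := hfa.2 ⟨x, hx⟩
    simp only at h2
    refine ⟨a ⟨x, hx⟩, (M (θ (⟨x, hx⟩, a ⟨x, hx⟩))).2, ?_⟩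
    have := hM (θ (⟨x, hx⟩, a ⟨x, hx⟩))
    have e := extP_mem S θ (⟨x, hx⟩, a ⟨x, hx⟩)
    simp only at e
    rw [h2]
    simp only [colR, actR, e, Equiv.Perm.mul_apply]
    simpa using this
  · left
    rw [hfa.1 x hx]
    simpa [colB] using hB x

end PartE1
end CF

set_option linter.unusedSectionVars false
set_option linter.unusedVariables false
set_option linter.unusedSimpArgs false
namespace CF
open Finset

section PartE2
variable {V : Type*} [Fintype V] [DecidableEq V] {d : ℕ}

/-- Number of successful relabellings. -/
noncomputable def Gct (N k : ℕ) [NeZero k] (B : V × V → Bool) (R : (V × Fin d) × (V × Fin d) → Bool) : ℝ :=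
  ∑ β : Equiv.Perm V, ind (succF N k (colB β B) (colR β R))

lemma gct_nonneg (N k : ℕ) [NeZero k] (B : V × V → Bool) (R : (V × Fin d) × (V × Fin d) → Bool) : 0 ≤ Gct N k B R :=
  sum_nonneg fun _ _ => ind_nonneg _

lemma gct_sum (N k : ℕ) [NeZero k] (B : V × V → Bool) (R : (V × Fin d) × (V × Fin d) → Bool) (X : Equiv.Perm V)
    (hB : ∀ x, B (x, X x) = true) (S : Finset V) (hM : HasM X R S) :
    ((Xset N k S d).card : ℝ) ≤ ∑ θ : Equiv.Perm (S × Fin d), Gct N k B (actR (extP S θ) R) := by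
  obtain ⟨M, hM⟩ := hM
  unfold Gct
  rw [sum_comm, ← Fintype.sum_prod_type' (f := fun (β : Equiv.Perm V) (θ : Equiv.Perm (S × Fin d)) => ind (succF N k (colB β B) (colR β (actR (extP S θ) R))))]
  have h1 : ((Xset N k S d).card : ℝ) = ∑ q : Equiv.Perm V × Equiv.Perm (S × Fin d), ind (q ∈ Xset N k S d) := by
    rw [← sum_subset (subset_univ (Xset N k S d)) (fun q _ h => ind_false h), sum_congr rfl (fun q hq => ind_true hq)]
    simp
  rw [h1]
  have e : (∑ q : Equiv.Perm V × Equiv.Perm (S × Fin d), ind (q ∈ Xset N k S d)) =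
      ∑ q : Equiv.Perm V × Equiv.Perm (S × Fin d), ind ((q.1 * X, M * q.2) ∈ Xset N k S d) := by
    exact (Equiv.sum_comp (Equiv.prodCongr (Equiv.mulRight X) (Equiv.mulLeft M)) (fun q => ind (q ∈ Xset N k S d))).symm
  rw [e]
  exact sum_le_sum fun q _ => ind_mono fun h => succ_of N k B R X q.1 hB S M q.2 hM h

lemma ex_act (p : ℝ) (τ : Equiv.Perm (V × Fin d)) (F : ((V × Fin d) × (V × Fin d) → Bool) → ℝ) :
    Ex (fun _ => p) (fun R : (V × Fin d) × (V × Fin d) → Bool => F (actR τ R)) = Ex (fun _ => p) F :=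
  ex_comp p (Equiv.prodCongr τ (Equiv.refl _)) F

lemma ex_colR (p : ℝ) (β : Equiv.Perm V) (F : ((V × Fin d) × (V × Fin d) → Bool) → ℝ) :
    Ex (fun _ => p) (fun R : (V × Fin d) × (V × Fin d) → Bool => F (colR β R)) = Ex (fun _ => p) F :=
  ex_comp p (Equiv.prodCongr (Equiv.refl _) (Equiv.prodCongr β⁻¹ (Equiv.refl _))) F

lemma ex_colB (p : ℝ) (β : Equiv.Perm V) (F : (V × V → Bool) → ℝ) :
    Ex (fun _ => p) (fun R => F (colB β R)) = Ex (fun _ => p) F :=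
  ex_comp p (Equiv.prodCongr (Equiv.refl _) β⁻¹) F

lemma step_one (N k : ℕ) [NeZero k] (p : ℝ) (h0 : 0 ≤ p) (h1 : p ≤ 1) (η : ℝ) (D1 : ℕ) (B : V × V → Bool) (X : Equiv.Perm V)
    (hB : ∀ x, B (x, X x) = true) (S : Finset V)
    (hS : (1 - η) * (((Fintype.card V).factorial : ℝ) * (d * S.card).factorial) ≤ ((Xset N k S d).card : ℝ)) :
    (1 - η) * ((Fintype.card V).factorial : ℝ) * Ex (fun _ => p) (fun R : (V × Fin d) × (V × Fin d) → Bool => ind (core X R D1 = S ∧ HasM X R S)) ≤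
      Ex (fun _ => p) (fun R : (V × Fin d) × (V × Fin d) → Bool => ind (core X R D1 = S ∧ HasM X R S) * Gct N k B R) := by
  set P : ((V × Fin d) × (V × Fin d) → Bool) → Prop := fun R => core X R D1 = S ∧ HasM X R S with hP
  have hPact : ∀ θ R, P R → P (actR (extP S θ) R) := by
    rintro θ R ⟨hc, hm⟩
    refine ⟨?_, hasM_act X R S θ hm⟩
    have := core_act X R D1 (extP S θ) (fun w hw => extP_not _ θ w (by rw [← hc]; exact hw))
    rw [this, hc]
  have hcardP : (Fintype.card (Equiv.Perm (S × Fin d)) : ℝ) = ((d * S.card).factorial : ℝ) := by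
    rw [Fintype.card_perm, Fintype.card_prod, Fintype.card_coe, Fintype.card_fin, mul_comm]
  have hpos : (0 : ℝ) < ((d * S.card).factorial : ℝ) := by exact_mod_cast Nat.factorial_pos _
  have main : ((Xset N k S d).card : ℝ) * Ex (fun _ => p) (fun R : (V × Fin d) × (V × Fin d) → Bool => ind (P R)) ≤
      ((d * S.card).factorial : ℝ) * Ex (fun _ => p) (fun R : (V × Fin d) × (V × Fin d) → Bool => ind (P R) * Gct N k B R) := by
    calc ((Xset N k S d).card : ℝ) * Ex (fun _ => p) (fun R : (V × Fin d) × (V × Fin d) → Bool => ind (P R))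
        = Ex (fun _ => p) (fun R : (V × Fin d) × (V × Fin d) → Bool => ((Xset N k S d).card : ℝ) * ind (P R)) := (ex_mul _ _ _).symm
      _ ≤ Ex (fun _ => p) (fun R : (V × Fin d) × (V × Fin d) → Bool => ∑ θ : Equiv.Perm (S × Fin d), ind (P R) * Gct N k B (actR (extP S θ) R)) := by
          refine ex_mono (fun _ => h0) (fun _ => h1) fun R => ?_
          rw [← mul_sum]
          by_cases hR : P R
          · rw [ind_true hR, mul_one, one_mul]
            exact gct_sum N k B R X hB S hR.2
          · rw [ind_false hR]; simp
      _ = ∑ θ : Equiv.Perm (S × Fin d), Ex (fun _ => p) (fun R : (V × Fin d) × (V × Fin d) → Bool => ind (P R) * Gct N k B (actR (extP S θ) R)) := ex_sum _ _ _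
      _ ≤ ∑ θ : Equiv.Perm (S × Fin d), Ex (fun _ => p) (fun R : (V × Fin d) × (V × Fin d) → Bool => ind (P (actR (extP S θ) R)) * Gct N k B (actR (extP S θ) R)) := by
          refine sum_le_sum fun θ _ => ex_mono (fun _ => h0) (fun _ => h1) fun R => ?_
          exact mul_le_mul_of_nonneg_right (ind_mono (hPact θ R)) (gct_nonneg N k B _)
      _ = ∑ θ : Equiv.Perm (S × Fin d), Ex (fun _ => p) (fun R : (V × Fin d) × (V × Fin d) → Bool => ind (P R) * Gct N k B R) := by
          refine sum_congr rfl fun θ _ => ?_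
          exact ex_act p (extP S θ) (fun R : (V × Fin d) × (V × Fin d) → Bool => ind (P R) * Gct N k B R)
      _ = _ := by rw [sum_const, card_univ, nsmul_eq_mul, hcardP]
  have hE : 0 ≤ Ex (fun _ => p) (fun R : (V × Fin d) × (V × Fin d) → Bool => ind (P R)) := pr_nonneg (fun _ => h0) (fun _ => h1) P
  have h2 := mul_le_mul_of_nonneg_right hS hE
  refine le_of_mul_le_mul_left ?_ hpos
  linarith

lemma step_two (N k : ℕ) [NeZero k] (p : ℝ) (h0 : 0 ≤ p) (h1 : p ≤ 1) (η : ℝ) (hη : η ≤ 1) (D1 : ℕ) (B : V × V → Bool) (X : Equiv.Perm V)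
    (hB : ∀ x, B (x, X x) = true) (Big : Finset V → Prop)
    (hS : ∀ S, Big S → (1 - η) * (((Fintype.card V).factorial : ℝ) * (d * S.card).factorial) ≤ ((Xset N k S d).card : ℝ))
    (SD : ((V × Fin d) × (V × Fin d) → Bool) → Prop)
    (hSD : ∀ R, SD R → Big (core X R D1) ∧ HasM X R (core X R D1)) :
    (1 - η) * ((Fintype.card V).factorial : ℝ) * Pr (fun _ => p) SD ≤ Ex (fun _ => p) (fun R : (V × Fin d) × (V × Fin d) → Bool => Gct N k B R) := by
  classical
  have hf : (0 : ℝ) < ((Fintype.card V).factorial : ℝ) := by exact_mod_cast Nat.factorial_pos _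
  calc (1 - η) * ((Fintype.card V).factorial : ℝ) * Pr (fun _ => p) SD
      ≤ (1 - η) * ((Fintype.card V).factorial : ℝ) * Ex (fun _ => p) (fun R : (V × Fin d) × (V × Fin d) → Bool => ∑ S ∈ univ.filter Big, ind (core X R D1 = S ∧ HasM X R S)) := by
        refine mul_le_mul_of_nonneg_left ?_ (mul_nonneg (by linarith) hf.le)
        refine ex_mono (fun _ => h0) (fun _ => h1) fun R => ?_
        by_cases hR : SD R
        · obtain ⟨hb, hm⟩ := hSD R hR
          rw [ind_true hR]
          have hh : (1 : ℝ) = ind (core X R D1 = core X R D1 ∧ HasM X R (core X R D1)) := (ind_true ⟨rfl, hm⟩).symm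
          rw [hh]
          exact single_le_sum (f := fun S => ind (core X R D1 = S ∧ HasM X R S)) (fun _ _ => ind_nonneg _) (by simp [hb])
        · rw [ind_false hR]; exact sum_nonneg fun _ _ => ind_nonneg _
    _ = ∑ S ∈ univ.filter Big, (1 - η) * ((Fintype.card V).factorial : ℝ) * Ex (fun _ => p) (fun R : (V × Fin d) × (V × Fin d) → Bool => ind (core X R D1 = S ∧ HasM X R S)) := by
        rw [ex_sum, mul_sum]
    _ ≤ ∑ S ∈ univ.filter Big, Ex (fun _ => p) (fun R : (V × Fin d) × (V × Fin d) → Bool => ind (core X R D1 = S ∧ HasM X R S) * Gct N k B R) := by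
        refine sum_le_sum fun S hS' => step_one N k p h0 h1 η D1 B X hB S (hS S ?_)
        simpa using hS'
    _ = Ex (fun _ => p) (fun R : (V × Fin d) × (V × Fin d) → Bool => ∑ S ∈ univ.filter Big, ind (core X R D1 = S ∧ HasM X R S) * Gct N k B R) := (ex_sum _ _ _).symm
    _ ≤ _ := by
        refine ex_mono (fun _ => h0) (fun _ => h1) fun R => ?_
        rw [← sum_mul]
        refine mul_le_of_le_one_left (gct_nonneg N k B R) ?_
        calc _ ≤ ∑ S ∈ univ.filter Big, (if core X R D1 = S then (1 : ℝ) else 0) := by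
              refine sum_le_sum fun S _ => ?_
              split_ifs with h
              · exact ind_le_one _
              · rw [ind_false (fun h' => h h'.1)]
          _ ≤ 1 := by
              rw [sum_ite_eq]; split_ifs <;> norm_num

theorem symm_main (N k : ℕ) [NeZero k] (p1 p : ℝ) (h10 : 0 ≤ p1) (h11 : p1 ≤ 1) (h0 : 0 ≤ p) (h1 : p ≤ 1) (η : ℝ) (hη : η ≤ 1) (D1 : ℕ) (Big : Finset V → Prop)
    (hS : ∀ S, Big S → (1 - η) * (((Fintype.card V).factorial : ℝ) * (d * S.card).factorial) ≤ ((Xset N k S d).card : ℝ))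
    (SD : ((V × Fin d) × (V × Fin d) → Bool) → Prop)
    (hSD : ∀ X R, SD R → Big (core X R D1) ∧ HasM X R (core X R D1)) :
    (1 - η) * Pr (fun _ => p1) (fun B : V × V → Bool => ∃ X : Equiv.Perm V, ∀ x, B (x, X x) = true) * Pr (fun _ => p) SD ≤
      Ex (fun _ => p1) (fun B : V × V → Bool => Ex (fun _ => p) (fun R : (V × Fin d) × (V × Fin d) → Bool => ind (succF N k B R))) := by
  have hf : (0 : ℝ) < ((Fintype.card V).factorial : ℝ) := by exact_mod_cast Nat.factorial_pos _
  refine le_of_mul_le_mul_left ?_ hf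
  set Z := Ex (fun _ => p1) (fun B : V × V → Bool => Ex (fun _ => p) (fun R : (V × Fin d) × (V × Fin d) → Bool => ind (succF N k B R))) with hZ
  have e1 : ((Fintype.card V).factorial : ℝ) * Z = Ex (fun _ => p1) (fun B : V × V → Bool => Ex (fun _ => p) (fun R : (V × Fin d) × (V × Fin d) → Bool => Gct N k B R)) := by
    unfold Gct
    simp_rw [ex_sum]
    have : ∀ β : Equiv.Perm V, Ex (fun _ => p1) (fun B : V × V → Bool => Ex (fun _ => p) (fun R : (V × Fin d) × (V × Fin d) → Bool => ind (succF N k (colB β B) (colR β R)))) = Z := by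
      intro β
      rw [hZ, ← ex_colB p1 β (fun B => Ex (fun _ => p) (fun R : (V × Fin d) × (V × Fin d) → Bool => ind (succF N k B R)))]
      congr 1
      funext B
      exact ex_colR p β (fun R : (V × Fin d) × (V × Fin d) → Bool => ind (succF N k (colB β B) R))
    rw [sum_congr rfl (fun β _ => this β), sum_const, card_univ, Fintype.card_perm, nsmul_eq_mul]
  rw [e1]
  calc _ = Ex (fun _ => p1) (fun B : V × V → Bool => ((1 - η) * ((Fintype.card V).factorial : ℝ) * Pr (fun _ => p) SD) * ind (∃ X : Equiv.Perm V, ∀ x, B (x, X x) = true)) := by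
        rw [ex_mul]; unfold Pr; ring
    _ ≤ _ := by
        refine ex_mono (fun _ => h10) (fun _ => h11) fun B => ?_
        by_cases hB : ∃ X : Equiv.Perm V, ∀ x, B (x, X x) = true
        · obtain ⟨X, hX⟩ := hB
          rw [ind_true ⟨X, hX⟩, mul_one]
          exact step_two N k p h0 h1 η hη D1 B X hX Big hS SD (hSD X)
        · rw [ind_false hB, mul_zero]
          exact sum_nonneg fun R _ => mul_nonneg (wt_nonneg (fun _ => h0) (fun _ => h1) R) (gct_nonneg N k B R)

end PartE2
end CF

set_option linter.unusedSectionVars false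
set_option linter.unusedVariables false
set_option linter.unusedSimpArgs false
namespace CF
open Finset

section PartD1
variable {W : Type*} [Fintype W] [DecidableEq W]

lemma sparse_fail (p : ℝ) (h0 : 0 ≤ p) (h1 : p ≤ 1) (D1 a0 : ℕ) (t x : ℝ) (ht : 0 ≤ t)
    (hx : (Fintype.card W : ℝ) ^ 2 * Real.exp (Real.exp t * p * a0 - t * D1) ≤ x) (hx1 : x ≤ 1) :
    Pr (fun _ : W × W => p) (fun R => ¬ Sparse R D1 a0) ≤ a0 * x := by
  set Q := Fintype.card W with hQ
  have hx0 : 0 ≤ x := le_trans (by positivity) hx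
  calc Pr (fun _ : W × W => p) (fun R => ¬ Sparse R D1 a0)
      ≤ Pr (fun _ : W × W => p) (fun R => ∃ a ∈ Icc 1 a0, ∃ AB ∈ (univ.powersetCard a ×ˢ univ.powersetCard a : Finset (Finset W × Finset W)),
          D1 * a ≤ (((AB.1 ×ˢ AB.2).filter (fun e => R e = true)).card)) := by
        refine pr_mono (fun _ => h0) (fun _ => h1) fun R hR => ?_
        unfold Sparse at hR
        push Not at hR
        obtain ⟨A, B, hAB, hA1, hA2, h⟩ := hR
        refine ⟨A.card, mem_Icc.2 ⟨hA1, hA2⟩, (A, B), by simp [hAB], ?_⟩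
        exact h
    _ ≤ ∑ a ∈ Icc 1 a0, Pr (fun _ : W × W => p) (fun R => ∃ AB ∈ (univ.powersetCard a ×ˢ univ.powersetCard a : Finset (Finset W × Finset W)),
          D1 * a ≤ (((AB.1 ×ˢ AB.2).filter (fun e => R e = true)).card)) := pr_union (fun _ => h0) (fun _ => h1) _ _
    _ ≤ ∑ a ∈ Icc 1 a0, x := by
        refine sum_le_sum fun a ha => ?_
        rw [mem_Icc] at ha
        refine (pr_union (fun _ => h0) (fun _ => h1) _ _).trans ?_
        calc _ ≤ ∑ AB ∈ (univ.powersetCard a ×ˢ univ.powersetCard a : Finset (Finset W × Finset W)), (Real.exp (Real.exp t * p * a0 - t * D1)) ^ a := by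
              refine sum_le_sum fun AB hAB => ?_
              simp only [mem_product, mem_powersetCard, subset_univ, true_and] at hAB
              refine (tail_up p h0 h1 (AB.1 ×ˢ AB.2) t ht (D1 * a)).trans ?_
              rw [card_product, hAB.1, hAB.2, ← Real.exp_nat_mul, Real.exp_le_exp]
              push_cast
              have ha0 : (a : ℝ) ≤ a0 := by exact_mod_cast ha.2
              have hn : (0 : ℝ) ≤ a := by positivity
              have h3 : (Real.exp t - 1) * p * ((a : ℝ) * a) ≤ Real.exp t * p * a0 * a := by
                have e1 : (Real.exp t - 1) * p * ((a : ℝ) * a) ≤ Real.exp t * p * ((a : ℝ) * a) := by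
                  refine mul_le_mul_of_nonneg_right ?_ (by positivity)
                  nlinarith
                have e2 : Real.exp t * p * ((a : ℝ) * a) ≤ Real.exp t * p * (a0 * a) := by
                  refine mul_le_mul_of_nonneg_left ?_ (by have := Real.exp_pos t; positivity)
                  nlinarith
                linarith
              nlinarith
          _ ≤ ((Q : ℝ) ^ a * (Q : ℝ) ^ a) * (Real.exp (Real.exp t * p * a0 - t * D1)) ^ a := by
              rw [sum_const, nsmul_eq_mul, card_product, card_powersetCard, card_univ, ← hQ]
              refine mul_le_mul_of_nonneg_right ?_ (by positivity)
              have : Q.choose a ≤ Q ^ a := Nat.choose_le_pow Q a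
              exact_mod_cast Nat.mul_le_mul this this
          _ = ((Q : ℝ) ^ 2 * Real.exp (Real.exp t * p * a0 - t * D1)) ^ a := by
              rw [mul_pow, ← pow_mul, ← pow_add]; congr 2; ring
          _ ≤ x ^ a := pow_le_pow_left₀ (by positivity) hx a
          _ ≤ x := pow_le_of_le_one hx0 hx1 (by omega)
    _ = a0 * x := by rw [sum_const, nsmul_eq_mul]; simp

lemma dense_fail (p : ℝ) (h0 : 0 ≤ p) (h1 : p ≤ 1) (D1 a0 y0 : ℕ) :
    Pr (fun _ : W × W => p) (fun R => ¬ Dense R D1 a0 y0) ≤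
      2 * 4 ^ (Fintype.card W) * Real.exp ((D1 * a0 : ℕ) - (1 - Real.exp (-1)) * p * (a0 * y0)) := by
  set Q := Fintype.card W with hQ
  calc Pr (fun _ : W × W => p) (fun R => ¬ Dense R D1 a0 y0)
      ≤ Pr (fun _ : W × W => p) (fun R => ∃ AB ∈ (univ.powersetCard a0 ×ˢ univ.powersetCard y0 : Finset (Finset W × Finset W)),
          (((AB.1 ×ˢ AB.2).filter (fun e => R e = true)).card < D1 * a0) ∨ (((AB.2 ×ˢ AB.1).filter (fun e => R e = true)).card < D1 * a0)) := by
        refine pr_mono (fun _ => h0) (fun _ => h1) fun R hR => ?_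
        unfold Dense at hR
        push Not at hR
        obtain ⟨A, Y, hA, hY, h⟩ := hR
        refine ⟨(A, Y), by simp [hA, hY], ?_⟩
        by_cases h2 : D1 * a0 ≤ ec R A Y
        · right; exact h h2
        · left; unfold ec at h2; simp only; omega
    _ ≤ ∑ AB ∈ (univ.powersetCard a0 ×ˢ univ.powersetCard y0 : Finset (Finset W × Finset W)), 2 * Real.exp ((D1 * a0 : ℕ) - (1 - Real.exp (-1)) * p * (a0 * y0)) := by
        refine (pr_union (fun _ => h0) (fun _ => h1) _ _).trans (sum_le_sum fun AB hAB => ?_)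
        simp only [mem_product, mem_powersetCard, subset_univ, true_and] at hAB
        refine (pr_or (fun _ => h0) (fun _ => h1) _ _).trans ?_
        have e1 := tail_down p h0 h1 (AB.1 ×ˢ AB.2) 1 zero_le_one (D1 * a0)
        have e2 := tail_down p h0 h1 (AB.2 ×ˢ AB.1) 1 zero_le_one (D1 * a0)
        rw [card_product, hAB.1, hAB.2, one_mul] at e1 e2
        push_cast at e1 e2 ⊢
        rw [mul_comm (y0 : ℝ)] at e2
        linarith
    _ ≤ _ := by
        rw [sum_const, nsmul_eq_mul, card_product, card_powersetCard, card_powersetCard, card_univ, ← hQ]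
        have h2 : ∀ a, Q.choose a ≤ 2 ^ Q := by
          intro a
          exact Nat.choose_le_two_pow Q a
        have h3 : ((Q.choose a0 * Q.choose y0 : ℕ) : ℝ) ≤ 4 ^ Q := by
          have := Nat.mul_le_mul (h2 a0) (h2 y0)
          rw [← mul_pow] at this
          exact_mod_cast this
        have := mul_le_mul_of_nonneg_right h3 (Real.exp_pos ((D1 * a0 : ℕ) - (1 - Real.exp (-1)) * p * (a0 * y0))).le
        linarith

lemma mindeg_fail (p : ℝ) (h0 : 0 ≤ p) (h1 : p ≤ 1) (D1 : ℕ) (s : ℝ) (hs : 0 ≤ s) :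
    Pr (fun _ : W × W => p) (fun R => ¬ ∀ x, D1 ≤ ec R {x} univ ∧ D1 ≤ ec R univ {x}) ≤
      2 * (Fintype.card W) * Real.exp (s * D1 - (1 - Real.exp (-s)) * p * Fintype.card W) := by
  calc _ ≤ Pr (fun _ : W × W => p) (fun R => ∃ x ∈ (univ : Finset W), (((({x} : Finset W) ×ˢ univ).filter (fun e => R e = true)).card < D1) ∨
            ((((univ : Finset W) ×ˢ {x}).filter (fun e => R e = true)).card < D1)) := by
        refine pr_mono (fun _ => h0) (fun _ => h1) fun R hR => ?_
        push Not at hR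
        obtain ⟨x, h⟩ := hR
        refine ⟨x, mem_univ _, ?_⟩
        by_cases h2 : D1 ≤ ec R {x} univ
        · right; exact h h2
        · left; unfold ec at h2; omega
    _ ≤ ∑ x : W, 2 * Real.exp (s * D1 - (1 - Real.exp (-s)) * p * Fintype.card W) := by
        refine (pr_union (fun _ => h0) (fun _ => h1) _ _).trans (sum_le_sum fun x hx => ?_)
        refine (pr_or (fun _ => h0) (fun _ => h1) _ _).trans ?_
        have e1 := tail_down p h0 h1 (({x} : Finset W) ×ˢ (univ : Finset W)) s hs D1
        have e2 := tail_down p h0 h1 ((univ : Finset W) ×ˢ {x}) s hs D1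
        rw [card_product, card_singleton, card_univ] at e1 e2
        rw [one_mul] at e1
        rw [mul_one] at e2
        linarith
    _ = _ := by rw [sum_const, nsmul_eq_mul, card_univ]; ring

end PartD1
end CF

set_option linter.unusedSectionVars false
set_option linter.unusedVariables false
set_option linter.unusedSimpArgs false
namespace CF
open Finset

section PartD2

lemma nat_ge_exp (L0 : ℝ) (n : ℕ) (h : ⌈Real.exp L0⌉₊ ≤ n) : L0 ≤ Real.log n := by
  have h1 : Real.exp L0 ≤ n := (Nat.le_ceil _).trans (by exact_mod_cast h)
  rwa [Real.le_log_iff_exp_le (lt_of_lt_of_le (Real.exp_pos _) h1)]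

lemma half_le_exp : (1 : ℝ) / 2 ≤ 1 - Real.exp (-1) := by
  have := Real.exp_neg 1
  have h2 : (2 : ℝ) ≤ Real.exp 1 := by have := Real.add_one_le_exp 1; linarith
  rw [this]
  have : (Real.exp 1)⁻¹ ≤ (2 : ℝ)⁻¹ := inv_anti₀ (by norm_num) h2
  norm_num at this ⊢
  linarith

set_option maxHeartbeats 1000000 in
lemma reg (μ ζ ξ0 : ℝ) (hμ : 0 < μ) (hζ : 0 < ζ) (hζμ : ζ ≤ μ / 64) (hξ0 : 0 < ξ0) (d : ℕ) (hd : 1 ≤ d) :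
    ∃ ξ : ℝ, 0 < ξ ∧ ξ ≤ ξ0 ∧ ∃ n0 : ℕ, ∀ n : ℕ, n0 ≤ n → ∀ (W : Type) [Fintype W] [DecidableEq W], Fintype.card W = d * n →
      μ * Real.log n / (d * n) ≤ 1 →
      Pr (fun _ : W × W => μ * Real.log n / (d * n)) (fun R => ¬ (Sparse R ⌈ζ * Real.log n⌉₊ ⌊ξ * (d * n)⌋₊ ∧
        Dense R ⌈ζ * Real.log n⌉₊ ⌊ξ * (d * n)⌋₊ (d * n / 3))) ≤ 3 / n := by
  set t : ℝ := 8 / ζ with ht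
  have ht0 : 0 < t := by positivity
  set ξ : ℝ := min ξ0 (min 1 (Real.exp (-t) / μ)) with hξ
  have hξpos : 0 < ξ := lt_min hξ0 (lt_min one_pos (div_pos (Real.exp_pos _) hμ))
  have hξ1 : ξ ≤ 1 := (min_le_right _ _).trans (min_le_left _ _)
  have hξt : Real.exp t * μ * ξ ≤ 1 := by
    have : ξ ≤ Real.exp (-t) / μ := (min_le_right _ _).trans (min_le_right _ _)
    rw [le_div_iff₀ hμ] at this
    calc Real.exp t * μ * ξ = Real.exp t * (ξ * μ) := by ring
      _ ≤ Real.exp t * Real.exp (-t) := mul_le_mul_of_nonneg_left this (Real.exp_pos _).le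
      _ = 1 := by rw [← Real.exp_add]; simp
  refine ⟨ξ, hξpos, min_le_left _ _, ⌈Real.exp (96 / (ξ * μ))⌉₊ + 8 + d + ⌈2 / ξ⌉₊, ?_⟩
  intro n hn W _ _ hW hp1
  have hL := nat_ge_exp (96 / (ξ * μ)) n (by omega)
  set L := Real.log n with hLdef
  have hn8 : 8 ≤ n := by omega
  have hnd : d ≤ n := by omega
  have hnξ : 2 / ξ ≤ n := (Nat.le_ceil _).trans (by exact_mod_cast (by omega : ⌈2 / ξ⌉₊ ≤ n))
  have hn0 : (0 : ℝ) < n := by exact_mod_cast (by omega : 0 < n)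
  have hd0 : (1 : ℝ) ≤ d := by exact_mod_cast hd
  have hnL : Real.exp L = n := Real.exp_log hn0
  have hL0 : 0 < L := lt_of_lt_of_le (by positivity) hL
  rw [div_le_iff₀ (by positivity)] at hL
  set q : ℝ := (d : ℝ) * n with hq
  have hqn : (n : ℝ) ≤ q := by nlinarith
  have hq8 : (8 : ℝ) ≤ q := by
    have : (8 : ℝ) ≤ n := by exact_mod_cast hn8
    linarith
  have hqpos : 0 < q := by linarith
  have hqW : ((Fintype.card W : ℕ) : ℝ) = q := by rw [hW]; push_cast; rfl
  set p := μ * L / q with hp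
  have hp0 : 0 ≤ p := by positivity
  set D1 := ⌈ζ * L⌉₊ with hD1
  set a0 := ⌊ξ * q⌋₊ with ha0
  set y0 := d * n / 3 with hy0
  have hD1l : ζ * L ≤ D1 := Nat.le_ceil _
  have hD1u : (D1 : ℝ) ≤ ζ * L + 1 := (Nat.ceil_lt_add_one (by positivity)).le
  have ha0u : (a0 : ℝ) ≤ ξ * q := Nat.floor_le (by positivity)
  have ha0l : ξ * q / 2 ≤ a0 := by
    have h1 := Nat.lt_floor_add_one (ξ * q)
    have h2 : 2 ≤ ξ * q := by
      rw [div_le_iff₀ hξpos] at hnξ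
      nlinarith
    rw [← ha0] at h1
    linarith
  have hy0l : q / 4 ≤ y0 := by
    have h1 : d * n ≤ 3 * y0 + 2 := by omega
    have h2 : q ≤ 3 * y0 + 2 := by
      have : ((d * n : ℕ) : ℝ) ≤ ((3 * y0 + 2 : ℕ) : ℝ) := by exact_mod_cast h1
      push_cast at this
      exact this
    linarith
  have hQn : q ≤ Real.exp (2 * L) := by
    have : Real.exp (2 * L) = n * n := by rw [two_mul, Real.exp_add, hnL]
    rw [this]
    have : (d : ℝ) ≤ n := by exact_mod_cast hnd
    nlinarith
  have hpq : p * q = μ * L := by rw [hp]; field_simp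
  -- sparse part
  have hs : Pr (fun _ : W × W => p) (fun R => ¬ Sparse R D1 a0) ≤ 1 / n := by
    have hx : (Fintype.card W : ℝ) ^ 2 * Real.exp (Real.exp t * p * a0 - t * D1) ≤ Real.exp (-(3 * L)) := by
      rw [hqW]
      have e1 : q ^ 2 ≤ Real.exp (4 * L) := by
        calc q ^ 2 ≤ (Real.exp (2 * L)) ^ 2 := pow_le_pow_left₀ hqpos.le hQn 2
          _ = _ := by rw [← Real.exp_nat_mul]; congr 1; push_cast; ring
      have e2 : Real.exp t * p * a0 - t * D1 ≤ -(7 * L) := by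
        have e3 : Real.exp t * p * a0 ≤ L := by
          calc Real.exp t * p * a0 ≤ Real.exp t * p * (ξ * q) := mul_le_mul_of_nonneg_left ha0u (by have := Real.exp_pos t; positivity)
            _ = (Real.exp t * μ * ξ) * L := by rw [show Real.exp t * p * (ξ * q) = Real.exp t * ξ * (p * q) by ring, hpq]; ring
            _ ≤ 1 * L := mul_le_mul_of_nonneg_right hξt hL0.le
            _ = L := one_mul L
        have e4 : 8 * L ≤ t * D1 := by
          calc 8 * L = t * (ζ * L) := by rw [ht]; field_simp
            _ ≤ _ := mul_le_mul_of_nonneg_left hD1l ht0.le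
        linarith
      calc q ^ 2 * Real.exp (Real.exp t * p * a0 - t * D1) ≤ Real.exp (4 * L) * Real.exp (-(7 * L)) :=
            mul_le_mul e1 (Real.exp_le_exp.2 e2) (Real.exp_pos _).le (Real.exp_pos _).le
        _ = _ := by rw [← Real.exp_add]; congr 1; ring
    refine (sparse_fail p hp0 hp1 D1 a0 t _ ht0.le hx (Real.exp_le_one_iff.2 (by linarith))).trans ?_
    calc (a0 : ℝ) * Real.exp (-(3 * L)) ≤ Real.exp (2 * L) * Real.exp (-(3 * L)) := by
          refine mul_le_mul_of_nonneg_right ?_ (Real.exp_pos _).le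
          nlinarith
      _ = Real.exp (-L) := by rw [← Real.exp_add]; congr 1; ring
      _ = 1 / n := by rw [Real.exp_neg, hnL, one_div]
  have hdn : Pr (fun _ : W × W => p) (fun R => ¬ Dense R D1 a0 y0) ≤ 2 / n := by
    refine (dense_fail p hp0 hp1 D1 a0 y0).trans ?_
    have e1 : ((D1 * a0 : ℕ) : ℝ) - (1 - Real.exp (-1)) * p * (a0 * y0) ≤ - (3 * q) := by
      push_cast
      have f1 : μ * L / 8 ≤ (1 - Real.exp (-1)) * p * y0 := by
        calc μ * L / 8 = 1 / 2 * (p * (q / 4)) := by rw [show p * (q / 4) = p * q / 4 by ring, hpq]; ring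
          _ ≤ (1 - Real.exp (-1)) * (p * y0) := mul_le_mul half_le_exp (mul_le_mul_of_nonneg_left hy0l hp0) (by positivity) (by linarith [half_le_exp])
          _ = _ := by ring
      have f2 : (D1 : ℝ) ≤ μ * L / 32 := by
        have g1 : ζ * L ≤ μ / 64 * L := mul_le_mul_of_nonneg_right hζμ hL0.le
        have g2 : 64 ≤ μ * L := by
          have : L * (ξ * μ) ≤ L * μ := by
            refine mul_le_mul_of_nonneg_left ?_ hL0.le
            nlinarith
          nlinarith
        linarith
      have f3 : (D1 : ℝ) * a0 - (1 - Real.exp (-1)) * p * (a0 * y0) = a0 * (D1 - (1 - Real.exp (-1)) * p * y0) := by ring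
      rw [f3]
      have f4 : (D1 : ℝ) - (1 - Real.exp (-1)) * p * y0 ≤ - (μ * L / 16) := by
        have : 0 < μ * L := by positivity
        linarith
      calc (a0 : ℝ) * (D1 - (1 - Real.exp (-1)) * p * y0) ≤ a0 * (- (μ * L / 16)) := mul_le_mul_of_nonneg_left f4 (by positivity)
        _ ≤ (ξ * q / 2) * (- (μ * L / 16)) := mul_le_mul_of_nonpos_right ha0l (by have : 0 < μ * L := by positivity
                                                                                  linarith)
        _ = - (q * (L * (ξ * μ)) / 32) := by ring
        _ ≤ - (3 * q) := by nlinarith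
    have e2 : (4 : ℝ) ^ (Fintype.card W) ≤ Real.exp (2 * q) := by
      rw [← hqW, mul_comm, Real.exp_nat_mul]
      refine pow_le_pow_left₀ (by norm_num) ?_ _
      have h2 : (2 : ℝ) ≤ Real.exp 1 := by have := Real.add_one_le_exp 1; linarith
      have : Real.exp 2 = Real.exp 1 * Real.exp 1 := by rw [← Real.exp_add]; norm_num
      nlinarith
    calc _ ≤ 2 * Real.exp (2 * q) * Real.exp (-(3 * q)) := by
          refine mul_le_mul ?_ (Real.exp_le_exp.2 e1) (Real.exp_pos _).le (by positivity)
          linarith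
      _ = 2 * Real.exp (-q) := by rw [mul_assoc, ← Real.exp_add]; congr 2; ring
      _ ≤ 2 * (1 / n) := by
          refine mul_le_mul_of_nonneg_left ?_ (by norm_num)
          rw [Real.exp_neg, ← one_div]
          refine one_div_le_one_div_of_le hn0 ?_
          have := Real.add_one_le_exp q
          linarith
      _ = 2 / n := by ring
  calc _ ≤ Pr (fun _ : W × W => p) (fun R => ¬ Sparse R D1 a0 ∨ ¬ Dense R D1 a0 y0) :=
        pr_mono (fun _ => hp0) (fun _ => hp1) fun R h => by tauto
    _ ≤ _ := pr_or (fun _ => hp0) (fun _ => hp1) _ _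
    _ ≤ 1 / n + 2 / n := add_le_add hs hdn
    _ = 3 / n := by ring

end PartD2
end CF

set_option linter.unusedSectionVars false
set_option linter.unusedVariables false
set_option linter.unusedSimpArgs false
namespace CF
open Finset

section PartD3

set_option maxHeartbeats 1000000 in
lemma perm_whp (δ η : ℝ) (hδ : 0 < δ) (hη : 0 < η) : ∃ n0 : ℕ, ∀ n : ℕ, n0 ≤ n → (1 + δ) * Real.log n / n ≤ 1 →
    1 - η ≤ Pr (fun _ : Fin n × Fin n => (1 + δ) * Real.log n / n) (fun B => ∃ X : Equiv.Perm (Fin n), ∀ x, B (x, X x) = true) := by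
  set s : ℝ := Real.log (4 * (1 + δ) / δ) with hs
  have hs1 : 1 < 4 * (1 + δ) / δ := by rw [lt_div_iff₀ hδ]; linarith
  have hs0 : 0 < s := Real.log_pos hs1
  have hes : (1 - Real.exp (-s)) * (1 + δ) = 1 + 3 * δ / 4 := by
    rw [Real.exp_neg, hs, Real.exp_log (by linarith)]
    field_simp
    ring
  set ζ : ℝ := min ((1 + δ) / 64) (δ / (4 * s)) with hζ
  have hζ0 : 0 < ζ := lt_min (by positivity) (by positivity)
  have hζs : s * ζ ≤ δ / 4 := by
    have : ζ ≤ δ / (4 * s) := min_le_right _ _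
    rw [le_div_iff₀ (by positivity)] at this
    linarith
  obtain ⟨ξ, hξ, hξ1, n0, hn0⟩ := reg (1 + δ) ζ 1 (by linarith) hζ0 (min_le_left _ _) one_pos 1 le_rfl
  refine ⟨n0 + ⌈Real.exp (2 / δ * (s + Real.log (4 / η)))⌉₊ + ⌈6 / η⌉₊ + ⌈1 / ξ⌉₊ + 2, ?_⟩
  intro n hn hp1
  have h1 := hn0 n (by omega) (Fin n) (by simp) (by simpa using hp1)
  have hL := nat_ge_exp (2 / δ * (s + Real.log (4 / η))) n (by omega)
  have hnη : 6 / η ≤ n := (Nat.le_ceil _).trans (by exact_mod_cast (by omega : ⌈6 / η⌉₊ ≤ n))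
  have hnξ : 1 / ξ ≤ n := (Nat.le_ceil _).trans (by exact_mod_cast (by omega : ⌈1 / ξ⌉₊ ≤ n))
  have hn1 : (1 : ℝ) < n := by exact_mod_cast (by omega : 1 < n)
  have hn0' : (0 : ℝ) < n := by linarith
  simp only [Nat.cast_one, one_mul] at h1
  set L := Real.log n with hLdef
  have hnL : Real.exp L = n := Real.exp_log hn0'
  have hL0 : 0 < L := Real.log_pos hn1
  set p := (1 + δ) * L / n with hp
  have hp0 : 0 ≤ p := by positivity
  set D1 := ⌈ζ * L⌉₊ with hD1
  set a0 := ⌊ξ * n⌋₊ with ha0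
  have hD1u : (D1 : ℝ) ≤ ζ * L + 1 := (Nat.ceil_lt_add_one (by positivity)).le
  have hD11 : 1 ≤ D1 := Nat.one_le_ceil_iff.2 (by positivity)
  have ha01 : 1 ≤ a0 := by
    rw [ha0, Nat.one_le_floor_iff]
    rw [div_le_iff₀ hξ] at hnξ
    linarith
  have h2 := mindeg_fail (W := Fin n) p hp0 hp1 D1 s hs0.le
  have h3 : 2 * (Fintype.card (Fin n)) * Real.exp (s * D1 - (1 - Real.exp (-s)) * p * Fintype.card (Fin n)) ≤ η / 2 := by
    rw [Fintype.card_fin]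
    have e1 : (1 - Real.exp (-s)) * p * n = (1 + 3 * δ / 4) * L := by
      rw [← hes, hp]; field_simp
    have e2 : s * D1 ≤ δ / 4 * L + s := by
      calc s * D1 ≤ s * (ζ * L + 1) := mul_le_mul_of_nonneg_left hD1u hs0.le
        _ = (s * ζ) * L + s := by ring
        _ ≤ _ := by linarith [mul_le_mul_of_nonneg_right hζs hL0.le]
    have e3 : s + Real.log (4 / η) ≤ δ / 2 * L := by
      have := mul_le_mul_of_nonneg_left hL (by positivity : 0 ≤ δ / 2)
      have e : δ / 2 * (2 / δ * (s + Real.log (4 / η))) = s + Real.log (4 / η) := by field_simp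
      linarith
    rw [e1, ← hnL, mul_assoc, ← Real.exp_add]
    calc _ ≤ 2 * Real.exp (- Real.log (4 / η)) := by
          refine mul_le_mul_of_nonneg_left (Real.exp_le_exp.2 ?_) (by norm_num)
          linarith
      _ = η / 2 := by rw [Real.exp_neg, Real.exp_log (by positivity)]; field_simp; norm_num
  have h4 : Pr (fun _ : Fin n × Fin n => p) (fun B => ¬ ∃ X : Equiv.Perm (Fin n), ∀ x, B (x, X x) = true) ≤ 3 / n + η / 2 := by
    refine le_trans (le_trans (pr_mono (fun _ => hp0) (fun _ => hp1) (F := fun B => ¬ (Sparse B D1 a0 ∧ Dense B D1 a0 (n / 3)) ∨ ¬ ∀ x, D1 ≤ ec B {x} univ ∧ D1 ≤ ec B univ {x}) ?_)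
      (pr_or (fun _ => hp0) (fun _ => hp1) _ _)) (add_le_add h1 (h2.trans h3))
    intro B hB
    by_contra h
    push Not at h
    obtain ⟨⟨hs, hd⟩, hm⟩ := h
    exact hB (hall_perm B D1 a0 (n / 3) hD11 ha01 hs hd (by rw [Fintype.card_fin]; omega) (fun x => (hm x).1) (fun x => (hm x).2))
  rw [pr_not] at h4
  have h5 : 3 / n ≤ η / 2 := by
    rw [div_le_iff₀ hη] at hnη
    rw [div_le_iff₀ hn0']
    linarith
  linarith

set_option maxHeartbeats 1000000 in
lemma core_whp (μ γ η : ℝ) (hμ : 0 < μ) (hγ : 0 < γ) (hγ1 : γ ≤ 1 / 16) (hη : 0 < η) (d : ℕ) (hd : 1 ≤ d) :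
    ∃ n0 : ℕ, ∀ n : ℕ, n0 ≤ n → μ * Real.log n / (d * n) ≤ 1 →
    ∃ (D1 : ℕ) (SD : ((Fin n × Fin d) × (Fin n × Fin d) → Bool) → Prop),
      1 - η ≤ Pr (fun _ => μ * Real.log n / (d * n)) SD ∧
      ∀ (X : Equiv.Perm (Fin n)) R, SD R → ((n : ℝ) - (core X R D1).card ≤ γ * n) ∧ HasM X R (core X R D1) := by
  have hd0 : (1 : ℝ) ≤ d := by exact_mod_cast hd
  obtain ⟨ξ, hξ, hξ1, n0, hn0⟩ := reg μ (μ / 64) (γ / (2 * d)) hμ (by positivity) le_rfl (by positivity) d hd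
  refine ⟨n0 + ⌈3 / η⌉₊ + ⌈1 / ξ⌉₊ + 2, ?_⟩
  intro n hn hp1
  have h1 := hn0 n (by omega) (Fin n × Fin d) (by simp [mul_comm]) hp1
  have hnη : 3 / η ≤ n := (Nat.le_ceil _).trans (by exact_mod_cast (by omega : ⌈3 / η⌉₊ ≤ n))
  have hnξ : 1 / ξ ≤ n := (Nat.le_ceil _).trans (by exact_mod_cast (by omega : ⌈1 / ξ⌉₊ ≤ n))
  have hn1 : (1 : ℝ) < n := by exact_mod_cast (by omega : 1 < n)
  have hn0' : (0 : ℝ) < n := by linarith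
  have hL0 : 0 < Real.log n := Real.log_pos hn1
  set D1 := ⌈μ / 64 * Real.log n⌉₊ with hD1
  set a0 := ⌊ξ * (d * n)⌋₊ with ha0
  have hD11 : 1 ≤ D1 := Nat.one_le_ceil_iff.2 (by positivity)
  have ha01 : 1 ≤ a0 := by
    rw [ha0, Nat.one_le_floor_iff]
    rw [div_le_iff₀ hξ] at hnξ
    nlinarith
  have ha0u : 2 * (a0 : ℝ) ≤ γ * n := by
    have e1 : (a0 : ℝ) ≤ ξ * (d * n) := Nat.floor_le (by positivity)
    rw [le_div_iff₀ (by positivity)] at hξ1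
    have := mul_le_mul_of_nonneg_right hξ1 hn0'.le
    linarith
  have ha0n : 32 * a0 ≤ n := by
    have : (32 : ℝ) * a0 ≤ n := by
      have := mul_le_mul_of_nonneg_right hγ1 hn0'.le
      linarith
    exact_mod_cast this
  refine ⟨D1, fun R => Sparse R D1 a0 ∧ Dense R D1 a0 (d * n / 3), ?_, ?_⟩
  · rw [pr_not] at h1
    have h5 : 3 / n ≤ η := by
      rw [div_le_iff₀ hη] at hnη
      rw [div_le_iff₀ hn0']
      linarith
    linarith
  · rintro X R ⟨hs, hdn⟩
    have hle : 32 * (a0 * d) ≤ n * d := by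
      have := Nat.mul_le_mul_right d ha0n
      linarith
    have hnd : d * n = n * d := mul_comm _ _
    have hc := core_card X R D1 a0 (d * n / 3) ha01 hdn (by
      rw [Fintype.card_fin, mul_assoc]
      omega)
    rw [Fintype.card_fin] at hc
    refine ⟨?_, ?_⟩
    · have : (n : ℝ) ≤ (core X R D1).card + 2 * a0 := by exact_mod_cast hc
      linarith
    · refine hasM_of X R D1 a0 (d * n / 3) hD11 ha01 hs hdn _ (core_good X R D1) ?_
      have := Nat.mul_le_mul_right d hc
      rw [add_mul, mul_assoc 2] at this
      omega

end PartD3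
end CF

set_option linter.unusedSectionVars false
set_option linter.unusedVariables false
set_option linter.unusedSimpArgs false
namespace CF
open Finset

section PartE3
variable {ι κ : Type*} [Fintype ι] [DecidableEq ι] [Fintype κ] [DecidableEq κ]

/-- Push-forward of a configuration. -/
def push (g : ι → κ) (ω : ι → Bool) : κ → Bool := fun e => decide (∃ i, g i = e ∧ ω i = true)

lemma ex_fib (p : ι → ℝ) (g : ι → κ) (a b : κ → ℝ) :
    Ex p (fun ω => ∏ e, (a e + b e * ∏ i ∈ univ.filter (fun i => g i = e), (if ω i then 0 else 1))) =
      ∏ e, (a e + b e * ∏ i ∈ univ.filter (fun i => g i = e), (1 - p i)) := by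
  have key : ∀ (T : Finset κ) (h : ι → ℝ), ∏ e ∈ T, (b e * ∏ i ∈ univ.filter (fun i => g i = e), h i) =
      (∏ e ∈ T, b e) * ∏ i, (if g i ∈ T then h i else 1) := by
    intro T h
    rw [prod_mul_distrib]
    congr 1
    rw [← prod_filter]
    rw [← prod_fiberwise_of_maps_to (s := univ.filter (fun i => g i ∈ T)) (t := T) (g := g) (fun i hi => (mem_filter.1 hi).2)]
    refine prod_congr rfl fun e he => ?_
    refine prod_congr ?_ fun _ _ => rfl
    ext i
    simp only [mem_filter, mem_univ, true_and]
    constructor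
    · rintro rfl; exact ⟨he, rfl⟩
    · exact fun h => h.2
  simp_rw [prod_add, key]
  rw [ex_sum]
  refine sum_congr rfl fun T _ => ?_
  simp_rw [← mul_assoc]
  rw [ex_mul]
  congr 1
  have := ex_prod p (fun i c => if g i ∈ univ \ T then (if c then (0 : ℝ) else 1) else 1)
  rw [this]
  refine prod_congr rfl fun i _ => ?_
  split_ifs <;> simp_all

lemma pr_point (q : κ → ℝ) (η : κ → Bool) : wt q η = ∏ e, ((if η e then 1 else 0) + (if η e then -1 else 1) * (1 - q e)) := by
  unfold wt
  refine prod_congr rfl fun e _ => ?_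
  split_ifs <;> ring

lemma ind_push (g : ι → κ) (ω : ι → Bool) (η : κ → Bool) :
    ind (push g ω = η) = ∏ e, ((if η e then 1 else 0) + (if η e then -1 else 1) * ∏ i ∈ univ.filter (fun i => g i = e), (if ω i then (0 : ℝ) else 1)) := by
  have h : ∀ e, ((if η e then (1 : ℝ) else 0) + (if η e then -1 else 1) * ∏ i ∈ univ.filter (fun i => g i = e), (if ω i then (0 : ℝ) else 1)) = if push g ω e = η e then 1 else 0 := by
    intro e
    by_cases hp : ∃ i, g i = e ∧ ω i = true
    · have h1 : push g ω e = true := by simp [push, hp]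
      obtain ⟨i, hi, hw⟩ := hp
      rw [prod_eq_zero (i := i) (by simp [hi]) (by simp [hw]), h1]
      cases η e <;> simp
    · have h1 : push g ω e = false := by simp only [push, hp]; simp
      push Not at hp
      rw [prod_eq_one (fun i hi => by
        have := hp i (by simpa using hi)
        simp [this]), h1]
      cases η e <;> simp
  rw [prod_congr rfl (fun e _ => h e)]
  by_cases hE : push g ω = η
  · rw [ind_true hE, hE]; simp
  · rw [ind_false hE]
    obtain ⟨e, he⟩ := Function.ne_iff.1 hE
    exact (prod_eq_zero (mem_univ e) (by simp [he])).symm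

lemma ex_push (p : ι → ℝ) (g : ι → κ) (F : (κ → Bool) → ℝ) :
    Ex p (fun ω => F (push g ω)) = Ex (fun e => 1 - ∏ i ∈ univ.filter (fun i => g i = e), (1 - p i)) F := by
  have h1 : ∀ ω, F (push g ω) = ∑ η, F η * ind (push g ω = η) := by
    intro ω
    rw [sum_eq_single (push g ω) (fun η _ h => by rw [ind_false (fun h' => h h'.symm), mul_zero]) (fun h => absurd (mem_univ _) h), ind_true rfl, mul_one]
  simp_rw [h1]
  rw [ex_sum]
  conv_rhs => rw [Ex]
  refine sum_congr rfl fun η _ => ?_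
  rw [ex_mul, mul_comm]
  congr 1
  simp_rw [ind_push]
  rw [ex_fib, pr_point]
  simp

lemma ex_elim {ι' : Type*} [Fintype ι'] [DecidableEq ι'] (p : ι → ℝ) (q : ι' → ℝ) (F : (ι ⊕ ι' → Bool) → ℝ) :
    Ex (Sum.elim p q) F = Ex p (fun a => Ex q (fun b => F (Sum.elim a b))) := by
  unfold Ex
  rw [← Equiv.sum_comp (Equiv.sumArrowEquivProdArrow ι ι' Bool).symm, Fintype.sum_prod_type]
  refine sum_congr rfl fun a _ => ?_
  rw [mul_sum]
  refine sum_congr rfl fun b _ => ?_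
  have : wt (Sum.elim p q) (Sum.elim a b) = wt p a * wt q b := by
    unfold wt
    rw [Fintype.prod_sum_type]
    rfl
  change wt (Sum.elim p q) (Sum.elim a b) * F (Sum.elim a b) = _
  rw [this]; ring

lemma ex_const (p : ι → ℝ) (c : ℝ) : Ex p (fun _ => c) = c := by
  have := ex_mul p c (fun _ => 1)
  rw [ex_one] at this
  simpa using this

/-- The graph of a configuration of edges. -/
def grf {n : ℕ} (η : Sym2 (Fin n) → Bool) : SimpleGraph (Fin n) where
  Adj x y := x ≠ y ∧ η s(x, y) = true
  symm := ⟨fun x y h => ⟨h.1.symm, by rw [Sym2.eq_swap]; exact h.2⟩⟩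
  loopless := ⟨fun x h => h.1 rfl⟩

end PartE3
end CF

set_option linter.unusedSectionVars false
set_option linter.unusedVariables false
set_option linter.unusedSimpArgs false
namespace CF
open Finset

section PartE4

open Classical in
lemma ind_grf {n : ℕ} (η : Sym2 (Fin n) → Bool) (H : SimpleGraph (Fin n)) :
    ind (grf η = H) = ∏ e : Sym2 (Fin n), (if e.IsDiag then (1 : ℝ) else if η e = decide (e ∈ H.edgeSet) then 1 else 0) := by
  by_cases h : grf η = H
  · rw [ind_true h]
    symm
    refine prod_eq_one fun e _ => ?_
    induction e using Sym2.inductionOn with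
    | _ x y =>
      by_cases hxy : x = y
      · simp [hxy]
      · have : η s(x, y) = decide (s(x, y) ∈ H.edgeSet) := by
          subst h
          rw [Bool.eq_iff_iff]
          simp [grf, hxy]
        rw [if_pos this]
        simp
  · rw [ind_false h]
    symm
    have : ∃ x y, ¬ ((grf η).Adj x y ↔ H.Adj x y) := by
      by_contra hcon
      push Not at hcon
      apply h
      ext x y
      exact hcon x y
    obtain ⟨x, y, hxy⟩ := this
    have hne : x ≠ y := by
      rintro rfl
      simp at hxy
    refine prod_eq_zero (mem_univ s(x, y)) ?_
    have h2 : ¬ (η s(x, y) = decide (s(x, y) ∈ H.edgeSet)) := by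
      intro h3
      apply hxy
      rw [Bool.eq_iff_iff] at h3
      simpa [grf, hne] using h3
    rw [if_neg (by simpa using hne), if_neg h2]

lemma ex_grf (n : ℕ) (p : ℝ) (q : Sym2 (Fin n) → ℝ) (hq : ∀ e, ¬ e.IsDiag → q e = p) (H : SimpleGraph (Fin n)) :
    Ex q (fun η => ind (grf η = H)) = p ^ H.edgeSet.ncard * (1 - p) ^ (n.choose 2 - H.edgeSet.ncard) := by
  classical
  simp_rw [ind_grf]
  rw [ex_prod q (fun e b => if e.IsDiag then (1 : ℝ) else if b = decide (e ∈ H.edgeSet) then 1 else 0)]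
  set D : Finset (Sym2 (Fin n)) := univ.filter (fun e => ¬ e.IsDiag) with hD
  have hDcard : D.card = n.choose 2 := by
    have := Sym2.card_subtype_not_diag (α := Fin n)
    rw [Fintype.card_fin, Fintype.card_subtype] at this
    rw [← this]
  set Ed : Finset (Sym2 (Fin n)) := univ.filter (fun e => e ∈ H.edgeSet) with hEd
  have hEcard : H.edgeSet.ncard = Ed.card := by
    rw [← Set.ncard_coe_finset]
    congr 1
    ext e
    simp [hEd]
  have hsub : Ed ⊆ D := by
    intro e he
    simp only [hEd, hD, mem_filter, mem_univ, true_and] at he ⊢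
    exact H.not_isDiag_of_mem_edgeSet he
  have h1 : ∀ e : Sym2 (Fin n), (q e * (if e.IsDiag then (1 : ℝ) else if true = decide (e ∈ H.edgeSet) then 1 else 0) +
      (1 - q e) * (if e.IsDiag then (1 : ℝ) else if false = decide (e ∈ H.edgeSet) then 1 else 0)) =
      if e ∈ D then (if e ∈ Ed then p else 1 - p) else 1 := by
    intro e
    by_cases hd : e.IsDiag
    · simp [hd, hD]
    · by_cases he : e ∈ H.edgeSet
      · simp [hd, hD, hEd, he, hq e hd]
      · simp [hd, hD, hEd, he, hq e hd]
  rw [prod_congr rfl (fun e _ => h1 e), prod_ite_mem, univ_inter, prod_ite, prod_const, prod_const, hEcard]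
  congr 2
  · congr 1
    ext e
    simp only [mem_filter]
    exact ⟨fun h => h.2, fun h => ⟨hsub h, h⟩⟩
  · rw [← hDcard, ← card_sdiff_of_subset hsub]
    congr 1
    ext e
    simp

lemma gnp_eq (n : ℕ) (p : ℝ) (q : Sym2 (Fin n) → ℝ) (hq : ∀ e, ¬ e.IsDiag → q e = p) (A : SimpleGraph (Fin n) → Prop) :
    gnpProb n p A = Ex q (fun η => ind (A (grf η))) := by
  classical
  have h1 : ∀ η : Sym2 (Fin n) → Bool, ind (A (grf η)) = ∑ H : SimpleGraph (Fin n), ind (A H) * ind (grf η = H) := by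
    intro η
    rw [sum_eq_single (grf η) (fun H _ h => by rw [ind_false (E := grf η = H) (fun h' => h h'.symm), mul_zero]) (fun h => absurd (mem_univ _) h), ind_true (E := grf η = grf η) rfl, mul_one]
  simp_rw [h1]
  rw [ex_sum]
  simp_rw [ex_mul, ex_grf n p q hq]
  unfold gnpProb
  have := _root_.tsum_subtype {G : SimpleGraph (Fin n) | A G} (fun H => p ^ H.edgeSet.ncard * (1 - p) ^ (n.choose 2 - H.edgeSet.ncard))
  refine this.trans ?_
  rw [tsum_fintype]
  refine sum_congr rfl fun H _ => ?_
  by_cases hA : A H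
  · rw [Set.indicator_of_mem (by exact hA), ind_true hA, one_mul]
  · rw [Set.indicator_of_notMem (by exact hA), ind_false hA, zero_mul]

lemma gnp_le_one (n : ℕ) (p : ℝ) (h0 : 0 ≤ p) (h1 : p ≤ 1) (A : SimpleGraph (Fin n) → Prop) : gnpProb n p A ≤ 1 := by
  rw [gnp_eq n p (fun _ => p) (fun _ _ => rfl)]
  exact pr_le_one (fun _ => h0) (fun _ => h1) _

end PartE4
end CF

set_option linter.unusedSectionVars false
set_option linter.unusedVariables false
set_option linter.unusedSimpArgs false
namespace CF
open Finset

section PartE5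

/-- The edge underlying each random bit. -/
def gmap (n d : ℕ) : ((Fin n × Fin n) ⊕ ((Fin n × Fin d) × (Fin n × Fin d))) ⊕ Sym2 (Fin n) → Sym2 (Fin n) :=
  Sum.elim (Sum.elim (fun e => s(e.1, e.2)) (fun e => s(e.1.1, e.2.1))) id

lemma factor_of_succ (n N k d : ℕ) [NeZero k] (hk : 2 ≤ k) (hn : n = N * k) (B : Fin n × Fin n → Bool)
    (R : (Fin n × Fin d) × (Fin n × Fin d) → Bool) (c : Sym2 (Fin n) → Bool) (h : succF N k B R) :
    HasCycleFactor (grf (push (gmap n d) (Sum.elim (Sum.elim B R) c))) k := by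
  obtain ⟨f, hf⟩ := h
  have hN : n / k = N := by rw [hn]; exact Nat.mul_div_cancel _ (by omega)
  unfold HasCycleFactor
  rw [hN]
  refine ⟨fun c i => f (c, i), f.bijective, fun c i => ?_⟩
  have hi : (⟨((i : ℕ) + 1) % k, Nat.mod_lt _ i.pos⟩ : Fin k) = i + 1 := by
    apply Fin.ext
    rw [val_add_one]
    have := i.2
    split_ifs with h
    · simp [h]
    · simp only; exact Nat.mod_eq_of_lt (by omega)
  rw [hi]
  have hsg := sg_apply f c i
  refine ⟨?_, ?_⟩
  · intro heq
    have h1 := f.injective heq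
    have h2 : i = i + 1 := (Prod.mk.inj h1).2
    have h3 := congrArg (fun j : Fin k => (j : ℕ)) h2
    simp only [val_add_one] at h3
    have := i.2
    split_ifs at h3 <;> omega
  · beta_reduce
    rw [← hsg]
    simp only [push, decide_eq_true_eq]
    rcases hf (f (c, i)) with h | ⟨a, b, h⟩
    · exact ⟨Sum.inl (Sum.inl (f (c, i), sg f (f (c, i)))), rfl, h⟩
    · exact ⟨Sum.inl (Sum.inr ((f (c, i), a), (sg f (f (c, i)), b))), rfl, h⟩

lemma fib1 (n : ℕ) (e : Sym2 (Fin n)) : (univ.filter (fun u : Fin n × Fin n => s(u.1, u.2) = e)).card ≤ 2 := by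
  induction e using Sym2.inductionOn with
  | _ x y =>
    calc _ ≤ ({(x, y), (y, x)} : Finset (Fin n × Fin n)).card := by
          refine card_le_card fun u hu => ?_
          simp only [mem_filter, mem_univ, true_and, Sym2.eq_iff] at hu
          simp only [mem_insert, mem_singleton, Prod.ext_iff]
          exact hu
      _ ≤ 2 := card_le_two

lemma fib2 (n d : ℕ) (e : Sym2 (Fin n)) :
    (univ.filter (fun u : (Fin n × Fin d) × (Fin n × Fin d) => s(u.1.1, u.2.1) = e)).card ≤ 2 * d ^ 2 := by
  induction e using Sym2.inductionOn with
  | _ x y =>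
    calc _ ≤ (((({x} : Finset (Fin n)) ×ˢ (univ : Finset (Fin d))) ×ˢ (({y} : Finset (Fin n)) ×ˢ (univ : Finset (Fin d)))) ∪
            ((({y} : Finset (Fin n)) ×ˢ (univ : Finset (Fin d))) ×ˢ (({x} : Finset (Fin n)) ×ˢ (univ : Finset (Fin d))))).card := by
          refine card_le_card fun u hu => ?_
          simp only [mem_filter, mem_univ, true_and, Sym2.eq_iff] at hu
          simp only [mem_union, mem_product, mem_singleton, mem_univ, and_true]
          exact hu
      _ ≤ _ := card_union_le _ _
      _ = 2 * d ^ 2 := by simp [card_product]; ring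

theorem gnp_ge (n N k d : ℕ) [NeZero k] (hk : 2 ≤ k) (hn : n = N * k) (p p1 p2 : ℝ) (h10 : 0 ≤ p1) (h20 : 0 ≤ p2) (hp1 : p < 1)
    (hpp : 2 * p1 + 2 * (d : ℝ) ^ 2 * p2 ≤ p) (h21 : p2 ≤ 1) :
    Ex (fun _ => p1) (fun B : Fin n × Fin n → Bool => Ex (fun _ => p2) (fun R : (Fin n × Fin d) × (Fin n × Fin d) → Bool => ind (succF N k B R))) ≤
      gnpProb n p (fun G => HasCycleFactor G k) := by
  have hd2 : 0 ≤ 2 * (d : ℝ) ^ 2 * p2 := by positivity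
  have h11 : p1 ≤ 1 := by linarith
  set P : Sym2 (Fin n) → ℝ := fun e => (1 - p1) ^ (univ.filter (fun u : Fin n × Fin n => s(u.1, u.2) = e)).card *
    (1 - p2) ^ (univ.filter (fun u : (Fin n × Fin d) × (Fin n × Fin d) => s(u.1.1, u.2.1) = e)).card with hP
  have hPge : ∀ e, 1 - p ≤ P e := by
    intro e
    have e1 : 1 - 2 * p1 ≤ (1 - p1) ^ (univ.filter (fun u : Fin n × Fin n => s(u.1, u.2) = e)).card := by
      refine le_trans ?_ (pow_le_pow_of_le_one (by linarith) (by linarith) (fib1 n e))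
      nlinarith [sq_nonneg p1]
    have e2 : 1 - 2 * (d : ℝ) ^ 2 * p2 ≤ (1 - p2) ^ (univ.filter (fun u : (Fin n × Fin d) × (Fin n × Fin d) => s(u.1.1, u.2.1) = e)).card := by
      refine le_trans ?_ (pow_le_pow_of_le_one (by linarith) (by linarith) (fib2 n d e))
      have := one_add_mul_le_pow (a := -p2) (by linarith) (2 * d ^ 2)
      push_cast at this
      rw [← sub_eq_add_neg] at this
      linarith
    calc 1 - p ≤ (1 - 2 * p1) * (1 - 2 * (d : ℝ) ^ 2 * p2) := by nlinarith
      _ ≤ P e := mul_le_mul e1 e2 (by linarith) (pow_nonneg (by linarith) _)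
  have hPpos : ∀ e, 0 < P e := fun e => by linarith [hPge e]
  set r : Sym2 (Fin n) → ℝ := fun e => 1 - (1 - p) / P e with hr
  have hr0 : ∀ e, 0 ≤ r e := by
    intro e
    have : (1 - p) / P e ≤ 1 := by rw [div_le_one (hPpos e)]; exact hPge e
    simp only [hr]; linarith
  have hr1 : ∀ e, r e ≤ 1 := by
    intro e
    have : 0 ≤ (1 - p) / P e := div_nonneg (by linarith) (hPpos e).le
    simp only [hr]; linarith
  set pp : ((Fin n × Fin n) ⊕ ((Fin n × Fin d) × (Fin n × Fin d))) ⊕ Sym2 (Fin n) → ℝ :=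
    Sum.elim (Sum.elim (fun _ => p1) (fun _ => p2)) r with hppdef
  have hq : ∀ e : Sym2 (Fin n), 1 - ∏ i ∈ univ.filter (fun i => gmap n d i = e), (1 - pp i) = p := by
    intro e
    rw [prod_filter, Fintype.prod_sum_type, Fintype.prod_sum_type]
    simp only [gmap, hppdef, Sum.elim_inl, Sum.elim_inr, id]
    rw [← prod_filter, ← prod_filter, prod_const, prod_const, prod_ite_eq', if_pos (mem_univ e)]
    change 1 - P e * (1 - (1 - (1 - p) / P e)) = p
    have := (hPpos e).ne'
    field_simp
    ring
  rw [gnp_eq n p _ (fun e _ => hq e) (fun G => HasCycleFactor G k), ← ex_push pp (gmap n d) (fun η => ind (HasCycleFactor (grf η) k)), hppdef, ex_elim, ex_elim]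
  refine ex_mono (fun _ => h10) (fun _ => h11) fun B => ?_
  refine ex_mono (fun _ => h20) (fun _ => h21) fun R => ?_
  rw [← ex_const r (ind (succF N k B R))]
  refine ex_mono hr0 hr1 fun c => ?_
  exact ind_mono fun h => factor_of_succ n N k d hk hn B R c h

end PartE5
end CF

set_option linter.unusedSectionVars false
set_option linter.unusedVariables false
set_option linter.unusedSimpArgs false
namespace CF
open Finset

section PartF1

lemma log_le_K0 (n : ℕ) (hn : 8 ≤ n) : Real.log n ≤ K0 n := by
  have hn' : (8 : ℝ) ≤ n := by exact_mod_cast hn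
  have hn0 : (0 : ℝ) < n := by linarith
  have h2 : 0 < Real.log 2 := Real.log_pos (by norm_num)
  have hL : 2 ≤ Real.log n := by
    rw [Real.le_log_iff_exp_le hn0]
    have h1 := Real.exp_one_lt_d9
    have : Real.exp 2 = Real.exp 1 * Real.exp 1 := by rw [← Real.exp_add]; norm_num
    have h3 := Real.exp_pos 1
    nlinarith
  have h43 : 0 < Real.log (4 / 3) := Real.log_pos (by norm_num)
  have h43u : Real.log (4 / 3) ≤ 1 / 3 := by
    have := Real.log_le_sub_one_of_pos (by norm_num : (0 : ℝ) < 4 / 3)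
    linarith
  have h4 : Real.log (4 / 3) = 2 * Real.log 2 - Real.log 3 := by
    rw [Real.log_div (by norm_num) (by norm_num), show (4 : ℝ) = 2 ^ 2 by norm_num, Real.log_pow]
    push_cast; ring
  have e : K0 n = 2 * (Real.log 2 + Real.log n - 1) / Real.log (4 / 3) := by
    unfold K0 Real.logb
    rw [Real.log_div (by positivity) (Real.exp_pos 1).ne', Real.log_exp, Real.log_mul (by norm_num) hn0.ne', h4]
    rw [h4] at h43
    have h5 : 1 - Real.log 3 / Real.log 2 / 2 ≠ 0 := by
      have : 1 - Real.log 3 / Real.log 2 / 2 = (2 * Real.log 2 - Real.log 3) / (2 * Real.log 2) := by field_simp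
      rw [this]
      positivity
    rw [div_eq_div_iff h5 h43.ne']
    field_simp
  rw [e, le_div_iff₀ h43]
  nlinarith

lemma log_small (c : ℝ) : ∃ n0 : ℕ, ∀ n : ℕ, n0 ≤ n → c * Real.log n / n < 1 := by
  have h1 : Filter.Tendsto (fun x : ℝ => Real.log x / x) Filter.atTop (nhds 0) := by
    have := Real.isLittleO_log_id_atTop.tendsto_div_nhds_zero
    simpa using this
  have h2 : Filter.Tendsto (fun n : ℕ => c * (Real.log n / n)) Filter.atTop (nhds (c * 0)) :=
    (h1.comp tendsto_natCast_atTop_atTop).const_mul c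
  rw [mul_zero] at h2
  obtain ⟨n0, h⟩ := Filter.eventually_atTop.1 (h2.eventually_lt_const one_pos)
  exact ⟨n0, fun n hn => by have := h n hn; rwa [← mul_div_assoc] at this⟩

theorem main_ev (ε η : ℝ) (hε : 0 < ε) (hη : 0 < η) (hη1 : η < 1) : ∃ n0 : ℕ, ∀ (n N k : ℕ), n0 ≤ n → n = N * k → Real.log n ≤ k →
    1 - 3 * η ≤ gnpProb n ((2 + ε) * Real.log n / n) (fun G => HasCycleFactor G k) := by
  obtain ⟨γ, hγ, hγ1, d, hd, n1, hcount⟩ := count_good η hη hη1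
  have hd0 : (3 : ℝ) ≤ d := by exact_mod_cast hd
  set μ : ℝ := ε / (8 * d) with hμ
  have hμ0 : 0 < μ := by positivity
  obtain ⟨n2, hperm⟩ := perm_whp (ε / 4) η (by positivity) hη
  obtain ⟨n3, hcore⟩ := core_whp μ γ η hμ0 hγ hγ1 hη d (by omega)
  obtain ⟨n4, hsmall⟩ := log_small (2 + ε)
  refine ⟨n1 + n2 + n3 + n4 + ⌈Real.exp 2⌉₊ + 2, ?_⟩
  intro n N k hn hnk hlog
  have hL := nat_ge_exp 2 n (by omega)
  have hk2 : 2 ≤ k := by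
    have : (2 : ℝ) ≤ k := hL.trans hlog
    exact_mod_cast this
  haveI : NeZero k := ⟨by omega⟩
  have hn0 : (0 : ℝ) < n := by exact_mod_cast (by omega : 0 < n)
  have hp := hsmall n (by omega)
  set L := Real.log n with hLdef
  have hLn : 0 < L / n := div_pos (by linarith) hn0
  have ep : (2 + ε) * L / n = (2 + ε) * (L / n) := by ring
  have ep1 : (1 + ε / 4) * L / n = (1 + ε / 4) * (L / n) := by ring
  have ep2 : 2 * (d : ℝ) ^ 2 * (μ * L / (d * n)) = ε / 4 * (L / n) := by
    rw [hμ]; field_simp; norm_num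
  have hp20 : 0 ≤ μ * L / (d * n) := by positivity
  have hεL : 0 < ε * (L / n) := by positivity
  have hpp : 2 * ((1 + ε / 4) * L / n) + 2 * (d : ℝ) ^ 2 * (μ * L / (d * n)) ≤ (2 + ε) * L / n := by
    rw [ep2, ep1, ep]
    linarith
  have hp10 : 0 ≤ (1 + ε / 4) * L / n := by rw [ep1]; positivity
  have hp11 : (1 + ε / 4) * L / n ≤ 1 := by
    have : 0 ≤ 2 * (d : ℝ) ^ 2 * (μ * L / (d * n)) := by positivity
    linarith
  have hp21 : μ * L / (d * n) ≤ 1 := by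
    have h1 : μ * L / (d * n) ≤ 2 * (d : ℝ) ^ 2 * (μ * L / (d * n)) := by
      refine le_mul_of_one_le_left hp20 ?_
      nlinarith
    linarith
  obtain ⟨D1, SD, hSDp, hSD⟩ := hcore n (by omega) hp21
  have hB := hperm n (by omega) hp11
  have hmain := symm_main (V := Fin n) (d := d) N k ((1 + ε / 4) * L / n) (μ * L / (d * n)) hp10 hp11 hp20 hp21 η hη1.le D1
    (fun S => (n : ℝ) - S.card ≤ γ * n)
    (fun S hS => by
      have := hcount n N k (by omega) (by rw [Fintype.card_fin]; exact hnk) hlog S hS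
      rwa [Fintype.card_fin]) SD hSD
  refine le_trans ?_ (hmain.trans (gnp_ge n N k d hk2 hnk ((2 + ε) * L / n) _ _ hp10 hp20 hp hpp hp21))
  have hη' : 0 ≤ 1 - η := by linarith
  calc 1 - 3 * η ≤ (1 - η) * (1 - η) * (1 - η) := by nlinarith [mul_nonneg hη.le hη.le, mul_nonneg (mul_nonneg hη.le hη.le) hη']
    _ ≤ _ := mul_le_mul (mul_le_mul_of_nonneg_left hB hη') hSDp hη' (mul_nonneg hη' (pr_nonneg (fun _ => hp10) (fun _ => hp11) _))

end PartF1
end CF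

theorem stmt18 (ε : ℝ) (hε : 0 < ε) (N k : ℕ → ℕ)
    (hN : Filter.Tendsto N Filter.atTop Filter.atTop)
    (hdvd : ∀ i, k i ∣ N i) (hK : ∀ i, K0 (N i) ≤ (k i : ℝ)) :
    Filter.Tendsto
      (fun i => gnpProb (N i) ((2 + ε) * Real.log (N i) / N i)
        (fun G => HasCycleFactor G (k i)))
      Filter.atTop (nhds 1) := by
  rw [Metric.tendsto_atTop]
  intro ρ hρ
  set η : ℝ := min (1 / 2) (ρ / 6) with hη
  have hη0 : 0 < η := lt_min (by norm_num) (by positivity)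
  have hη1 : η < 1 := lt_of_le_of_lt (min_le_left _ _) (by norm_num)
  have hηρ : η ≤ ρ / 6 := min_le_right _ _
  obtain ⟨n0, h0⟩ := CF.main_ev ε η hε hη0 hη1
  obtain ⟨n1, h1⟩ := CF.log_small (2 + ε)
  obtain ⟨i0, hi0⟩ := Filter.eventually_atTop.1 (hN.eventually_ge_atTop (n0 + n1 + 8))
  refine ⟨i0, fun i hi => ?_⟩
  have hNi := hi0 i hi
  have hlog := (CF.log_le_K0 (N i) (by omega)).trans (hK i)
  have hlow := h0 (N i) (N i / k i) (k i) (by omega) (Nat.div_mul_cancel (hdvd i)).symm hlog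
  have hp1 := h1 (N i) (by omega)
  have hn8 : (1 : ℝ) ≤ N i := by exact_mod_cast (by omega : 1 ≤ N i)
  have hp0 : 0 ≤ (2 + ε) * Real.log (N i) / N i := by
    have := Real.log_nonneg hn8
    positivity
  have hup := CF.gnp_le_one (N i) _ hp0 hp1.le (fun G => HasCycleFactor G (k i))
  rw [Real.dist_eq, abs_lt]
  constructor <;> linarith
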